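/- Let A be a compact homologically smooth DG algebra over a field k. Then there exists a canonical non-degenerate pairing HH_n(A) × HH_{-n}(A) → k for every integer n. -/

import Mathlib

/- Framework: differential graded algebras (internal ℤ-grading), right DG modules,
DG bimodules, homotopy-theoretic notions (twisted modules, perfectness,
homological smoothness), cohomology and Hochschild homology. -/

open DirectSum TensorProduct

noncomputable section
set_option linter.unusedVariables false

/-- `(-1)^i` for `i : ℤ`, valued in `ℤ`. -/
def sgnz (i : ℤ) : ℤ := if Even i then 1 else -1

/-- `(-1)^i` for `i : ℤ`, valued in a field `k`. -/
def sgnk (k : Type) [Field k] (i : ℤ) : k := if Even i then 1 else -1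

/-- A differential graded algebra over a field `k`: a `k`-algebra with an internal
ℤ-grading and a square-zero degree `+1` differential satisfying the graded Leibniz rule. -/
structure DGAlgebra (k : Type) [Field k] : Type 1 where
  R : Type
  [ring : Ring R]
  [alg : Algebra k R]
  gr : ℤ → Submodule k R
  [dec : DirectSum.Decomposition gr]
  one_mem : (1 : R) ∈ gr 0
  mul_mem : ∀ {i j : ℤ} {x y : R}, x ∈ gr i → y ∈ gr j → x * y ∈ gr (i + j)
  d : R →ₗ[k] R
  d_deg : ∀ (i : ℤ), ∀ x ∈ gr i, d x ∈ gr (i + 1)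
  d_sq : ∀ x : R, d (d x) = 0
  leibniz : ∀ (i : ℤ), ∀ x ∈ gr i, ∀ y : R,
    d (x * y) = d x * y + sgnz i • (x * d y)

attribute [instance] DGAlgebra.ring DGAlgebra.alg DGAlgebra.dec

variable {k : Type} [Field k]

/-- A right DG module over a DG algebra `A`.  The right action of `x : A` on `m`
is written `act x m` (representing `m · x`). -/
structure DGMod (A : DGAlgebra k) : Type 1 where
  M : Type
  [acg : AddCommGroup M]
  [kmod : Module k M]
  gm : ℤ → Submodule k M
  [dec : DirectSum.Decomposition gm]
  act : A.R →ₗ[k] M →ₗ[k] M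
  act_one : ∀ m : M, act 1 m = m
  act_mul : ∀ (x y : A.R) (m : M), act (x * y) m = act y (act x m)
  act_deg : ∀ (i j : ℤ) (x : A.R) (m : M), x ∈ A.gr i → m ∈ gm j → act x m ∈ gm (j + i)
  D : M →ₗ[k] M
  D_deg : ∀ (j : ℤ), ∀ m ∈ gm j, D m ∈ gm (j + 1)
  D_sq : ∀ m : M, D (D m) = 0
  leibniz : ∀ (i j : ℤ) (x : A.R) (m : M), x ∈ A.gr i → m ∈ gm j →
    D (act x m) = act x (D m) + sgnz j • act (A.d x) m

attribute [instance] DGMod.acg DGMod.kmod DGMod.dec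

variable {A : DGAlgebra k}

/-- Morphisms of right DG modules (closed, degree 0). -/
structure DGHom (X Y : DGMod A) where
  f : X.M →ₗ[k] Y.M
  deg : ∀ (j : ℤ), ∀ m ∈ X.gm j, f m ∈ Y.gm j
  actc : ∀ (x : A.R) (m : X.M), f (X.act x m) = Y.act x (f m)
  comm : ∀ m : X.M, f (X.D m) = Y.D (f m)

/-- The identity morphism. -/
def DGHom.id (X : DGMod A) : DGHom X X :=
  ⟨LinearMap.id, fun _ _ h => h, fun _ _ => rfl, fun _ => rfl⟩

/-- Composition of morphisms of DG modules. -/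
def DGHom.comp {X Y Z : DGMod A} (G : DGHom Y Z) (F : DGHom X Y) : DGHom X Z :=
  ⟨G.f ∘ₗ F.f, fun j m h => G.deg j _ (F.deg j m h),
    fun x m => by simp [LinearMap.comp_apply, F.actc, G.actc],
    fun m => by simp [LinearMap.comp_apply, F.comm, G.comm]⟩

/-- The zero morphism. -/
def DGHom.zero (X Y : DGMod A) : DGHom X Y :=
  ⟨0, fun j _ _ => (Y.gm j).zero_mem, fun _ _ => by simp, fun _ => by simp⟩

/-- Chain homotopy between two morphisms of DG modules. -/
def Homotopic {X Y : DGMod A} (F G : DGHom X Y) : Prop :=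
  ∃ h : X.M →ₗ[k] Y.M,
    (∀ (j : ℤ), ∀ m ∈ X.gm j, h m ∈ Y.gm (j - 1)) ∧
    (∀ (x : A.R) (m : X.M), h (X.act x m) = Y.act x (h m)) ∧
    ∀ m : X.M, F.f m - G.f m = Y.D (h m) + h (X.D m)

/-- Cycles of degree `n` of a complex given by a grading and a differential. -/
def Zg {M : Type} [AddCommGroup M] [Module k M]
    (gm : ℤ → Submodule k M) (Dm : M →ₗ[k] M) (n : ℤ) : Submodule k M :=
  gm n ⊓ LinearMap.ker Dm

/-- Boundaries of degree `n`. -/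
def Bg {M : Type} [AddCommGroup M] [Module k M]
    (gm : ℤ → Submodule k M) (Dm : M →ₗ[k] M) (n : ℤ) : Submodule k M :=
  gm n ⊓ LinearMap.range Dm

/-- Degree `n` cohomology of a complex. -/
def Hg {M : Type} [AddCommGroup M] [Module k M]
    (gm : ℤ → Submodule k M) (Dm : M →ₗ[k] M) (n : ℤ) : Type :=
  ↥(Zg gm Dm n) ⧸ (Submodule.comap (Zg gm Dm n).subtype (Bg gm Dm n))

instance {M : Type} [AddCommGroup M] [Module k M]
    (gm : ℤ → Submodule k M) (Dm : M →ₗ[k] M) (n : ℤ) : AddCommGroup (Hg gm Dm n) := by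
  unfold Hg; infer_instance

instance {M : Type} [AddCommGroup M] [Module k M]
    (gm : ℤ → Submodule k M) (Dm : M →ₗ[k] M) (n : ℤ) : Module k (Hg gm Dm n) := by
  unfold Hg; infer_instance

/-- `f` induces an isomorphism on the homology of two complexes presented by
(families of) cycle and boundary submodules. -/
def InducesHIso {M₁ M₂ : Type} [AddCommGroup M₁] [Module k M₁] [AddCommGroup M₂] [Module k M₂]
    (Z₁ B₁ : ℤ → Submodule k M₁) (Z₂ B₂ : ℤ → Submodule k M₂) (f : M₁ →ₗ[k] M₂) : Prop :=
  (∀ n : ℤ, ∀ x ∈ Z₁ n, f x ∈ Z₂ n) ∧ (∀ n : ℤ, ∀ x ∈ B₁ n, f x ∈ B₂ n) ∧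
  ∀ n : ℤ, (∀ z ∈ Z₂ n, ∃ w ∈ Z₁ n, f w - z ∈ B₂ n) ∧
    (∀ w ∈ Z₁ n, f w ∈ B₂ n → w ∈ B₁ n)

/-- Quasi-isomorphism of complexes, in elementary terms. -/
def QIsoData {M₁ M₂ : Type} [AddCommGroup M₁] [Module k M₁] [AddCommGroup M₂] [Module k M₂]
    (gm₁ : ℤ → Submodule k M₁) (D₁ : M₁ →ₗ[k] M₁)
    (gm₂ : ℤ → Submodule k M₂) (D₂ : M₂ →ₗ[k] M₂) (f : M₁ →ₗ[k] M₂) : Prop :=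
  InducesHIso (Zg gm₁ D₁) (Bg gm₁ D₁) (Zg gm₂ D₂) (Bg gm₂ D₂) f

/-- A morphism of DG modules is a quasi-isomorphism if it induces isomorphisms on
all cohomology groups. -/
def IsQuasiIso {X Y : DGMod A} (F : DGHom X Y) : Prop :=
  QIsoData X.gm X.D Y.gm Y.D F.f

/-- A DG module is acyclic if all its cohomology vanishes. -/
def AcyclicM (X : DGMod A) : Prop := ∀ n : ℤ, Zg X.gm X.D n ≤ Bg X.gm X.D n

/-- The `A`-submodule of a right DG module generated by a set. -/
def rSpan (X : DGMod A) (S : Set X.M) : Submodule k X.M :=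
  sInf {p : Submodule k X.M | S ⊆ ↑p ∧ ∀ (x : A.R) (m : X.M), m ∈ p → X.act x m ∈ p}

/-- Twisted modules: finitely generated semi-free right DG `A`-modules, i.e.
modules with a finite homogeneous basis `e` such that `D (e j)` lies in the
`A`-span of the previous basis elements ("strictly upper triangular" twisting). -/
def IsTwisted (T : DGMod A) : Prop :=
  ∃ (s : ℕ) (r : Fin s → ℤ) (e : Fin s → T.M),
    (∀ j, e j ∈ T.gm (-(r j))) ∧
    (∀ j, T.D (e j) ∈ rSpan T (e '' {i | i < j})) ∧
    Function.Bijective (fun v : Fin s → A.R => ∑ j, T.act (v j) (e j))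

/-- `P` is a homotopy direct summand of `T`. -/
def IsHoSummand (P T : DGMod A) : Prop :=
  ∃ (ι : DGHom P T) (ρ : DGHom T P), Homotopic (ρ.comp ι) (DGHom.id P)

/-- A perfect DG module: one admitting a resolution by a homotopy direct summand
of a twisted module. -/
def IsPerfect (N : DGMod A) : Prop :=
  ∃ T P : DGMod A, IsTwisted T ∧ IsHoSummand P T ∧ ∃ F : DGHom P N, IsQuasiIso F

/-- Homotopically projective (K-projective) DG modules. -/
def IsHoProjM (P : DGMod A) : Prop :=
  ∀ N : DGMod A, AcyclicM N → ∀ F : DGHom P N, Homotopic F (DGHom.zero P N)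

/-- Compactness of a DG algebra: the total cohomology is finite dimensional. -/
def IsCompactAlg (A : DGAlgebra k) : Prop :=
  (∀ n : ℤ, FiniteDimensional k (Hg A.gr A.d n)) ∧
    {n : ℤ | ¬ Subsingleton (Hg A.gr A.d n)}.Finite
/-- The grading operator on a graded module scaling the degree `j` component by `c j`. -/
def gop {M : Type} [AddCommGroup M] [Module k M]
    (gm : ℤ → Submodule k M) [DirectSum.Decomposition gm] (c : ℤ → k) : M →ₗ[k] M :=
  (DirectSum.toModule k ℤ M (fun j => c j • (gm j).subtype)) ∘ₗ
    (DirectSum.decomposeLinearEquiv gm).toLinearMap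

/-- A DG bimodule over `A` (equivalently, a right DG module over `Aᵉ = Aᵒᵖ ⊗ A`). -/
structure DGBimod (A : DGAlgebra k) : Type 1 where
  M : Type
  [acg : AddCommGroup M]
  [kmod : Module k M]
  gm : ℤ → Submodule k M
  [dec : DirectSum.Decomposition gm]
  actL : A.R →ₗ[k] M →ₗ[k] M
  actR : A.R →ₗ[k] M →ₗ[k] M
  actL_one : ∀ m : M, actL 1 m = m
  actR_one : ∀ m : M, actR 1 m = m
  actL_mul : ∀ (x y : A.R) (m : M), actL (x * y) m = actL x (actL y m)
  actR_mul : ∀ (x y : A.R) (m : M), actR (x * y) m = actR y (actR x m)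
  actLR : ∀ (x y : A.R) (m : M), actL x (actR y m) = actR y (actL x m)
  actL_deg : ∀ (i j : ℤ) (x : A.R) (m : M), x ∈ A.gr i → m ∈ gm j → actL x m ∈ gm (i + j)
  actR_deg : ∀ (i j : ℤ) (x : A.R) (m : M), x ∈ A.gr i → m ∈ gm j → actR x m ∈ gm (j + i)
  D : M →ₗ[k] M
  D_deg : ∀ (j : ℤ), ∀ m ∈ gm j, D m ∈ gm (j + 1)
  D_sq : ∀ m : M, D (D m) = 0
  leibnizL : ∀ (i j : ℤ) (x : A.R) (m : M), x ∈ A.gr i → m ∈ gm j →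
    D (actL x m) = actL (A.d x) m + sgnz i • actL x (D m)
  leibnizR : ∀ (i j : ℤ) (x : A.R) (m : M), x ∈ A.gr i → m ∈ gm j →
    D (actR x m) = actR x (D m) + sgnz j • actR (A.d x) m

attribute [instance] DGBimod.acg DGBimod.kmod DGBimod.dec

/-- Morphisms of DG bimodules (closed, degree 0). -/
structure BimodHom {A : DGAlgebra k} (X Y : DGBimod A) where
  f : X.M →ₗ[k] Y.M
  deg : ∀ (j : ℤ), ∀ m ∈ X.gm j, f m ∈ Y.gm j
  actLc : ∀ (x : A.R) (m : X.M), f (X.actL x m) = Y.actL x (f m)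
  actRc : ∀ (x : A.R) (m : X.M), f (X.actR x m) = Y.actR x (f m)
  comm : ∀ m : X.M, f (X.D m) = Y.D (f m)

def BimodHom.id (X : DGBimod A) : BimodHom X X :=
  ⟨LinearMap.id, fun _ _ h => h, fun _ _ => rfl, fun _ _ => rfl, fun _ => rfl⟩

def BimodHom.comp {X Y Z : DGBimod A} (G : BimodHom Y Z) (F : BimodHom X Y) : BimodHom X Z :=
  ⟨G.f ∘ₗ F.f, fun j m h => G.deg j _ (F.deg j m h),
    fun x m => by simp [LinearMap.comp_apply, F.actLc, G.actLc],
    fun x m => by simp [LinearMap.comp_apply, F.actRc, G.actRc],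
    fun m => by simp [LinearMap.comp_apply, F.comm, G.comm]⟩

def BimodHom.zero (X Y : DGBimod A) : BimodHom X Y :=
  ⟨0, fun j _ _ => (Y.gm j).zero_mem, fun _ _ => by simp, fun _ _ => by simp, fun _ => by simp⟩

/-- Chain homotopy between morphisms of DG bimodules (with the Koszul sign for the
left action). -/
def BimodHomotopic {X Y : DGBimod A} (F G : BimodHom X Y) : Prop :=
  ∃ h : X.M →ₗ[k] Y.M,
    (∀ (j : ℤ), ∀ m ∈ X.gm j, h m ∈ Y.gm (j - 1)) ∧
    (∀ (i : ℤ) (x : A.R), x ∈ A.gr i → ∀ m : X.M, h (X.actL x m) = sgnz i • Y.actL x (h m)) ∧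
    (∀ (x : A.R) (m : X.M), h (X.actR x m) = Y.actR x (h m)) ∧
    ∀ m : X.M, F.f m - G.f m = Y.D (h m) + h (X.D m)

def AcyclicB (X : DGBimod A) : Prop := ∀ n : ℤ, Zg X.gm X.D n ≤ Bg X.gm X.D n

def IsHoProjB (P : DGBimod A) : Prop :=
  ∀ N : DGBimod A, AcyclicB N → ∀ F : BimodHom P N, BimodHomotopic F (BimodHom.zero P N)

/-- Auxiliary: the action of a homogeneous element of degree `i` in the first tensor
factor of `Aᵉ` on a bimodule, with its Koszul sign. -/
def biactAux (N : DGBimod A) (i : ℤ) : ↥(A.gr i) →ₗ[k] A.R →ₗ[k] N.M →ₗ[k] N.M where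
  toFun x :=
    { toFun := fun y => (N.actL ↑x) ∘ₗ (N.actR y) ∘ₗ (gop N.gm fun j => sgnk k (i * j))
      map_add' := by intro y z; ext m; simp
      map_smul' := by intro c y; ext m; simp }
  map_add' := by intro x z; ext y m; simp [Submodule.coe_add]
  map_smul' := by intro c x; ext y m; simp

/-- The right action of `Aᵉ = Aᵒᵖ ⊗ A` (as a `k`-module, `A.R ⊗[k] A.R`) on a DG
bimodule, with Koszul signs. -/
def biact (N : DGBimod A) : (A.R ⊗[k] A.R) →ₗ[k] N.M →ₗ[k] N.M :=
  TensorProduct.lift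
    ((DirectSum.toModule k ℤ _ (fun i => biactAux N i)) ∘ₗ
      (DirectSum.decomposeLinearEquiv A.gr).toLinearMap)

/-- The sub-bimodule generated by a set. -/
def biSpan (N : DGBimod A) (S : Set N.M) : Submodule k N.M :=
  sInf {p : Submodule k N.M | S ⊆ ↑p ∧ (∀ (x : A.R) (m : N.M), m ∈ p → N.actL x m ∈ p) ∧
    ∀ (x : A.R) (m : N.M), m ∈ p → N.actR x m ∈ p}

/-- Twisted DG bimodules: finitely generated semi-free DG `Aᵉ`-modules. -/
def IsTwistedB (T : DGBimod A) : Prop :=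
  ∃ (s : ℕ) (r : Fin s → ℤ) (e : Fin s → T.M),
    (∀ j, e j ∈ T.gm (-(r j))) ∧
    (∀ j, T.D (e j) ∈ biSpan T (e '' {i | i < j})) ∧
    Function.Bijective (fun v : Fin s → A.R ⊗[k] A.R => ∑ j, biact T (v j) (e j))

def IsHoSummandB (P T : DGBimod A) : Prop :=
  ∃ (ι : BimodHom P T) (ρ : BimodHom T P), BimodHomotopic (ρ.comp ι) (BimodHom.id P)

def IsPerfectB (N : DGBimod A) : Prop :=
  ∃ T P : DGBimod A, IsTwistedB T ∧ IsHoSummandB P T ∧ ∃ F : BimodHom P N, QIsoData P.gm P.D N.gm N.D F.f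

/-- The diagonal bimodule: `A` as a DG bimodule over itself. -/
def diagBimod (A : DGAlgebra k) : DGBimod A where
  M := A.R
  gm := A.gr
  actL := LinearMap.mul k A.R
  actR := (LinearMap.mul k A.R).flip
  actL_one := fun m => one_mul m
  actR_one := fun m => mul_one m
  actL_mul := fun x y m => mul_assoc x y m
  actR_mul := fun x y m => (mul_assoc m x y).symm
  actLR := fun x y m => (mul_assoc x m y).symm
  actL_deg := fun i j x m hx hm => A.mul_mem hx hm
  actR_deg := fun i j x m hx hm => A.mul_mem hm hx
  D := A.d
  D_deg := A.d_deg
  D_sq := A.d_sq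
  leibnizL := fun i j x m hx _ => A.leibniz i x hx m
  leibnizR := fun i j x m _ hm => A.leibniz j m hm x

/-- `A` is homologically smooth if the diagonal bimodule is perfect over `Aᵉ`. -/
def IsSmooth (A : DGAlgebra k) : Prop := IsPerfectB (diagBimod A)

/-- The graded commutator subspace `[A, P] ⊆ P` of a DG bimodule. -/
def commSub (P : DGBimod A) : Submodule k P.M :=
  Submodule.span k {z : P.M | ∃ (i j : ℤ) (x : A.R) (m : P.M), x ∈ A.gr i ∧ m ∈ P.gm j ∧
    z = P.actL x m - sgnz (i * j) • P.actR x m}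

/-- Degree-`n` cycles of the complex `P/[A,P]` (computing `P ⊗_{Aᵉ} A`), described by
representatives in `P`. -/
def HHZ (P : DGBimod A) (n : ℤ) : Submodule k P.M :=
  P.gm n ⊓ (commSub P).comap P.D

/-- Degree-`n` boundaries of the complex `P/[A,P]`, described by representatives. -/
def HHB (P : DGBimod A) (n : ℤ) : Submodule k P.M :=
  P.gm n ⊓ (commSub P ⊔ LinearMap.range P.D)

/-- The `n`-th Hochschild homology group `HH_n(A) = H^n(P ⊗_{Aᵉ} A)` computed from a
bimodule resolution `P` of the diagonal. -/
def HHspace (P : DGBimod A) (n : ℤ) : Type :=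
  ↥(HHZ P n) ⧸ (Submodule.comap (HHZ P n).subtype (HHB P n ⊓ HHZ P n))

instance (P : DGBimod A) (n : ℤ) : AddCommGroup (HHspace P n) := by
  unfold HHspace; infer_instance

instance (P : DGBimod A) (n : ℤ) : Module k (HHspace P n) := by
  unfold HHspace; infer_instance

/-- `F : P → A` is an h-projective bimodule resolution of the diagonal bimodule. -/
def IsDiagResolution {A : DGAlgebra k} (P : DGBimod A) (F : BimodHom P (diagBimod A)) : Prop :=
  IsHoProjB P ∧ QIsoData P.gm P.D (diagBimod A).gm (diagBimod A).D F.f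
/-! ### Hom complexes and Ext spaces -/

/-- The degree-`n` part of the Hom complex of two right DG `A`-modules:
`A`-linear maps shifting degrees by `n`. -/
def homGrade (X Y : DGMod A) (n : ℤ) : Submodule k (X.M →ₗ[k] Y.M) where
  carrier := {f | (∀ (j : ℤ), ∀ m ∈ X.gm j, f m ∈ Y.gm (j + n)) ∧
    ∀ (x : A.R) (m : X.M), f (X.act x m) = Y.act x (f m)}
  add_mem' := by
    rintro f g ⟨hf1, hf2⟩ ⟨hg1, hg2⟩
    refine ⟨fun j m hm => ?_, fun x m => ?_⟩
    · exact (Y.gm (j + n)).add_mem (hf1 j m hm) (hg1 j m hm)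
    · simp [hf2, hg2]
  zero_mem' := by
    refine ⟨fun j m hm => (Y.gm (j + n)).zero_mem, fun x m => by simp⟩
  smul_mem' := by
    rintro c f ⟨hf1, hf2⟩
    refine ⟨fun j m hm => (Y.gm (j + n)).smul_mem c (hf1 j m hm), fun x m => ?_⟩
    simp [hf2]

theorem mem_homGrade {X Y : DGMod A} {n : ℤ} {f : X.M →ₗ[k] Y.M} :
    f ∈ homGrade X Y n ↔ ((∀ (j : ℤ), ∀ m ∈ X.gm j, f m ∈ Y.gm (j + n)) ∧
      ∀ (x : A.R) (m : X.M), f (X.act x m) = Y.act x (f m)) := Iff.rfl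

/-- The differential of the Hom complex in degree `n`:
`f ↦ D_Y ∘ f - (-1)^n f ∘ D_X`. -/
def homDop (X Y : DGMod A) (n : ℤ) : (X.M →ₗ[k] Y.M) →ₗ[k] (X.M →ₗ[k] Y.M) :=
  (LinearMap.llcomp k X.M Y.M Y.M) Y.D - sgnz n • (LinearMap.llcomp k X.M X.M Y.M).flip X.D

/-- Closed degree-`n` `A`-linear maps. -/
def ZHomS (X Y : DGMod A) (n : ℤ) : Submodule k (X.M →ₗ[k] Y.M) :=
  homGrade X Y n ⊓ LinearMap.ker (homDop X Y n)

/-- Degree-`n` boundaries of the Hom complex. -/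
def BHomS (X Y : DGMod A) (n : ℤ) : Submodule k (X.M →ₗ[k] Y.M) :=
  Submodule.map (homDop X Y (n - 1)) (homGrade X Y (n - 1))

/-- `Hom_{Ho(A)}(X, Y[n])`: the `n`-th cohomology of the Hom complex.  For
homotopically projective `X` this computes `Hom_{D(A)}(X, Y[n])`. -/
def ExtSpace (X Y : DGMod A) (n : ℤ) : Type :=
  ↥(ZHomS X Y n) ⧸ (Submodule.comap (ZHomS X Y n).subtype (BHomS X Y n ⊓ ZHomS X Y n))

instance (X Y : DGMod A) (n : ℤ) : AddCommGroup (ExtSpace X Y n) := by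
  unfold ExtSpace; infer_instance

instance (X Y : DGMod A) (n : ℤ) : Module k (ExtSpace X Y n) := by
  unfold ExtSpace; infer_instance

/-! ### Shifts, cones, isomorphisms in the homotopy category -/

/-- `X'` realizes the shift `X[t]` (so `X'^n = X^{n+t}`). -/
def IsShiftOf (X X' : DGMod A) (t : ℤ) : Prop :=
  ∃ g : X.M ≃ₗ[k] X'.M,
    (∀ n : ℤ, ∀ m ∈ X.gm (n + t), g m ∈ X'.gm n) ∧
    (∀ (x : A.R) (m : X.M), g (X.act x m) = X'.act x (g m)) ∧
    ∀ m : X.M, g (X.D m) = sgnz t • X'.D (g m)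

/-- `C` realizes the cone of the closed morphism `F : X → Y` with canonical
inclusion `j : Y → C`. -/
def IsConeOf {X Y : DGMod A} (F : DGHom X Y) (C : DGMod A) (j : DGHom Y C) : Prop :=
  ∃ (p : C.M →ₗ[k] X.M) (s : X.M →ₗ[k] C.M) (q : C.M →ₗ[k] Y.M),
    (∀ n : ℤ, ∀ c ∈ C.gm n, p c ∈ X.gm (n + 1)) ∧
    (∀ n : ℤ, ∀ m ∈ X.gm (n + 1), s m ∈ C.gm n) ∧
    (∀ n : ℤ, ∀ c ∈ C.gm n, q c ∈ Y.gm n) ∧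
    (∀ (x : A.R) (c : C.M), p (C.act x c) = X.act x (p c)) ∧
    (∀ (x : A.R) (m : X.M), s (X.act x m) = C.act x (s m)) ∧
    (∀ (x : A.R) (c : C.M), q (C.act x c) = Y.act x (q c)) ∧
    (∀ y : Y.M, q (j.f y) = y) ∧ (∀ m : X.M, p (s m) = m) ∧
    (∀ m : X.M, q (s m) = 0) ∧ (∀ y : Y.M, p (j.f y) = 0) ∧
    (∀ c : C.M, j.f (q c) + s (p c) = c) ∧
    ∀ m : X.M, C.D (s m) = j.f (F.f m) - s (X.D m)

/-- Isomorphism in the homotopy category of DG modules. -/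
def HoIso (X Y : DGMod A) : Prop :=
  ∃ (F : DGHom X Y) (G : DGHom Y X),
    Homotopic (G.comp F) (DGHom.id X) ∧ Homotopic (F.comp G) (DGHom.id Y)
/-! ### Left DG modules (right modules over `Aᵒᵖ`) and duality complexes -/

/-- A left DG module over `A` (equivalently, a right DG module over `Aᵒᵖ`). -/
structure DGModL (A : DGAlgebra k) : Type 1 where
  M : Type
  [acg : AddCommGroup M]
  [kmod : Module k M]
  gm : ℤ → Submodule k M
  [dec : DirectSum.Decomposition gm]
  actL : A.R →ₗ[k] M →ₗ[k] M
  actL_one : ∀ m : M, actL 1 m = m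
  actL_mul : ∀ (x y : A.R) (m : M), actL (x * y) m = actL x (actL y m)
  actL_deg : ∀ (i j : ℤ) (x : A.R) (m : M), x ∈ A.gr i → m ∈ gm j → actL x m ∈ gm (i + j)
  D : M →ₗ[k] M
  D_deg : ∀ (j : ℤ), ∀ m ∈ gm j, D m ∈ gm (j + 1)
  D_sq : ∀ m : M, D (D m) = 0
  leibnizL : ∀ (i j : ℤ) (x : A.R) (m : M), x ∈ A.gr i → m ∈ gm j →
    D (actL x m) = actL (A.d x) m + sgnz i • actL x (D m)

attribute [instance] DGModL.acg DGModL.kmod DGModL.dec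

/-- Morphisms of left DG modules. -/
structure DGHomL (X Y : DGModL A) where
  f : X.M →ₗ[k] Y.M
  deg : ∀ (j : ℤ), ∀ m ∈ X.gm j, f m ∈ Y.gm j
  actc : ∀ (x : A.R) (m : X.M), f (X.actL x m) = Y.actL x (f m)
  comm : ∀ m : X.M, f (X.D m) = Y.D (f m)

def DGHomL.id (X : DGModL A) : DGHomL X X :=
  ⟨LinearMap.id, fun _ _ h => h, fun _ _ => rfl, fun _ => rfl⟩

def DGHomL.comp {X Y Z : DGModL A} (G : DGHomL Y Z) (F : DGHomL X Y) : DGHomL X Z :=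
  ⟨G.f ∘ₗ F.f, fun j m h => G.deg j _ (F.deg j m h),
    fun x m => by simp [LinearMap.comp_apply, F.actc, G.actc],
    fun m => by simp [LinearMap.comp_apply, F.comm, G.comm]⟩

def HomotopicL {X Y : DGModL A} (F G : DGHomL X Y) : Prop :=
  ∃ h : X.M →ₗ[k] Y.M,
    (∀ (j : ℤ), ∀ m ∈ X.gm j, h m ∈ Y.gm (j - 1)) ∧
    (∀ (i : ℤ) (x : A.R), x ∈ A.gr i → ∀ m : X.M, h (X.actL x m) = sgnz i • Y.actL x (h m)) ∧
    ∀ m : X.M, F.f m - G.f m = Y.D (h m) + h (X.D m)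

def lSpan (X : DGModL A) (S : Set X.M) : Submodule k X.M :=
  sInf {p : Submodule k X.M | S ⊆ ↑p ∧ ∀ (x : A.R) (m : X.M), m ∈ p → X.actL x m ∈ p}

def IsTwistedL (T : DGModL A) : Prop :=
  ∃ (s : ℕ) (r : Fin s → ℤ) (e : Fin s → T.M),
    (∀ j, e j ∈ T.gm (-(r j))) ∧
    (∀ j, T.D (e j) ∈ lSpan T (e '' {i | i < j})) ∧
    Function.Bijective (fun v : Fin s → A.R => ∑ j, T.actL (v j) (e j))

def IsHoSummandL (P T : DGModL A) : Prop :=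
  ∃ (ι : DGHomL P T) (ρ : DGHomL T P), HomotopicL (ρ.comp ι) (DGHomL.id P)

def IsPerfectL (N : DGModL A) : Prop :=
  ∃ T P : DGModL A, IsTwistedL T ∧ IsHoSummandL P T ∧
    ∃ F : DGHomL P N, QIsoData P.gm P.D N.gm N.D F.f

/-- The degree-`n` part of the complex `Hom_A(X, A)` of right `A`-module maps into `A`. -/
def rHomGrade (X : DGMod A) (n : ℤ) : Submodule k (X.M →ₗ[k] A.R) where
  carrier := {g | (∀ (j : ℤ), ∀ m ∈ X.gm j, g m ∈ A.gr (j + n)) ∧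
    ∀ (x : A.R) (m : X.M), g (X.act x m) = g m * x}
  add_mem' := by
    rintro f g ⟨hf1, hf2⟩ ⟨hg1, hg2⟩
    exact ⟨fun j m hm => (A.gr (j + n)).add_mem (hf1 j m hm) (hg1 j m hm),
      fun x m => by simp [hf2, hg2, add_mul]⟩
  zero_mem' := ⟨fun j m hm => (A.gr (j + n)).zero_mem, fun x m => by simp⟩
  smul_mem' := by
    rintro c f ⟨hf1, hf2⟩
    exact ⟨fun j m hm => (A.gr (j + n)).smul_mem c (hf1 j m hm),
      fun x m => by simp [hf2, Algebra.smul_mul_assoc]⟩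

/-- `V` realizes the dual complex `X^∨ = RHom_A(X, A)` of a (homotopically projective)
right DG module `X`, as a left DG module. -/
def IsRightDualOf (X : DGMod A) (V : DGModL A) : Prop :=
  ∃ Φ : V.M →ₗ[k] (X.M →ₗ[k] A.R),
    Function.Injective Φ ∧
    (∀ n : ℤ, Submodule.map Φ (V.gm n) = rHomGrade X n) ∧
    (∀ (n : ℤ), ∀ v ∈ V.gm n, Φ (V.D v) = A.d ∘ₗ Φ v - sgnz n • (Φ v ∘ₗ X.D)) ∧
    ∀ (x : A.R) (v : V.M), Φ (V.actL x v) = LinearMap.mul k A.R x ∘ₗ Φ v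

/-- The degree-`n` part of the complex `Hom_{Aᵒᵖ}(V, A)` of left `A`-module maps into `A`
(with Koszul signs for moving a degree-`n` map past a left action). -/
def lHomGrade (V : DGModL A) (n : ℤ) : Submodule k (V.M →ₗ[k] A.R) where
  carrier := {g | (∀ (j : ℤ), ∀ v ∈ V.gm j, g v ∈ A.gr (j + n)) ∧
    ∀ (i : ℤ) (x : A.R), x ∈ A.gr i → ∀ v : V.M, g (V.actL x v) = sgnz (i * n) • (x * g v)}
  add_mem' := by
    rintro f g ⟨hf1, hf2⟩ ⟨hg1, hg2⟩
    exact ⟨fun j v hv => (A.gr (j + n)).add_mem (hf1 j v hv) (hg1 j v hv),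
      fun i x hx v => by simp [hf2 i x hx, hg2 i x hx, mul_add, smul_add]⟩
  zero_mem' := ⟨fun j v hv => (A.gr (j + n)).zero_mem, fun i x hx v => by simp⟩
  smul_mem' := by
    rintro c f ⟨hf1, hf2⟩
    refine ⟨fun j v hv => (A.gr (j + n)).smul_mem c (hf1 j v hv), fun i x hx v => ?_⟩
    simp only [LinearMap.smul_apply, hf2 i x hx, Algebra.mul_smul_comm]
    rw [smul_comm]

/-- `W` realizes the bidual complex `Hom_{Aᵒᵖ}(V, A)` of a left DG module `V`,
as a right DG module. -/
def IsLeftDualOf (V : DGModL A) (W : DGMod A) : Prop :=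
  ∃ Ψ : W.M →ₗ[k] (V.M →ₗ[k] A.R),
    Function.Injective Ψ ∧
    (∀ n : ℤ, Submodule.map Ψ (W.gm n) = lHomGrade V n) ∧
    (∀ (n : ℤ), ∀ w ∈ W.gm n, Ψ (W.D w) = A.d ∘ₗ Ψ w - sgnz n • (Ψ w ∘ₗ V.D)) ∧
    ∀ (x : A.R) (w : W.M), Ψ (W.act x w) = (LinearMap.mul k A.R).flip x ∘ₗ Ψ w

/-- The degree-`j` part of the graded `k`-linear dual of a graded module:
functionals vanishing on all components of degree `≠ -j`. -/
def dualGrade {M : Type} [AddCommGroup M] [Module k M]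
    (gm : ℤ → Submodule k M) (j : ℤ) : Submodule k (M →ₗ[k] k) where
  carrier := {ν | ∀ l : ℤ, l ≠ -j → ∀ m ∈ gm l, ν m = 0}
  add_mem' := by
    intro f g hf hg l hl m hm
    simp [hf l hl m hm, hg l hl m hm]
  zero_mem' := by intro l hl m hm; simp
  smul_mem' := by
    intro c f hf l hl m hm
    simp [hf l hl m hm]

/-- `W` realizes the graded `k`-linear dual of a left DG module `V`, as a right DG
module (the Nakayama construction `V ↦ V^*`). -/
def IsGradedKDual (V : DGModL A) (W : DGMod A) : Prop :=
  ∃ Ψ : W.M →ₗ[k] (V.M →ₗ[k] k),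
    (∀ (n : ℤ), ∀ w ∈ W.gm n, Ψ w ∈ dualGrade V.gm n) ∧
    (∀ n : ℤ, Function.Bijective
      (fun w : ↥(W.gm n) => (Ψ ↑w) ∘ₗ (V.gm (-n)).subtype)) ∧
    (∀ (n : ℤ), ∀ w ∈ W.gm n, ∀ v : V.M, Ψ (W.D w) v = -(sgnz n) • Ψ w (V.D v)) ∧
    ∀ (i : ℤ) (x : A.R), x ∈ A.gr i → ∀ (n : ℤ), ∀ w ∈ W.gm n, ∀ v : V.M,
      Ψ (W.act x w) v = sgnz (i * n) • Ψ w (V.actL x v)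

/-- `W` realizes the Nakayama functor value `S_A(X) = (X^∨)^*`. -/
def IsNakayamaOf (X : DGMod A) (W : DGMod A) : Prop :=
  ∃ V : DGModL A, IsRightDualOf X V ∧ IsGradedKDual V W
/-! ### Graded tensor products, dual complexes, and bimodule Hom complexes -/

/-- The degree-`n` part of the tensor product of two graded modules. -/
def tenGrade {M₁ M₂ : Type} [AddCommGroup M₁] [Module k M₁] [AddCommGroup M₂] [Module k M₂]
    (gm₁ : ℤ → Submodule k M₁) (gm₂ : ℤ → Submodule k M₂) (n : ℤ) :
    Submodule k (M₁ ⊗[k] M₂) :=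
  Submodule.span k {t : M₁ ⊗[k] M₂ | ∃ (i j : ℤ) (x : M₁) (y : M₂),
    x ∈ gm₁ i ∧ y ∈ gm₂ j ∧ i + j = n ∧ t = x ⊗ₜ y}

/-- The differential `D₁ ⊗ 1 + σ₁ ⊗ D₂` on a tensor product of complexes, where `σ₁`
is the sign operator of the first factor. -/
def tenD {M₁ M₂ : Type} [AddCommGroup M₁] [Module k M₁] [AddCommGroup M₂] [Module k M₂]
    (D₁ : M₁ →ₗ[k] M₁) (s₁ : M₁ →ₗ[k] M₁) (D₂ : M₂ →ₗ[k] M₂) :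
    (M₁ ⊗[k] M₂) →ₗ[k] (M₁ ⊗[k] M₂) :=
  TensorProduct.map D₁ LinearMap.id + TensorProduct.map s₁ D₂

/-- Cycles of a quotient complex `M/K`, described by representatives in `M`. -/
def ZgK {M : Type} [AddCommGroup M] [Module k M]
    (gm : ℤ → Submodule k M) (Dm : M →ₗ[k] M) (K : Submodule k M) (n : ℤ) :
    Submodule k M :=
  gm n ⊓ K.comap Dm

/-- Boundaries of a quotient complex `M/K`, described by representatives in `M`. -/
def BgK {M : Type} [AddCommGroup M] [Module k M]
    (gm : ℤ → Submodule k M) (Dm : M →ₗ[k] M) (K : Submodule k M) (n : ℤ) :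
    Submodule k M :=
  gm n ⊓ (K ⊔ LinearMap.range Dm)

/-- The differential of the graded dual of a complex. -/
def dualD {M : Type} [AddCommGroup M] [Module k M]
    (gm : ℤ → Submodule k M) [DirectSum.Decomposition gm] (Dm : M →ₗ[k] M) :
    (M →ₗ[k] k) →ₗ[k] (M →ₗ[k] k) :=
  -((LinearMap.llcomp k M M k).flip (Dm ∘ₗ gop gm fun j => sgnk k (j + 1)))

/-- The left `A`-action on the dual `M^*` of a right DG `A`-module `M`. -/
def dualActL (M : DGMod A) (x : A.R) : (M.M →ₗ[k] k) →ₗ[k] (M.M →ₗ[k] k) :=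
  (LinearMap.llcomp k M.M M.M k).flip (M.act x)

/-- The relations submodule defining `X ⊗_A V` inside `X ⊗_k V` for a right module `X`
and a bimodule `V`. -/
def tenRelMB (X : DGMod A) (V : DGBimod A) : Submodule k (X.M ⊗[k] V.M) :=
  Submodule.span k {t : X.M ⊗[k] V.M | ∃ (a : A.R) (x : X.M) (v : V.M),
    t = (X.act a x) ⊗ₜ v - x ⊗ₜ (V.actL a v)}

/-- The relations submodule defining `U ⊗_A V` inside `U ⊗_k V` for two bimodules. -/
def tenRelBB (U V : DGBimod A) : Submodule k (U.M ⊗[k] V.M) :=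
  Submodule.span k {t : U.M ⊗[k] V.M | ∃ (a : A.R) (u : U.M) (v : V.M),
    t = (U.actR a u) ⊗ₜ v - u ⊗ₜ (V.actL a v)}

/-- `V` realizes the dual bimodule `A^* = Hom_k(A, k)` (with its canonical DG
`A`-bimodule structure induced from the diagonal bimodule `A`). -/
def IsDualDiagOf {A : DGAlgebra k} (V : DGBimod A) : Prop :=
  ∃ Ψ : V.M →ₗ[k] (A.R →ₗ[k] k),
    (∀ (n : ℤ), ∀ v ∈ V.gm n, Ψ v ∈ dualGrade A.gr n) ∧
    (∀ n : ℤ, Function.Bijective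
      (fun v : ↥(V.gm n) => (Ψ ↑v) ∘ₗ (A.gr (-n)).subtype)) ∧
    (∀ (n : ℤ), ∀ v ∈ V.gm n, ∀ b : A.R, Ψ (V.D v) b = -(sgnz n) • Ψ v (A.d b)) ∧
    (∀ (i : ℤ) (x : A.R), x ∈ A.gr i → ∀ (n : ℤ), ∀ v ∈ V.gm n, ∀ b : A.R,
      Ψ (V.actL x v) b = sgnz (i * n) • Ψ v (b * x)) ∧
    ∀ (x : A.R) (v : V.M) (b : A.R), Ψ (V.actR x v) b = Ψ v (x * b)

/-- The degree-`n` part of the bimodule Hom complex `Hom_{Aᵉ}(P, T)`, for a target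
complex `T` equipped with (degreewise) commuting `Aᵉ`-actions `actLT`, `actRT`. -/
def bheGrade (P : DGBimod A) {T : Type} [AddCommGroup T] [Module k T]
    (gmT : ℤ → Submodule k T) (actLT actRT : ℤ → A.R → T →ₗ[k] T) (n : ℤ) :
    Submodule k (P.M →ₗ[k] T) where
  carrier := {g | (∀ (j : ℤ), ∀ m ∈ P.gm j, g m ∈ gmT (j + n)) ∧
    (∀ (i : ℤ) (x : A.R), x ∈ A.gr i → ∀ m : P.M,
      g (P.actL x m) = sgnz (i * n) • actLT i x (g m)) ∧
    ∀ (i : ℤ) (x : A.R), x ∈ A.gr i → ∀ m : P.M, g (P.actR x m) = actRT i x (g m)}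
  add_mem' := by
    rintro f g ⟨hf1, hf2, hf3⟩ ⟨hg1, hg2, hg3⟩
    exact ⟨fun j m hm => (gmT (j + n)).add_mem (hf1 j m hm) (hg1 j m hm),
      fun i x hx m => by simp [hf2 i x hx, hg2 i x hx, smul_add],
      fun i x hx m => by simp [hf3 i x hx, hg3 i x hx]⟩
  zero_mem' := ⟨fun j m hm => (gmT (j + n)).zero_mem,
    fun i x hx m => by simp, fun i x hx m => by simp⟩
  smul_mem' := by
    rintro c f ⟨hf1, hf2, hf3⟩
    refine ⟨fun j m hm => (gmT (j + n)).smul_mem c (hf1 j m hm), fun i x hx m => ?_,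
      fun i x hx m => by simp [hf3 i x hx]⟩
    simp only [LinearMap.smul_apply, hf2 i x hx, map_smul]
    rw [smul_comm]

/-- The differential of the bimodule Hom complex in degree `n`. -/
def bhDop (P : DGBimod A) {T : Type} [AddCommGroup T] [Module k T]
    (DT : T →ₗ[k] T) (n : ℤ) : (P.M →ₗ[k] T) →ₗ[k] (P.M →ₗ[k] T) :=
  (LinearMap.llcomp k P.M T T) DT - sgnz n • (LinearMap.llcomp k P.M P.M T).flip P.D

/-- Closed degree-`n` elements of the bimodule Hom complex. -/
def ZbhS (P : DGBimod A) {T : Type} [AddCommGroup T] [Module k T]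
    (gmT : ℤ → Submodule k T) (actLT actRT : ℤ → A.R → T →ₗ[k] T)
    (DT : T →ₗ[k] T) (n : ℤ) : Submodule k (P.M →ₗ[k] T) :=
  bheGrade P gmT actLT actRT n ⊓ LinearMap.ker (bhDop P DT n)

/-- Boundaries of degree `n` of the bimodule Hom complex. -/
def BbhS (P : DGBimod A) {T : Type} [AddCommGroup T] [Module k T]
    (gmT : ℤ → Submodule k T) (actLT actRT : ℤ → A.R → T →ₗ[k] T)
    (DT : T →ₗ[k] T) (n : ℤ) : Submodule k (P.M →ₗ[k] T) :=
  Submodule.map (bhDop P DT (n - 1)) (bheGrade P gmT actLT actRT (n - 1))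

/-- Cohomology of the bimodule Hom complex (`Ext` over `Aᵉ`). -/
def ExtBSpace (P : DGBimod A) {T : Type} [AddCommGroup T] [Module k T]
    (gmT : ℤ → Submodule k T) (actLT actRT : ℤ → A.R → T →ₗ[k] T)
    (DT : T →ₗ[k] T) (n : ℤ) : Type :=
  ↥(ZbhS P gmT actLT actRT DT n) ⧸
    (Submodule.comap (ZbhS P gmT actLT actRT DT n).subtype
      (BbhS P gmT actLT actRT DT n ⊓ ZbhS P gmT actLT actRT DT n))

instance (P : DGBimod A) {T : Type} [AddCommGroup T] [Module k T]
    (gmT : ℤ → Submodule k T) (actLT actRT : ℤ → A.R → T →ₗ[k] T)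
    (DT : T →ₗ[k] T) (n : ℤ) : AddCommGroup (ExtBSpace P gmT actLT actRT DT n) := by
  unfold ExtBSpace; infer_instance

instance (P : DGBimod A) {T : Type} [AddCommGroup T] [Module k T]
    (gmT : ℤ → Submodule k T) (actLT actRT : ℤ → A.R → T →ₗ[k] T)
    (DT : T →ₗ[k] T) (n : ℤ) : Module k (ExtBSpace P gmT actLT actRT DT n) := by
  unfold ExtBSpace; infer_instance

/-- The differential of `Aᵉ` on the underlying space `A.R ⊗[k] A.R`. -/
def aeD (A : DGAlgebra k) : (A.R ⊗[k] A.R) →ₗ[k] (A.R ⊗[k] A.R) :=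
  tenD A.d (gop A.gr fun j => sgnk k j) A.d

/-- The inner (module) action of a homogeneous element of degree `i` on the left slot
of the free `Aᵉ`-module `Aᵉ`. -/
def aeInnerL (A : DGAlgebra k) (i : ℤ) (x : A.R) : (A.R ⊗[k] A.R) →ₗ[k] (A.R ⊗[k] A.R) :=
  TensorProduct.map (LinearMap.mulLeft k x) (gop A.gr fun j => sgnk k (i * j))

/-- The inner (module) action on the right slot of the free `Aᵉ`-module `Aᵉ`. -/
def aeInnerR (A : DGAlgebra k) (i : ℤ) (x : A.R) : (A.R ⊗[k] A.R) →ₗ[k] (A.R ⊗[k] A.R) :=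
  TensorProduct.map LinearMap.id (LinearMap.mulRight k x)

/-- The outer left action on the free `Aᵉ`-module `Aᵉ`. -/
def aeOuterL (A : DGAlgebra k) (i : ℤ) (x : A.R) : (A.R ⊗[k] A.R) →ₗ[k] (A.R ⊗[k] A.R) :=
  TensorProduct.map (LinearMap.mulRight k x) LinearMap.id

/-- The outer right action on the free `Aᵉ`-module `Aᵉ`. -/
def aeOuterR (A : DGAlgebra k) (i : ℤ) (x : A.R) : (A.R ⊗[k] A.R) →ₗ[k] (A.R ⊗[k] A.R) :=
  TensorProduct.map (gop A.gr fun j => sgnk k (i * j)) (LinearMap.mulLeft k x)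

/-- `E` represents the inverse dualizing bimodule
`A^! = RHom_{(Aᵉ)ᵒᵖ}(A, (Aᵉ)ᵒᵖ)`: `E` is identified, via `Φ`, with the bimodule Hom
complex `Hom_{Aᵉ}(P, Aᵉ)` for an h-projective bimodule resolution `P` of the diagonal. -/
def RepresentsShriek {A : DGAlgebra k} (E : DGBimod A) : Prop :=
  ∃ (P : DGBimod A) (F : BimodHom P (diagBimod A)), IsDiagResolution P F ∧
  ∃ Φ : E.M →ₗ[k] (P.M →ₗ[k] (A.R ⊗[k] A.R)),
    Function.Injective Φ ∧
    (∀ n : ℤ, Submodule.map Φ (E.gm n) =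
      bheGrade P (tenGrade A.gr A.gr) (aeInnerL A) (aeInnerR A) n) ∧
    (∀ (n : ℤ), ∀ v ∈ E.gm n, Φ (E.D v) = bhDop P (aeD A) n (Φ v)) ∧
    (∀ (i : ℤ) (x : A.R), x ∈ A.gr i → ∀ v : E.M,
      Φ (E.actL x v) = aeOuterL A i x ∘ₗ Φ v) ∧
    ∀ (i : ℤ) (x : A.R), x ∈ A.gr i → ∀ v : E.M,
      Φ (E.actR x v) = aeOuterR A i x ∘ₗ Φ v

set_option linter.unusedVariables false

/-! ## Signs -/
theorem sgnz_cases (i : ℤ) : sgnz i = 1 ∨ sgnz i = -1 := by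
  unfold sgnz; split_ifs <;> simp

theorem sgnz_add (a b : ℤ) : sgnz (a + b) = sgnz a * sgnz b := by
  unfold sgnz
  by_cases ha : Even a <;> by_cases hb : Even b <;> simp [Int.even_add, ha, hb]

theorem sgnz_neg (a : ℤ) : sgnz (-a) = sgnz a := by
  unfold sgnz; simp

theorem sgnz_sub (a b : ℤ) : sgnz (a - b) = sgnz a * sgnz b := by
  rw [sub_eq_add_neg, sgnz_add, sgnz_neg]

theorem sgnz_zero : sgnz 0 = 1 := by simp [sgnz]
theorem sgnz_one : sgnz 1 = -1 := by simp [sgnz]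

theorem sgnz_sq (a : ℤ) : sgnz a * sgnz a = 1 := by
  rcases sgnz_cases a with h | h <;> simp [h]

theorem sgnz_mul_self (a : ℤ) : sgnz (a * a) = sgnz a := by
  unfold sgnz; simp [Int.even_mul]

theorem sgnz_smul_smul {M : Type} [AddCommGroup M] (a : ℤ) (m : M) :
    sgnz a • sgnz a • m = m := by
  rw [smul_smul, sgnz_sq, one_smul]

theorem sgnk_eq (i : ℤ) : sgnk k i = ((sgnz i : ℤ) : k) := by
  unfold sgnk sgnz; split_ifs <;> simp

theorem sgnk_smul {M : Type} [AddCommGroup M] [Module k M] (i : ℤ) (m : M) :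
    sgnk k i • m = sgnz i • m := by
  rw [sgnk_eq, Int.cast_smul_eq_zsmul]

theorem sgnz_smul_mem {M : Type} [AddCommGroup M] [Module k M] (p : Submodule k M) (i : ℤ) {m : M}
    (h : m ∈ p) : sgnz i • m ∈ p := by
  rw [← sgnk_smul (k := k)]; exact p.smul_mem _ h

theorem zsm_mem {M : Type} [AddCommGroup M] [Module k M] (p : Submodule k M) (i : ℤ) {m : M}
    (h : m ∈ p) : i • m ∈ p := p.toAddSubgroup.zsmul_mem h i

theorem mem_cast {M : Type} [AddCommGroup M] [Module k M] {gm : ℤ → Submodule k M} {i j : ℤ}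
    {m : M} (h : m ∈ gm i) (e : i = j) : m ∈ gm j := e ▸ h

/-! ## Graded modules -/
section graded
variable {M N : Type} [AddCommGroup M] [Module k M] [AddCommGroup N] [Module k N]
variable (gm : ℤ → Submodule k M) [DirectSum.Decomposition gm]

theorem gr_induction {p : M → Prop} (h0 : p 0) (ha : ∀ a b, p a → p b → p (a + b))
    (h : ∀ j, ∀ m ∈ gm j, p m) (m : M) : p m :=
  DirectSum.Decomposition.inductionOn gm h0 (fun {i} m => h i m m.2) ha m

theorem gr_ext {f g : M →ₗ[k] N} (h : ∀ j, ∀ m ∈ gm j, f m = g m) : f = g := by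
  ext m
  induction m using gr_induction gm with
  | h0 => simp
  | ha a b h1 h2 => simp [h1, h2]
  | h j m hm => exact h j m hm

theorem gop_mem (c : ℤ → k) {j : ℤ} {m : M} (hm : m ∈ gm j) : gop gm c m = c j • m := by
  unfold gop
  simp only [LinearMap.comp_apply, LinearEquiv.coe_coe, DirectSum.decomposeLinearEquiv_apply]
  rw [DirectSum.decompose_of_mem gm hm]
  erw [DirectSum.toModule_lof]
  simp

/-- sign operator: degree `j` part scaled by `(-1)^(t*j)`. -/
def sg (t : ℤ) : M →ₗ[k] M := gop gm (fun j => sgnk k (t * j))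

theorem sg_mem (t : ℤ) {j : ℤ} {m : M} (hm : m ∈ gm j) : sg gm t m = sgnz (t * j) • m := by
  unfold sg; rw [gop_mem gm _ hm, sgnk_smul]

/-- projection to the degree `j` part. -/
def grp (j : ℤ) : M →ₗ[k] M := gop gm (fun l => if l = j then 1 else 0)

theorem grp_same {j : ℤ} {m : M} (hm : m ∈ gm j) : grp gm j m = m := by
  unfold grp; rw [gop_mem gm _ hm]; simp

theorem grp_ne {j l : ℤ} {m : M} (hm : m ∈ gm l) (h : l ≠ j) : grp gm j m = 0 := by
  unfold grp; rw [gop_mem gm _ hm]; simp [h]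

theorem grp_mem (j : ℤ) (m : M) : grp gm j m ∈ gm j := by
  induction m using gr_induction gm with
  | h0 => simp
  | ha a b h1 h2 => rw [map_add]; exact add_mem h1 h2
  | h l m hm =>
    by_cases e : l = j
    · subst e; rw [grp_same gm hm]; exact hm
    · rw [grp_ne gm hm e]; exact zero_mem _

/-- gluing of linear maps on the homogeneous parts -/
def glue (c : ℤ → M →ₗ[k] N) : M →ₗ[k] N :=
  (DirectSum.toModule k ℤ N (fun j => c j ∘ₗ (gm j).subtype)) ∘ₗ
    (DirectSum.decomposeLinearEquiv gm).toLinearMap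

theorem glue_mem (c : ℤ → M →ₗ[k] N) {j : ℤ} {m : M} (hm : m ∈ gm j) : glue gm c m = c j m := by
  unfold glue
  simp only [LinearMap.comp_apply, LinearEquiv.coe_coe, DirectSum.decomposeLinearEquiv_apply]
  rw [DirectSum.decompose_of_mem gm hm]
  erw [DirectSum.toModule_lof]
  simp

theorem sg_sg (t : ℤ) (m : M) : sg gm t (sg gm t m) = m := by
  induction m using gr_induction gm with
  | h0 => simp
  | ha a b h1 h2 => simp [h1, h2]
  | h l m hm => rw [sg_mem gm t hm, map_zsmul, sg_mem gm t hm, sgnz_smul_smul]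

theorem sg_zero (m : M) : sg gm 0 m = m := by
  induction m using gr_induction gm with
  | h0 => simp
  | ha a b h1 h2 => simp [h1, h2]
  | h l m hm => rw [sg_mem gm 0 hm]; simp [sgnz_zero]

theorem sg_mem' (t : ℤ) {j : ℤ} {m : M} (hm : m ∈ gm j) : sg gm t m ∈ gm j := by
  rw [sg_mem gm t hm]; exact sgnz_smul_mem _ _ hm

theorem sg_D (t : ℤ) (D : M →ₗ[k] M) (hD : ∀ j, ∀ m ∈ gm j, D m ∈ gm (j + 1)) (m : M) :
    sg gm t (D m) = sgnz t • D (sg gm t m) := by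
  induction m using gr_induction gm with
  | h0 => simp
  | ha a b h1 h2 => simp [h1, h2]
  | h l m hm =>
    rw [sg_mem gm t hm, map_zsmul, sg_mem gm t (hD l m hm), smul_smul, mul_add, mul_one, sgnz_add,
      mul_comm]

theorem sg_add (t s : ℤ) (m : M) : sg gm (t + s) m = sg gm t (sg gm s m) := by
  induction m using gr_induction gm with
  | h0 => simp
  | ha a b h1 h2 => simp [h1, h2]
  | h l m hm =>
    rw [sg_mem gm s hm, map_zsmul, sg_mem gm t hm, sg_mem gm _ hm, smul_smul, add_mul, sgnz_add,
      mul_comm]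
end graded

theorem A_sg_one (t : ℤ) : sg A.gr t 1 = 1 := by
  rw [sg_mem A.gr t A.one_mem]; simp [sgnz_zero]

theorem A_d_one : A.d 1 = 0 := by
  have := A.leibniz 0 1 A.one_mem 1
  simp [sgnz_zero] at this
  exact this

theorem A_sg_mul (t : ℤ) (x y : A.R) : sg A.gr t (x * y) = sg A.gr t x * sg A.gr t y := by
  induction x using gr_induction A.gr with
  | h0 => simp
  | ha a b h1 h2 => simp [h1, h2, add_mul]
  | h i x hx =>
    induction y using gr_induction A.gr with
    | h0 => simp
    | ha a b h1 h2 => simp [h1, h2, mul_add]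
    | h j y hy =>
      rw [sg_mem A.gr t hx, sg_mem A.gr t hy, sg_mem A.gr t (A.mul_mem hx hy), smul_mul_assoc,
        mul_smul_comm, smul_smul, mul_add, sgnz_add]

theorem A_sg_d (t : ℤ) (x : A.R) : sg A.gr t (A.d x) = sgnz t • A.d (sg A.gr t x) :=
  sg_D A.gr t A.d A.d_deg x

/-! ## Pre-bimodules -/
/-- a DG bimodule without a chosen decomposition -/
structure PB (A : DGAlgebra k) : Type 1 where
  E : Type
  [acg : AddCommGroup E]
  [kmod : Module k E]
  gm : ℤ → Submodule k E
  aL : A.R →ₗ[k] E →ₗ[k] E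
  aR : A.R →ₗ[k] E →ₗ[k] E
  aL_one : ∀ m : E, aL 1 m = m
  aR_one : ∀ m : E, aR 1 m = m
  aL_mul : ∀ (x y : A.R) (m : E), aL (x * y) m = aL x (aL y m)
  aR_mul : ∀ (x y : A.R) (m : E), aR (x * y) m = aR y (aR x m)
  aLR : ∀ (x y : A.R) (m : E), aL x (aR y m) = aR y (aL x m)
  aL_deg : ∀ (i j : ℤ) (x : A.R) (m : E), x ∈ A.gr i → m ∈ gm j → aL x m ∈ gm (i + j)
  aR_deg : ∀ (i j : ℤ) (x : A.R) (m : E), x ∈ A.gr i → m ∈ gm j → aR x m ∈ gm (j + i)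
  D : E →ₗ[k] E
  D_deg : ∀ (j : ℤ), ∀ m ∈ gm j, D m ∈ gm (j + 1)
  D_sq : ∀ m : E, D (D m) = 0
  leibL : ∀ (i j : ℤ) (x : A.R) (m : E), x ∈ A.gr i → m ∈ gm j →
    D (aL x m) = aL (A.d x) m + sgnz i • aL x (D m)
  leibR : ∀ (i j : ℤ) (x : A.R) (m : E), x ∈ A.gr i → m ∈ gm j →
    D (aR x m) = aR x (D m) + sgnz j • aR (A.d x) m

attribute [instance] PB.acg PB.kmod

/-- the pre-bimodule underlying a DG bimodule -/
abbrev ofDG (X : DGBimod A) : PB A where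
  E := X.M
  gm := X.gm
  aL := X.actL
  aR := X.actR
  aL_one := X.actL_one
  aR_one := X.actR_one
  aL_mul := X.actL_mul
  aR_mul := X.actR_mul
  aLR := X.actLR
  aL_deg := X.actL_deg
  aR_deg := X.actR_deg
  D := X.D
  D_deg := X.D_deg
  D_sq := X.D_sq
  leibL := X.leibnizL
  leibR := X.leibnizR

structure PBHom (X Y : PB A) where
  f : X.E →ₗ[k] Y.E
  deg : ∀ (j : ℤ), ∀ m ∈ X.gm j, f m ∈ Y.gm j
  aLc : ∀ (x : A.R) (m : X.E), f (X.aL x m) = Y.aL x (f m)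
  aRc : ∀ (x : A.R) (m : X.E), f (X.aR x m) = Y.aR x (f m)
  comm : ∀ m : X.E, f (X.D m) = Y.D (f m)

def PBHom.ofDG {X Y : DGBimod A} (g : BimodHom X Y) : PBHom (_root_.ofDG X) (_root_.ofDG Y) :=
  ⟨g.f, g.deg, g.actLc, g.actRc, g.comm⟩

def PBAcyc (X : PB A) : Prop := ∀ n, ∀ x ∈ X.gm n, X.D x = 0 → ∃ y ∈ X.gm (n - 1), X.D y = x

/-- elementwise quasi-isomorphism -/
def QI {X Y : PB A} (g : PBHom X Y) : Prop :=
  (∀ n, ∀ z ∈ Y.gm n, Y.D z = 0 → ∃ w ∈ X.gm n, X.D w = 0 ∧ ∃ y ∈ Y.gm (n - 1), g.f w = z + Y.D y) ∧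
  (∀ n, ∀ w ∈ X.gm n, X.D w = 0 → ∀ y ∈ Y.gm (n - 1), g.f w = Y.D y →
    ∃ v ∈ X.gm (n - 1), X.D v = w)

theorem range_homog {M : Type} [AddCommGroup M] [Module k M] (gm : ℤ → Submodule k M)
    [DirectSum.Decomposition gm] (D : M →ₗ[k] M) (hD : ∀ j, ∀ m ∈ gm j, D m ∈ gm (j + 1))
    {n : ℤ} {x : M} (hx : x ∈ gm n) (hr : x ∈ LinearMap.range D) : ∃ y ∈ gm (n - 1), D y = x := by
  obtain ⟨y, rfl⟩ := hr
  refine ⟨grp gm (n - 1) y, grp_mem gm _ _, ?_⟩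
  have key : ∀ y, D (grp gm (n - 1) y) = grp gm n (D y) := by
    intro y
    induction y using gr_induction gm with
    | h0 => simp
    | ha a b h1 h2 => simp [h1, h2]
    | h l m hm =>
      by_cases e : l = n - 1
      · subst e
        rw [grp_same gm hm, grp_same gm]
        exact mem_cast (hD _ _ hm) (by ring)
      · rw [grp_ne gm hm e, grp_ne gm (hD _ _ hm) (by omega)]; simp
  rw [key, grp_same gm hx]

theorem qi_of_data {X Y : DGBimod A} (g : BimodHom X Y) (h : QIsoData X.gm X.D Y.gm Y.D g.f) :
    QI (PBHom.ofDG g) := by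
  obtain ⟨h1, h2, h3⟩ := h
  constructor
  · intro n z hz hDz
    obtain ⟨w, hw, hb⟩ := (h3 n).1 z ⟨hz, hDz⟩
    obtain ⟨y, hy, e⟩ := range_homog Y.gm Y.D Y.D_deg hb.1 hb.2
    refine ⟨w, hw.1, hw.2, y, hy, ?_⟩
    change g.f w = z + Y.D y
    rw [e]; abel
  · intro n w hw hDw y hy e
    have := (h3 n).2 w ⟨hw, hDw⟩ ⟨g.deg n w hw, y, e.symm⟩
    exact range_homog X.gm X.D X.D_deg this.1 this.2

/-! ## Totalization -/
/-- a linear retraction on a subspace -/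
def prj {E : Type} [AddCommGroup E] [Module k E] (p : Submodule k E) : E →ₗ[k] p :=
  (LinearMap.exists_leftInverse_of_injective p.subtype p.ker_subtype).choose

theorem prj_mem {E : Type} [AddCommGroup E] [Module k E] (p : Submodule k E) {x : E} (hx : x ∈ p) :
    prj p x = ⟨x, hx⟩ :=
  LinearMap.congr_fun (LinearMap.exists_leftInverse_of_injective p.subtype p.ker_subtype).choose_spec
    ⟨x, hx⟩

structure PN (A : DGAlgebra k) : Type 1 where
  E : Type
  [acg : AddCommGroup E]
  [kmod : Module k E]
  gm : ℤ → Submodule k E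
  aL : ℤ → ℤ → A.R →ₗ[k] E →ₗ[k] E
  aR : ℤ → ℤ → A.R →ₗ[k] E →ₗ[k] E
  D : ℤ → E →ₗ[k] E
  aL_one : ∀ n, ∀ m ∈ gm n, aL 0 n 1 m = m
  aR_one : ∀ n, ∀ m ∈ gm n, aR 0 n 1 m = m
  aL_mul : ∀ i j n, ∀ x ∈ A.gr i, ∀ y ∈ A.gr j, ∀ m ∈ gm n,
    aL (i + j) n (x * y) m = aL i (j + n) x (aL j n y m)
  aR_mul : ∀ i j n, ∀ x ∈ A.gr i, ∀ y ∈ A.gr j, ∀ m ∈ gm n,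
    aR (i + j) n (x * y) m = aR j (n + i) y (aR i n x m)
  aLR : ∀ i j n, ∀ x ∈ A.gr i, ∀ y ∈ A.gr j, ∀ m ∈ gm n,
    aL i (n + j) x (aR j n y m) = aR j (i + n) y (aL i n x m)
  aL_deg : ∀ i n, ∀ x ∈ A.gr i, ∀ m ∈ gm n, aL i n x m ∈ gm (i + n)
  aR_deg : ∀ i n, ∀ x ∈ A.gr i, ∀ m ∈ gm n, aR i n x m ∈ gm (n + i)
  D_deg : ∀ n, ∀ m ∈ gm n, D n m ∈ gm (n + 1)
  D_sq : ∀ n, ∀ m ∈ gm n, D (n + 1) (D n m) = 0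
  leibL : ∀ i n, ∀ x ∈ A.gr i, ∀ m ∈ gm n,
    D (i + n) (aL i n x m) = aL (i + 1) n (A.d x) m + sgnz i • aL i (n + 1) x (D n m)
  leibR : ∀ i n, ∀ x ∈ A.gr i, ∀ m ∈ gm n,
    D (n + i) (aR i n x m) = aR i (n + 1) x (D n m) + sgnz n • aR (i + 1) n (A.d x) m

attribute [instance] PN.acg PN.kmod

abbrev PB.toPN (N : PB A) : PN A where
  E := N.E
  gm := N.gm
  aL := fun _ _ => N.aL
  aR := fun _ _ => N.aR
  D := fun _ => N.D
  aL_one := fun _ m _ => N.aL_one m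
  aR_one := fun _ m _ => N.aR_one m
  aL_mul := fun _ _ _ x _ y _ m _ => N.aL_mul x y m
  aR_mul := fun _ _ _ x _ y _ m _ => N.aR_mul x y m
  aLR := fun _ _ _ x _ y _ m _ => N.aLR x y m
  aL_deg := fun i n x hx m hm => N.aL_deg i n x m hx hm
  aR_deg := fun i n x hx m hm => N.aR_deg i n x m hx hm
  D_deg := N.D_deg
  D_sq := fun _ m _ => N.D_sq m
  leibL := fun i n x hx m hm => N.leibL i n x m hx hm
  leibR := fun i n x hx m hm => N.leibR i n x m hx hm

/-- underlying space of the totalization -/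
abbrev PN.T (N : PN A) : Type := ⨁ n : ℤ, N.gm n

/-- inclusion of the degree `n` part -/
def PN.tin (N : PN A) (n : ℤ) : N.E →ₗ[k] N.T := (DirectSum.lof k ℤ (fun n => N.gm n) n) ∘ₗ prj (N.gm n)

theorem PN.lof_eq (N : PN A) (n : ℤ) (m : N.gm n) :
    DirectSum.lof k ℤ (fun n => N.gm n) n m = N.tin n (m : N.E) := by
  unfold PN.tin; rw [LinearMap.comp_apply, prj_mem _ m.2]

theorem PN.tin_ind (N : PN A) {p : N.T → Prop} (h0 : p 0) (ha : ∀ a b, p a → p b → p (a + b))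
    (h : ∀ n, ∀ m ∈ N.gm n, p (N.tin n m)) (m : N.T) : p m := by
  induction m using DirectSum.induction_on with
  | zero => exact h0
  | of i x =>
    have := h i x x.2
    rw [← PN.lof_eq] at this
    exact this
  | add a b h1 h2 => exact ha _ _ h1 h2

/-- map out of the totalization -/
def PN.tout (N : PN A) {W : Type} [AddCommGroup W] [Module k W] (g : ℤ → N.E →ₗ[k] W) : N.T →ₗ[k] W :=
  DirectSum.toModule k ℤ W (fun n => g n ∘ₗ (N.gm n).subtype)

theorem PN.tout_tin (N : PN A) {W : Type} [AddCommGroup W] [Module k W] (g : ℤ → N.E →ₗ[k] W)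
    {n : ℤ} {m : N.E} (hm : m ∈ N.gm n) : N.tout g (N.tin n m) = g n m := by
  unfold PN.tin PN.tout
  rw [LinearMap.comp_apply, prj_mem _ hm, DirectSum.toModule_lof]; rfl

def PN.tgm (N : PN A) (n : ℤ) : Submodule k N.T := Submodule.map (N.tin n) (N.gm n)

theorem PN.tin_mem (N : PN A) {n : ℤ} {m : N.E} (hm : m ∈ N.gm n) : N.tin n m ∈ N.tgm n :=
  ⟨m, hm, rfl⟩

def PN.tcomp (N : PN A) (n : ℤ) : N.T →ₗ[k] N.E :=
  N.tout (fun l => if l = n then LinearMap.id else 0)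

theorem PN.tcomp_same (N : PN A) {n : ℤ} {m : N.E} (hm : m ∈ N.gm n) : N.tcomp n (N.tin n m) = m := by
  unfold PN.tcomp; rw [N.tout_tin _ hm]; simp

theorem PN.tcomp_ne (N : PN A) {n l : ℤ} {m : N.E} (hm : m ∈ N.gm l) (h : l ≠ n) :
    N.tcomp n (N.tin l m) = 0 := by
  unfold PN.tcomp; rw [N.tout_tin _ hm]; simp [h]

theorem PN.tin_inj (N : PN A) {n : ℤ} {m : N.E} (hm : m ∈ N.gm n) (h : N.tin n m = 0) : m = 0 := by
  have := N.tcomp_same hm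
  rw [h] at this; simpa using this.symm

instance PN.tdec (N : PN A) : DirectSum.Decomposition N.tgm :=
  DirectSum.Decomposition.ofLinearMap N.tgm
    (DirectSum.toModule k ℤ _ (fun n => (DirectSum.lof k ℤ (fun n => N.tgm n) n) ∘ₗ
      ((N.tin n ∘ₗ (N.gm n).subtype).codRestrict (N.tgm n) (fun m => N.tin_mem m.2))))
    (by
      ext n m : 2
      simp only [LinearMap.comp_apply, DirectSum.toModule_lof, LinearMap.id_apply,
        DirectSum.coeLinearMap_lof]
      simp [N.lof_eq])
    (by
      ext n ⟨x, hx⟩ : 2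
      obtain ⟨m, hm, e⟩ := hx
      have e' : x = DirectSum.lof k ℤ (fun n => N.gm n) n ⟨m, hm⟩ := by rw [N.lof_eq, ← e]
      simp only [LinearMap.comp_apply, LinearMap.id_apply, DirectSum.coeLinearMap_lof]
      conv_lhs => rw [e', DirectSum.toModule_lof]
      simp only [LinearMap.comp_apply]
      congr 1
      apply Subtype.ext
      simpa using e)

def PN.tL (N : PN A) : A.R →ₗ[k] N.T →ₗ[k] N.T :=
  glue (N := N.T →ₗ[k] N.T) A.gr (fun i => LinearMap.flip (N.tout (W := A.R →ₗ[k] N.T) (fun n => LinearMap.flip ((N.aL i n).compr₂ (N.tin (i + n))))))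

def PN.tR (N : PN A) : A.R →ₗ[k] N.T →ₗ[k] N.T :=
  glue (N := N.T →ₗ[k] N.T) A.gr (fun i => LinearMap.flip (N.tout (W := A.R →ₗ[k] N.T) (fun n => LinearMap.flip ((N.aR i n).compr₂ (N.tin (n + i))))))

def PN.tD (N : PN A) : N.T →ₗ[k] N.T := N.tout (fun n => N.tin (n + 1) ∘ₗ N.D n)

theorem PN.tL_tin (N : PN A) {i n : ℤ} {x : A.R} {m : N.E} (hx : x ∈ A.gr i) (hm : m ∈ N.gm n) :
    N.tL x (N.tin n m) = N.tin (i + n) (N.aL i n x m) := by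
  unfold PN.tL; rw [glue_mem A.gr _ hx, LinearMap.flip_apply, N.tout_tin _ hm]; rfl

theorem PN.tR_tin (N : PN A) {i n : ℤ} {x : A.R} {m : N.E} (hx : x ∈ A.gr i) (hm : m ∈ N.gm n) :
    N.tR x (N.tin n m) = N.tin (n + i) (N.aR i n x m) := by
  unfold PN.tR; rw [glue_mem A.gr _ hx, LinearMap.flip_apply, N.tout_tin _ hm]; rfl

theorem PN.tD_tin (N : PN A) {n : ℤ} {m : N.E} (hm : m ∈ N.gm n) :
    N.tD (N.tin n m) = N.tin (n + 1) (N.D n m) := by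
  unfold PN.tD; rw [N.tout_tin _ hm]; rfl

theorem PN.tin_congr (N : PN A) {a b : ℤ} {m m' : N.E} (h : a = b) (h' : m = m') :
    N.tin a m = N.tin b m' := by rw [h, h']

abbrev tot (N : PN A) : DGBimod A where
  M := N.T
  gm := N.tgm
  actL := N.tL
  actR := N.tR
  actL_one := fun m => by
    induction m using N.tin_ind with
    | h0 => simp
    | ha a b h1 h2 => simp [h1, h2]
    | h n m hm => rw [N.tL_tin A.one_mem hm, N.aL_one n m hm]; simp
  actR_one := fun m => by
    induction m using N.tin_ind with
    | h0 => simp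
    | ha a b h1 h2 => simp [h1, h2]
    | h n m hm => rw [N.tR_tin A.one_mem hm, N.aR_one n m hm]; simp
  actL_mul := fun x y m => by
    induction m using N.tin_ind with
    | h0 => simp
    | ha a b h1 h2 => simp [h1, h2]
    | h n m hm =>
      induction x using gr_induction A.gr with
      | h0 => simp
      | ha a b h1 h2 => simp [h1, h2, add_mul]
      | h i x hx =>
        induction y using gr_induction A.gr with
        | h0 => simp
        | ha a b h1 h2 => simp [h1, h2, mul_add]
        | h j y hy =>
          rw [N.tL_tin (A.mul_mem hx hy) hm, N.tL_tin hy hm, N.tL_tin hx (N.aL_deg _ _ _ hy _ hm)]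
          exact N.tin_congr (by ring) (N.aL_mul _ _ _ _ hx _ hy _ hm)
  actR_mul := fun x y m => by
    induction m using N.tin_ind with
    | h0 => simp
    | ha a b h1 h2 => simp [h1, h2]
    | h n m hm =>
      induction x using gr_induction A.gr with
      | h0 => simp
      | ha a b h1 h2 => simp [h1, h2, add_mul]
      | h i x hx =>
        induction y using gr_induction A.gr with
        | h0 => simp
        | ha a b h1 h2 => simp [h1, h2, mul_add]
        | h j y hy =>
          rw [N.tR_tin (A.mul_mem hx hy) hm, N.tR_tin hx hm, N.tR_tin hy (N.aR_deg _ _ _ hx _ hm)]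
          exact N.tin_congr (by ring) (N.aR_mul _ _ _ _ hx _ hy _ hm)
  actLR := fun x y m => by
    induction m using N.tin_ind with
    | h0 => simp
    | ha a b h1 h2 => simp [h1, h2]
    | h n m hm =>
      induction x using gr_induction A.gr with
      | h0 => simp
      | ha a b h1 h2 => simp [h1, h2]
      | h i x hx =>
        induction y using gr_induction A.gr with
        | h0 => simp
        | ha a b h1 h2 => simp [h1, h2]
        | h j y hy =>
          rw [N.tR_tin hy hm, N.tL_tin hx hm, N.tR_tin hy (N.aL_deg _ _ _ hx _ hm),
            N.tL_tin hx (N.aR_deg _ _ _ hy _ hm)]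
          exact N.tin_congr (by ring) (N.aLR _ _ _ _ hx _ hy _ hm)
  actL_deg := by
    rintro i j x _ hx ⟨m, hm, rfl⟩
    rw [N.tL_tin hx hm]
    exact N.tin_mem (N.aL_deg _ _ _ hx _ hm)
  actR_deg := by
    rintro i j x _ hx ⟨m, hm, rfl⟩
    rw [N.tR_tin hx hm]
    exact N.tin_mem (N.aR_deg _ _ _ hx _ hm)
  D := N.tD
  D_deg := by
    rintro j _ ⟨m, hm, rfl⟩
    rw [N.tD_tin hm]
    exact N.tin_mem (N.D_deg _ _ hm)
  D_sq := fun m => by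
    induction m using N.tin_ind with
    | h0 => simp
    | ha a b h1 h2 => simp [h1, h2]
    | h n m hm =>
      rw [N.tD_tin hm, N.tD_tin (N.D_deg _ _ hm), N.D_sq _ _ hm]; simp
  leibnizL := by
    rintro i j x _ hx ⟨m, hm, rfl⟩
    rw [N.tL_tin hx hm, N.tD_tin hm, N.tD_tin (N.aL_deg _ _ _ hx _ hm), N.tL_tin (A.d_deg _ _ hx) hm,
      N.tL_tin hx (N.D_deg _ _ hm), N.leibL _ _ _ hx _ hm, map_add, map_zsmul]
    congr 1
    · exact N.tin_congr (by ring) rfl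
    · exact congrArg _ (N.tin_congr (by ring) rfl)
  leibnizR := by
    rintro i j x _ hx ⟨m, hm, rfl⟩
    rw [N.tR_tin hx hm, N.tD_tin hm, N.tD_tin (N.aR_deg _ _ _ hx _ hm), N.tR_tin (A.d_deg _ _ hx) hm,
      N.tR_tin hx (N.D_deg _ _ hm), N.leibR _ _ _ hx _ hm, map_add, map_zsmul]
    congr 1
    · exact N.tin_congr (by ring) rfl
    · exact congrArg _ (N.tin_congr (by ring) rfl)

/-- the canonical map from the totalization of a pre-bimodule -/
def tsm (N : PB A) : PBHom (ofDG (tot N.toPN)) N where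
  f := N.toPN.tout (fun _ => LinearMap.id)
  deg := by
    rintro j _ ⟨m, hm, rfl⟩
    rw [PN.tout_tin _ _ hm]; exact hm
  aLc := fun x m => by
    induction m using N.toPN.tin_ind with
    | h0 => simp
    | ha a b h1 h2 => simp only [map_add, h1, h2]
    | h n m hm =>
      induction x using gr_induction A.gr with
      | h0 => simp
      | ha a b h1 h2 => simp only [map_add, LinearMap.add_apply, h1, h2]
      | h i x hx =>
        change N.toPN.tout _ (N.toPN.tL x _) = _
        rw [PN.tL_tin _ hx hm, PN.tout_tin _ _ (N.toPN.aL_deg _ _ _ hx _ hm), PN.tout_tin _ _ hm]; rfl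
  aRc := fun x m => by
    induction m using N.toPN.tin_ind with
    | h0 => simp
    | ha a b h1 h2 => simp only [map_add, h1, h2]
    | h n m hm =>
      induction x using gr_induction A.gr with
      | h0 => simp
      | ha a b h1 h2 => simp only [map_add, LinearMap.add_apply, h1, h2]
      | h i x hx =>
        change N.toPN.tout _ (N.toPN.tR x _) = _
        rw [PN.tR_tin _ hx hm, PN.tout_tin _ _ (N.toPN.aR_deg _ _ _ hx _ hm), PN.tout_tin _ _ hm]; rfl
  comm := fun m => by
    induction m using N.toPN.tin_ind with
    | h0 => simp
    | ha a b h1 h2 => simp only [map_add, h1, h2]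
    | h n m hm =>
      change N.toPN.tout _ (N.toPN.tD _) = _
      rw [PN.tD_tin _ hm, PN.tout_tin _ _ (N.toPN.D_deg _ _ hm), PN.tout_tin _ _ hm]; rfl

theorem tsm_tin (N : PB A) {n : ℤ} {m : N.E} (hm : m ∈ N.gm n) :
    (tsm N).f (N.toPN.tin n m) = m := PN.tout_tin _ _ hm

theorem tsm_qi (N : PB A) : QI (tsm N) := by
  constructor
  · intro n z hz hDz
    refine ⟨N.toPN.tin n z, N.toPN.tin_mem hz, ?_, 0, zero_mem _, ?_⟩
    · change N.toPN.tD _ = 0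
      rw [PN.tD_tin _ hz]
      have : N.toPN.D n z = 0 := hDz
      rw [this, map_zero]
    · rw [tsm_tin N hz]; simp
  · rintro n _ ⟨m, hm, rfl⟩ hDw y hy e
    rw [tsm_tin N hm] at e
    refine ⟨N.toPN.tin (n - 1) y, N.toPN.tin_mem hy, ?_⟩
    change N.toPN.tD _ = _
    rw [PN.tD_tin _ hy]
    exact N.toPN.tin_congr (by ring) e.symm

/-! ## Hom complexes -/
def HomG (P : DGBimod A) (N : PB A) (n : ℤ) : Submodule k (P.M →ₗ[k] N.E) where
  carrier := {f | (∀ (j : ℤ), ∀ m ∈ P.gm j, f m ∈ N.gm (j + n)) ∧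
    (∀ (i : ℤ) (x : A.R), x ∈ A.gr i → ∀ m : P.M, f (P.actL x m) = sgnz (i * n) • N.aL x (f m)) ∧
    ∀ (x : A.R) (m : P.M), f (P.actR x m) = N.aR x (f m)}
  add_mem' := by
    rintro f g ⟨hf1, hf2, hf3⟩ ⟨hg1, hg2, hg3⟩
    exact ⟨fun j m hm => (N.gm (j + n)).add_mem (hf1 j m hm) (hg1 j m hm),
      fun i x hx m => by simp [hf2 i x hx, hg2 i x hx, smul_add],
      fun x m => by simp [hf3, hg3]⟩
  zero_mem' := ⟨fun j m hm => (N.gm (j + n)).zero_mem,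
    fun i x hx m => by simp, fun x m => by simp⟩
  smul_mem' := by
    rintro c f ⟨hf1, hf2, hf3⟩
    refine ⟨fun j m hm => (N.gm (j + n)).smul_mem c (hf1 j m hm), fun i x hx m => ?_,
      fun x m => by simp [hf3]⟩
    simp only [LinearMap.smul_apply, hf2 i x hx, map_smul]
    rw [smul_comm]

def dl (P : DGBimod A) (N : PB A) (n : ℤ) : (P.M →ₗ[k] N.E) →ₗ[k] (P.M →ₗ[k] N.E) :=
  (LinearMap.llcomp k P.M N.E N.E) N.D - sgnz n • (LinearMap.llcomp k P.M P.M N.E).flip P.D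

theorem dl_apply {P : DGBimod A} {N : PB A} (n : ℤ) (f : P.M →ₗ[k] N.E) (x : P.M) :
    dl P N n f x = N.D (f x) - sgnz n • f (P.D x) := by
  simp [dl]

theorem PBleibL {N : PB A} {i j : ℤ} {x : A.R} {m : N.E} (hx : x ∈ A.gr i) (hm : m ∈ N.gm j) :
    N.D (N.aL x m) = N.aL (A.d x) m + sgnz i • N.aL x (N.D m) := N.leibL i j x m hx hm

theorem DGleibL {N : DGBimod A} {i : ℤ} {x : A.R} (m : N.M) (hx : x ∈ A.gr i) :
    N.D (N.actL x m) = N.actL (A.d x) m + sgnz i • N.actL x (N.D m) := by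
  induction m using gr_induction N.gm with
  | h0 => simp
  | ha a b h1 h2 => simp only [map_add, h1, h2, smul_add]; abel
  | h j m hm => exact N.leibnizL i j x m hx hm

theorem HomG_of {P : DGBimod A} {N : PB A} {n : ℤ} {f : P.M →ₗ[k] N.E}
    (h1 : ∀ (j : ℤ), ∀ m ∈ P.gm j, f m ∈ N.gm (j + n))
    (h2 : ∀ (i : ℤ) (x : A.R), x ∈ A.gr i → ∀ j, ∀ m ∈ P.gm j,
      f (P.actL x m) = sgnz (i * n) • N.aL x (f m))
    (h3 : ∀ (i : ℤ) (x : A.R), x ∈ A.gr i → ∀ j, ∀ m ∈ P.gm j, f (P.actR x m) = N.aR x (f m)) :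
    f ∈ HomG P N n := by
  refine ⟨h1, fun i x hx m => ?_, fun x m => ?_⟩
  · induction m using gr_induction P.gm with
    | h0 => simp
    | ha a b h1 h2 => simp only [map_add, h1, h2, smul_add]
    | h j m hm => exact h2 i x hx j m hm
  · induction m using gr_induction P.gm with
    | h0 => simp
    | ha a b h1 h2 => simp only [map_add, h1, h2]
    | h j m hm =>
      induction x using gr_induction A.gr with
      | h0 => simp
      | ha a b h1 h2 => simp only [map_add, LinearMap.add_apply, h1, h2]
      | h i x hx => exact h3 i x hx j m hm

theorem dl_mem {P : DGBimod A} {N : PB A} {n : ℤ} {f : P.M →ₗ[k] N.E} (hf : f ∈ HomG P N n) :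
    dl P N n f ∈ HomG P N (n + 1) := by
  obtain ⟨h1, h2, h3⟩ := hf
  apply HomG_of
  · intro j m hm
    rw [dl_apply]
    refine sub_mem (mem_cast (N.D_deg _ _ (h1 j m hm)) (by ring)) (sgnz_smul_mem _ _ ?_)
    exact mem_cast (h1 _ _ (P.D_deg _ _ hm)) (by ring)
  · intro i x hx j m hm
    rw [dl_apply, dl_apply, h2 i x hx, P.leibnizL i j x m hx hm, map_zsmul,
      N.leibL _ _ _ _ hx (h1 j m hm), map_add, map_zsmul, h2 _ _ (A.d_deg _ _ hx), h2 _ _ hx]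
    simp only [mul_add, add_mul, sgnz_add, map_sub, smul_sub, smul_add, mul_one, one_mul, map_zsmul,
      smul_smul]
    rcases sgnz_cases (i * n) with h | h <;> rcases sgnz_cases i with h' | h' <;>
      rcases sgnz_cases n with h'' | h'' <;> simp [h, h', h'']
  · intro i x hx j m hm
    rw [dl_apply, dl_apply, h3, P.leibnizR i j x m hx hm,
      N.leibR _ _ _ _ hx (h1 j m hm), map_add, map_zsmul, h3, h3]
    simp only [sgnz_add, map_sub, smul_add, map_zsmul, smul_smul, mul_comm]
    abel

theorem dl_dl {P : DGBimod A} {N : PB A} {n : ℤ} (f : P.M →ₗ[k] N.E) :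
    dl P N (n + 1) (dl P N n f) = 0 := by
  ext x
  simp only [dl_apply, map_sub, N.D_sq, P.D_sq, map_zsmul, sgnz_add, sgnz_one, map_zero]
  simp

def Zh (P : DGBimod A) (N : PB A) (n : ℤ) : Submodule k (P.M →ₗ[k] N.E) :=
  HomG P N n ⊓ LinearMap.ker (dl P N n)

def Bh (P : DGBimod A) (N : PB A) (n : ℤ) : Submodule k (P.M →ₗ[k] N.E) :=
  Submodule.map (dl P N (n - 1)) (HomG P N (n - 1))

theorem Bh_le (P : DGBimod A) (N : PB A) (n : ℤ) : Bh P N n ≤ Zh P N n := by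
  rintro _ ⟨g, hg, rfl⟩
  refine ⟨mem_cast (dl_mem hg) (by ring), ?_⟩
  have := dl_dl (n := n - 1) g
  rw [sub_add_cancel] at this
  exact this

theorem Zh_D {P : DGBimod A} {N : PB A} {n : ℤ} {f : P.M →ₗ[k] N.E} (hf : f ∈ Zh P N n) (x : P.M) :
    N.D (f x) = sgnz n • f (P.D x) := by
  have := LinearMap.congr_fun (show dl P N n f = 0 from hf.2) x
  rw [dl_apply] at this
  exact sub_eq_zero.mp this

theorem Zh_of {P : DGBimod A} {N : PB A} {n : ℤ} {f : P.M →ₗ[k] N.E} (hf : f ∈ HomG P N n)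
    (h : ∀ j, ∀ x ∈ P.gm j, N.D (f x) = sgnz n • f (P.D x)) : f ∈ Zh P N n := by
  refine ⟨hf, ?_⟩
  apply gr_ext P.gm
  intro j x hx
  rw [dl_apply, h j x hx]; simp

theorem Bh_of {P : DGBimod A} {N : PB A} {n : ℤ} {f g : P.M →ₗ[k] N.E} (hg : g ∈ HomG P N (n - 1))
    (h : ∀ j, ∀ x ∈ P.gm j, f x = N.D (g x) + sgnz n • g (P.D x)) : f ∈ Bh P N n := by
  refine ⟨g, hg, ?_⟩
  apply gr_ext P.gm
  intro j x hx
  rw [dl_apply, h j x hx, sgnz_sub, sgnz_one]; simp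

theorem Bh_D {P : DGBimod A} {N : PB A} {n : ℤ} {f : P.M →ₗ[k] N.E} (h : f ∈ Bh P N n) :
    ∃ g ∈ HomG P N (n - 1), ∀ x, f x = N.D (g x) + sgnz n • g (P.D x) := by
  obtain ⟨g, hg, rfl⟩ := h
  refine ⟨g, hg, fun x => ?_⟩
  rw [dl_apply, sgnz_sub, sgnz_one]; simp

/-- cohomology of the Hom complex -/
abbrev UH (P : DGBimod A) (N : PB A) (n : ℤ) : Type :=
  ↥(Zh P N n) ⧸ (Bh P N n).comap (Zh P N n).subtype

/-- lift of a morphism to the totalization -/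
def totLift {X : DGBimod A} {N : PB A} (g : PBHom (ofDG X) N) : BimodHom X (tot N.toPN) where
  f := glue X.gm (fun j => N.toPN.tin j ∘ₗ g.f)
  deg := fun j m hm => by
    rw [glue_mem X.gm _ hm]; exact N.toPN.tin_mem (g.deg j m hm)
  actLc := fun x m => by
    induction m using gr_induction X.gm with
    | h0 => simp
    | ha a b h1 h2 => simp only [map_add, h1, h2]
    | h n m hm =>
      induction x using gr_induction A.gr with
      | h0 => simp
      | ha a b h1 h2 => simp only [map_add, LinearMap.add_apply, h1, h2]
      | h i x hx =>
        rw [glue_mem X.gm _ hm, glue_mem X.gm _ (X.actL_deg i n x m hx hm)]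
        change _ = N.toPN.tL x _
        simp only [LinearMap.comp_apply]
        rw [PN.tL_tin _ hx (g.deg n m hm)]
        exact congrArg _ (g.aLc x m)
  actRc := fun x m => by
    induction m using gr_induction X.gm with
    | h0 => simp
    | ha a b h1 h2 => simp only [map_add, h1, h2]
    | h n m hm =>
      induction x using gr_induction A.gr with
      | h0 => simp
      | ha a b h1 h2 => simp only [map_add, LinearMap.add_apply, h1, h2]
      | h i x hx =>
        rw [glue_mem X.gm _ hm, glue_mem X.gm _ (X.actR_deg i n x m hx hm)]
        change _ = N.toPN.tR x _
        simp only [LinearMap.comp_apply]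
        rw [PN.tR_tin _ hx (g.deg n m hm)]
        exact congrArg _ (g.aRc x m)
  comm := fun m => by
    induction m using gr_induction X.gm with
    | h0 => simp
    | ha a b h1 h2 => simp only [map_add, h1, h2]
    | h n m hm =>
      rw [glue_mem X.gm _ hm, glue_mem X.gm _ (X.D_deg n m hm)]
      change _ = N.toPN.tD _
      simp only [LinearMap.comp_apply]
      rw [PN.tD_tin _ (g.deg n m hm)]
      exact congrArg _ (g.comm m)

theorem tsm_totLift {X : DGBimod A} {N : PB A} (g : PBHom (ofDG X) N) (x : X.M) :
    (tsm N).f ((totLift g).f x) = g.f x := by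
  induction x using gr_induction X.gm with
  | h0 => simp
  | ha a b h1 h2 => simp only [map_add, h1, h2]
  | h n m hm =>
    change (tsm N).f (glue X.gm _ m) = _
    rw [glue_mem X.gm _ hm]; exact tsm_tin N (g.deg n m hm)

theorem tot_acyc {N : PB A} (h : PBAcyc N) : AcyclicB (tot N.toPN) := by
  rintro n _ ⟨⟨m, hm, rfl⟩, hD⟩
  refine ⟨N.toPN.tin_mem hm, ?_⟩
  have hD' : N.toPN.tD (N.toPN.tin n m) = 0 := hD
  rw [PN.tD_tin _ hm] at hD'
  have h0 := N.toPN.tin_inj (N.D_deg n m hm) hD'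
  obtain ⟨y, hy, e⟩ := h n m hm h0
  refine ⟨N.toPN.tin (n - 1) y, ?_⟩
  change N.toPN.tD _ = _
  rw [PN.tD_tin _ hy]
  exact N.toPN.tin_congr (by ring) e

/-- shift by `n` -/
abbrev shf (N : PB A) (n : ℤ) : PB A where
  E := N.E
  gm := fun m => N.gm (m + n)
  aL := N.aL ∘ₗ sg A.gr n
  aR := N.aR
  aL_one := fun m => by simp [A_sg_one, N.aL_one]
  aR_one := N.aR_one
  aL_mul := fun x y m => by simp [A_sg_mul, N.aL_mul]
  aR_mul := N.aR_mul
  aLR := fun x y m => by simp [N.aLR]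
  aL_deg := fun i j x m hx hm => by
    have := N.aL_deg i (j + n) _ m (sg_mem' A.gr n hx) hm
    exact mem_cast this (by ring)
  aR_deg := fun i j x m hx hm => mem_cast (N.aR_deg i (j + n) x m hx hm) (by ring)
  D := sgnz n • N.D
  D_deg := fun j m hm => sgnz_smul_mem _ _ (mem_cast (N.D_deg _ m hm) (by ring))
  D_sq := fun m => by simp [N.D_sq]
  leibL := fun i j x m hx hm => by
    simp only [LinearMap.smul_apply, LinearMap.comp_apply]
    rw [N.leibL _ _ _ _ (sg_mem' A.gr n hx) hm, A_sg_d]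
    simp only [smul_add, map_zsmul, LinearMap.smul_apply, smul_smul]
    rw [mul_comm]
  leibR := fun i j x m hx hm => by
    simp only [LinearMap.smul_apply, LinearMap.comp_apply]
    rw [N.leibR _ _ _ _ hx hm]
    simp only [smul_add, map_zsmul, smul_smul, sgnz_add]
    rw [mul_comm (sgnz j), ← mul_assoc, sgnz_sq, one_mul]

theorem L0 {P : DGBimod A} (hP : IsHoProjB P) {N : PB A} (hN : PBAcyc N) {n : ℤ}
    {f : P.M →ₗ[k] N.E} (hf : f ∈ Zh P N n) : f ∈ Bh P N n := by
  obtain ⟨h1, h2, h3⟩ := hf.1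
  let g : PBHom (ofDG P) (shf N n) :=
    { f := f
      deg := h1
      aLc := fun x m => by
        induction x using gr_induction A.gr with
        | h0 => simp
        | ha a b h1 h2 => simp only [map_add, LinearMap.add_apply, h1, h2]
        | h i x hx =>
          simp only [LinearMap.comp_apply]
          rw [h2 i x hx, sg_mem A.gr n hx, map_zsmul, LinearMap.smul_apply, mul_comm]
      aRc := h3
      comm := fun m => by
        rw [LinearMap.smul_apply, Zh_D hf, sgnz_smul_smul] }
  have hac : PBAcyc (shf N n) := by
    intro m x hx hD
    have hD' : sgnz n • N.D x = 0 := hD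
    have hD'' : N.D x = 0 := by rw [← sgnz_smul_smul n (N.D x), hD', smul_zero]
    obtain ⟨y, hy, e⟩ := hN _ x hx hD''
    refine ⟨sgnz n • y, sgnz_smul_mem _ _ (mem_cast (gm := N.gm) hy (by ring)), ?_⟩
    simp [e, smul_smul, sgnz_sq]
  obtain ⟨h, hd, hl, hr, hh⟩ := hP _ (tot_acyc hac) (totLift g)
  let h' : P.M →ₗ[k] N.E := (tsm (shf N n)).f ∘ₗ h
  have e1 : ∀ j, ∀ m ∈ P.gm j, h' m ∈ N.gm (j + (n - 1)) := fun j m hm =>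
    mem_cast ((tsm (shf N n)).deg _ _ (hd j m hm)) (by ring)
  have e2 : ∀ (i : ℤ) (x : A.R), x ∈ A.gr i → ∀ m : P.M,
      h' (P.actL x m) = sgnz (i * (n - 1)) • N.aL x (h' m) := fun i x hx m => by
    change (tsm (shf N n)).f (h _) = _
    rw [hl i x hx m, map_zsmul, (tsm (shf N n)).aLc]
    simp only [LinearMap.comp_apply, sg_mem A.gr n hx, map_zsmul, LinearMap.smul_apply, smul_smul]
    rw [mul_sub, mul_one, sgnz_sub, mul_comm n i, mul_comm]; rfl
  have e3 : ∀ (x : A.R) (m : P.M), h' (P.actR x m) = N.aR x (h' m) := fun x m => by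
    change (tsm (shf N n)).f (h _) = _
    rw [hr, (tsm (shf N n)).aRc]; rfl
  have e4 : ∀ m, f m = sgnz n • N.D (h' m) + h' (P.D m) := fun m => by
    have := congrArg (tsm (shf N n)).f (hh m)
    rw [map_sub, map_add, tsm_totLift] at this
    have e5 : (tsm (shf N n)).f ((tot (shf N n).toPN).D (h m)) = sgnz n • N.D (h' m) :=
      (tsm (shf N n)).comm (h m)
    rw [e5] at this
    change g.f m - (tsm (shf N n)).f 0 = _ at this
    rw [map_zero, sub_zero] at this
    exact this
  refine Bh_of (g := sgnz n • h') ((HomG P N (n - 1)).toAddSubgroup.zsmul_mem ⟨e1, e2, e3⟩ _) ?_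
  intro j x hx
  rw [e4]
  simp [smul_smul, sgnz_sq]

/-- mapping cone -/
abbrev cone {X Y : PB A} (g : PBHom X Y) : PB A where
  E := X.E × Y.E
  gm := fun n => (X.gm (n + 1)).prod (Y.gm n)
  aL := LinearMap.mk₂ k (fun a p => (X.aL (sg A.gr 1 a) p.1, Y.aL a p.2))
    (fun _ _ _ => by simp) (fun _ _ _ => by simp) (fun _ _ _ => by simp) (fun _ _ _ => by simp)
  aR := LinearMap.mk₂ k (fun a p => (X.aR a p.1, Y.aR a p.2))
    (fun _ _ _ => by simp) (fun _ _ _ => by simp) (fun _ _ _ => by simp) (fun _ _ _ => by simp)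
  aL_one := fun m => by simp [A_sg_one, X.aL_one, Y.aL_one]
  aR_one := fun m => by simp [X.aR_one, Y.aR_one]
  aL_mul := fun x y m => by simp [A_sg_mul, X.aL_mul, Y.aL_mul]
  aR_mul := fun x y m => by simp [X.aR_mul, Y.aR_mul]
  aLR := fun x y m => by simp [X.aLR, Y.aLR]
  aL_deg := fun i j x m hx hm =>
    ⟨mem_cast (X.aL_deg i _ _ m.1 (sg_mem' A.gr 1 hx) hm.1) (by ring), Y.aL_deg i j x m.2 hx hm.2⟩
  aR_deg := fun i j x m hx hm =>
    ⟨mem_cast (X.aR_deg i _ _ m.1 hx hm.1) (by ring), Y.aR_deg i j x m.2 hx hm.2⟩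
  D := LinearMap.prod (-(X.D ∘ₗ LinearMap.fst k X.E Y.E))
    (g.f ∘ₗ LinearMap.fst k X.E Y.E + Y.D ∘ₗ LinearMap.snd k X.E Y.E)
  D_deg := fun j m hm => by
    refine ⟨neg_mem (X.D_deg _ _ hm.1), add_mem (g.deg _ _ hm.1) (Y.D_deg _ _ hm.2)⟩
  D_sq := fun m => by simp [X.D_sq, Y.D_sq, g.comm]
  leibL := fun i j x m hx hm => by
    have e := sg_mem A.gr 1 hx
    have e' := sg_mem A.gr 1 (A.d_deg i x hx)
    ext
    · have := X.leibL i _ x m.1 hx hm.1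
      simp [this, e, e', sgnz_add, sgnz_one, -zsmul_eq_mul]
      rcases sgnz_cases i with h | h <;> simp [h] <;> abel
    · simp [Y.leibL i _ x m.2 hx hm.2, e, g.aLc, -zsmul_eq_mul]; abel
  leibR := fun i j x m hx hm => by
    ext
    · simp [X.leibR i _ x m.1 hx hm.1, sgnz_add, sgnz_one]; abel
    · simp [Y.leibR i _ x m.2 hx hm.2, g.aRc]; abel

theorem cone_acyc {X Y : PB A} {g : PBHom X Y} (h : QI g) : PBAcyc (cone g) := by
  rintro n ⟨x, y⟩ ⟨hx, hy⟩ hD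
  have h1 : X.D x = 0 := by simpa using congrArg Prod.fst hD
  have h2 : g.f x + Y.D y = 0 := by simpa using congrArg Prod.snd hD
  obtain ⟨v, hv, e⟩ := h.2 (n + 1) x hx h1 (-y) (neg_mem (mem_cast hy (by ring)))
    (by rw [map_neg]; exact eq_neg_of_add_eq_zero_left h2)
  have h3 : Y.D (y + g.f v) = 0 := by
    rw [map_add, ← g.comm, e, add_comm]; exact h2
  have hv' : v ∈ X.gm n := mem_cast hv (by ring)
  obtain ⟨w, hw, hDw, y', hy', e2⟩ := h.1 n (y + g.f v) (add_mem hy (g.deg _ _ hv')) h3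
  refine ⟨(w - v, -y'), ⟨?_, neg_mem hy'⟩, ?_⟩
  · exact mem_cast (sub_mem hw hv') (by ring)
  · ext
    · simp [hDw, e]
    · simp [e2]; abel

theorem HomG_comp {P : DGBimod A} {X Y : PB A} (g : PBHom X Y) {n : ℤ} {f : P.M →ₗ[k] X.E}
    (hf : f ∈ HomG P X n) : g.f ∘ₗ f ∈ HomG P Y n :=
  ⟨fun j m hm => g.deg _ _ (hf.1 j m hm),
    fun i x hx m => by simp only [LinearMap.comp_apply, hf.2.1 i x hx, map_zsmul, g.aLc],
    fun x m => by simp only [LinearMap.comp_apply, hf.2.2, g.aRc]⟩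

theorem dl_comp {P : DGBimod A} {X Y : PB A} (g : PBHom X Y) (n : ℤ) (f : P.M →ₗ[k] X.E) :
    dl P Y n (g.f ∘ₗ f) = g.f ∘ₗ dl P X n f := by
  ext x; simp [dl_apply, g.comm]

theorem Zh_comp {P : DGBimod A} {X Y : PB A} (g : PBHom X Y) {n : ℤ} {f : P.M →ₗ[k] X.E}
    (hf : f ∈ Zh P X n) : g.f ∘ₗ f ∈ Zh P Y n := by
  refine ⟨HomG_comp g hf.1, ?_⟩
  change dl P Y n _ = 0
  rw [dl_comp, show dl P X n f = 0 from hf.2, LinearMap.comp_zero]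

theorem Bh_comp {P : DGBimod A} {X Y : PB A} (g : PBHom X Y) {n : ℤ} {f : P.M →ₗ[k] X.E}
    (hf : f ∈ Bh P X n) : g.f ∘ₗ f ∈ Bh P Y n := by
  obtain ⟨h, hh, rfl⟩ := hf
  exact ⟨_, HomG_comp g hh, dl_comp g _ h⟩

theorem L_surj {P : DGBimod A} (hP : IsHoProjB P) {X Y : PB A} {g : PBHom X Y} (hg : QI g) {n : ℤ}
    {f : P.M →ₗ[k] Y.E} (hf : f ∈ Zh P Y n) : ∃ f' ∈ Zh P X n, g.f ∘ₗ f' - f ∈ Bh P Y n := by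
  have hz : LinearMap.inr k X.E Y.E ∘ₗ f ∈ Zh P (cone g) n := by
    refine Zh_of ⟨fun j m hm => ⟨zero_mem _, hf.1.1 j m hm⟩, fun i x hx m => ?_, fun x m => ?_⟩ ?_
    · ext
      · simp
      · simp [hf.1.2.1 i x hx]
    · ext
      · simp
      · simp [hf.1.2.2]
    · intro j x hx
      ext
      · simp
      · simp [Zh_D hf]
  obtain ⟨u, hu, e⟩ := Bh_D (L0 hP (cone_acyc hg) hz)
  have u1 : LinearMap.fst k X.E Y.E ∘ₗ u ∈ HomG P X n := by
    refine HomG_of (fun j m hm => mem_cast (hu.1 j m hm).1 (by ring)) ?_ ?_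
    · intro i x hx j m hm
      have := congrArg Prod.fst (hu.2.1 i x hx m)
      simp [sg_mem A.gr 1 hx, -zsmul_eq_mul] at this
      simp only [LinearMap.comp_apply, LinearMap.fst_apply, this, smul_smul]
      rw [mul_sub, mul_one, sgnz_sub, mul_assoc, sgnz_sq, mul_one]
    · intro i x hx j m hm
      have := congrArg Prod.fst (hu.2.2 x m)
      simpa using this
  have u2 : LinearMap.snd k X.E Y.E ∘ₗ u ∈ HomG P Y (n - 1) := by
    refine HomG_of (fun j m hm => (hu.1 j m hm).2) ?_ ?_
    · intro i x hx j m hm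
      have := congrArg Prod.snd (hu.2.1 i x hx m)
      simpa using this
    · intro i x hx j m hm
      have := congrArg Prod.snd (hu.2.2 x m)
      simpa using this
  refine ⟨_, Zh_of u1 ?_, Bh_of (Submodule.neg_mem _ u2) ?_⟩
  · intro j x hx
    have := congrArg Prod.fst (e x)
    simp at this
    simp only [LinearMap.comp_apply, LinearMap.fst_apply]
    exact (neg_add_eq_zero.mp this.symm)
  · intro j x hx
    have := congrArg Prod.snd (e x)
    simp at this
    simp [this]
    abel

theorem L_inj {P : DGBimod A} (hP : IsHoProjB P) {X Y : PB A} {g : PBHom X Y} (hg : QI g) {n : ℤ}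
    {f : P.M →ₗ[k] X.E} (hf : f ∈ Zh P X n) (hb : g.f ∘ₗ f ∈ Bh P Y n) : f ∈ Bh P X n := by
  obtain ⟨h, hh, e⟩ := Bh_D hb
  have hz : LinearMap.prod f (-h) ∈ Zh P (cone g) (n - 1) := by
    refine Zh_of (HomG_of (fun j m hm => ⟨mem_cast (hf.1.1 j m hm) (by ring),
      neg_mem (hh.1 j m hm)⟩) (fun i x hx j m hm => ?_) (fun i x hx j m hm => ?_)) ?_
    · ext
      · simp only [LinearMap.prod_apply, Function.prod_apply, Prod.smul_fst, LinearMap.mk₂_apply,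
          hf.1.2.1 i x hx, sg_mem A.gr 1 hx, map_zsmul, LinearMap.smul_apply, smul_smul]
        rw [one_mul, mul_sub, mul_one, sgnz_sub, mul_assoc, sgnz_sq, mul_one]
      · simp [hh.2.1 i x hx]
    · ext
      · simp [hf.1.2.2]
      · simp [hh.2.2]
    · intro j x hx
      have e' := e x
      simp only [LinearMap.comp_apply] at e'
      ext
      · simp [Zh_D hf, sgnz_sub, sgnz_one]
      · simp [e', sgnz_sub, sgnz_one]
  obtain ⟨u, hu, e⟩ := Bh_D (L0 hP (cone_acyc hg) hz)
  have u1 : LinearMap.fst k X.E Y.E ∘ₗ u ∈ HomG P X (n - 1) := by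
    refine HomG_of (fun j m hm => mem_cast (hu.1 j m hm).1 (by ring)) ?_ ?_
    · intro i x hx j m hm
      have := congrArg Prod.fst (hu.2.1 i x hx m)
      simp [sg_mem A.gr 1 hx, -zsmul_eq_mul] at this
      simp only [LinearMap.comp_apply, LinearMap.fst_apply, this, smul_smul]
      rw [mul_sub, mul_one, sgnz_sub, mul_assoc, sgnz_sq, mul_one]
    · intro i x hx j m hm
      have := congrArg Prod.fst (hu.2.2 x m)
      simpa using this
  refine Bh_of (Submodule.neg_mem _ u1) ?_
  intro j x hx
  have := congrArg Prod.fst (e x)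
  simp [sgnz_sub, sgnz_one] at this
  simp [this]

/-- induced map on cohomology of Hom complexes -/
def Umap (P : DGBimod A) {X Y : PB A} (g : PBHom X Y) (n : ℤ) : UH P X n →ₗ[k] UH P Y n :=
  Submodule.mapQ _ _ (((LinearMap.llcomp k P.M X.E Y.E) g.f).restrict (fun f hf => Zh_comp g hf))
    (fun f hf => Bh_comp g hf)

theorem Umap_bij {P : DGBimod A} (hP : IsHoProjB P) {X Y : PB A} {g : PBHom X Y} (hg : QI g) (n : ℤ) :
    Function.Bijective (Umap P g n) := by
  constructor
  · rw [← LinearMap.ker_eq_bot, LinearMap.ker_eq_bot']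
    intro x hx
    obtain ⟨f, rfl⟩ := Submodule.Quotient.mk_surjective _ x
    refine (Submodule.Quotient.mk_eq_zero _).2 ?_
    exact L_inj hP hg f.2 ((Submodule.Quotient.mk_eq_zero ((Bh P Y n).comap (Zh P Y n).subtype)).1 hx)
  · intro y
    obtain ⟨f, rfl⟩ := Submodule.Quotient.mk_surjective _ y
    obtain ⟨f', hf', h⟩ := L_surj hP hg f.2
    exact ⟨Submodule.Quotient.mk ⟨f', hf'⟩, (Submodule.Quotient.eq _).2 h⟩

def Ueq {P : DGBimod A} (hP : IsHoProjB P) {X Y : PB A} {g : PBHom X Y} (hg : QI g) (n : ℤ) :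
    UH P X n ≃ₗ[k] UH P Y n := LinearEquiv.ofBijective _ (Umap_bij hP hg n)

/-! ## Contractions -/
theorem contr {E : Type} [AddCommGroup E] [Module k E] (gm : ℤ → Submodule k E) (D : E →ₗ[k] E)
    (hdeg : ∀ j, ∀ m ∈ gm j, D m ∈ gm (j + 1)) (hsq : ∀ m, D (D m) = 0) (pi : ℤ → E →ₗ[k] E)
    (h : ∀ n, ∀ z ∈ gm n, D z = 0 → D (pi n z) = 0 ∧ ∃ y ∈ gm (n - 1), D y = z - pi n z)
    (hb : ∀ n, ∀ y ∈ gm (n - 1), pi n (D y) = 0) :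
    ∃ κ σ : ℤ → E →ₗ[k] E, ∀ n, ∀ x ∈ gm n, κ n x ∈ gm (n - 1) ∧ σ n x ∈ gm n ∧ D (σ n x) = 0 ∧
      D (κ n x) + κ (n + 1) (D x) = x - pi n (σ n x) ∧ (D x = 0 → σ n x = x) := by
  have h1 : ∀ n, ∃ ρ : E →ₗ[k] E, (∀ x, ρ x ∈ gm (n - 1)) ∧ ∀ y ∈ gm (n - 1), D (ρ (D y)) = D y := by
    intro n
    let Bn : Submodule k E := (gm (n - 1)).map D
    let s : gm (n - 1) →ₗ[k] Bn := (D ∘ₗ (gm (n - 1)).subtype).codRestrict Bn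
      (fun x => ⟨x, x.2, rfl⟩)
    have hs : LinearMap.range s = ⊤ := by
      rw [LinearMap.range_eq_top]
      rintro ⟨_, y, hy, rfl⟩
      exact ⟨⟨y, hy⟩, rfl⟩
    obtain ⟨r, hr⟩ := s.exists_rightInverse_of_surjective hs
    refine ⟨(gm (n - 1)).subtype ∘ₗ r ∘ₗ prj Bn, fun x => (r (prj Bn x)).2, fun y hy => ?_⟩
    have hy' : D y ∈ Bn := ⟨y, hy, rfl⟩
    have := congrArg Subtype.val (LinearMap.congr_fun hr ⟨D y, hy'⟩)
    simp only [LinearMap.comp_apply, prj_mem Bn hy']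
    exact this
  choose ρ hρ1 hρ2 using h1
  let σ : ℤ → E →ₗ[k] E := fun n => LinearMap.id - ρ (n + 1) ∘ₗ D
  have hs1 : ∀ n x, σ n x = x - ρ (n + 1) (D x) := fun n x => rfl
  have hs2 : ∀ n, ∀ x ∈ gm n, σ n x ∈ gm n := fun n x hx =>
    sub_mem hx (mem_cast (hρ1 (n + 1) (D x)) (by ring))
  have hs3 : ∀ n, ∀ x ∈ gm n, D (σ n x) = 0 := fun n x hx => by
    rw [hs1, map_sub, hρ2 (n + 1) x (mem_cast hx (by ring)), sub_self]
  have hs4 : ∀ n x, D x = 0 → σ n x = x := fun n x hx => by simp [hs1, hx]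
  refine ⟨fun n => ρ n ∘ₗ (LinearMap.id - pi n) ∘ₗ σ n, σ, fun n x hx =>
    ⟨hρ1 n _, hs2 n x hx, hs3 n x hx, ?_, hs4 n x⟩⟩
  simp only [LinearMap.comp_apply, LinearMap.sub_apply, LinearMap.id_apply]
  obtain ⟨-, y, hy, e⟩ := h n _ (hs2 n x hx) (hs3 n x hx)
  rw [← e, hρ2 n y hy, e, hs4 (n + 1) (D x) (hsq x), hb (n + 1) x (mem_cast hx (by ring)), sub_zero,
    hs1 n x]
  abel

theorem KQI {X Y : DGBimod A} (g : BimodHom X Y) (hg : QI (PBHom.ofDG g)) :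
    ∃ (g' : Y.M →ₗ[k] X.M) (κ : Y.M →ₗ[k] Y.M) (l : X.M →ₗ[k] X.M),
      (∀ n, ∀ y ∈ Y.gm n, g' y ∈ X.gm n) ∧ (∀ n, ∀ y ∈ Y.gm n, κ y ∈ Y.gm (n - 1)) ∧
      (∀ n, ∀ x ∈ X.gm n, l x ∈ X.gm (n - 1)) ∧ (∀ y, g' (Y.D y) = X.D (g' y)) ∧
      (∀ y, g.f (g' y) = y - Y.D (κ y) - κ (Y.D y)) ∧
      (∀ x, g' (g.f x) = x + X.D (l x) + l (X.D x)) := by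
  let C := cone (PBHom.ofDG g)
  obtain ⟨κ, σ, H⟩ := contr C.gm C.D C.D_deg C.D_sq (fun _ => 0)
    (fun n z hz hD => ⟨by simp, by
      obtain ⟨y, hy, e⟩ := cone_acyc hg n z hz hD
      exact ⟨y, hy, e.trans (by simp)⟩⟩) (by simp)
  let iy : Y.M →ₗ[k] X.M × Y.M := LinearMap.inr k X.M Y.M
  let ix : X.M →ₗ[k] X.M × Y.M := LinearMap.inl k X.M Y.M
  let p1 : X.M × Y.M →ₗ[k] X.M := LinearMap.fst k X.M Y.M
  let p2 : X.M × Y.M →ₗ[k] Y.M := LinearMap.snd k X.M Y.M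
  have hy : ∀ n, ∀ y ∈ Y.gm n, iy y ∈ C.gm n := fun n y hy => ⟨zero_mem _, hy⟩
  have hx : ∀ n, ∀ x ∈ X.gm n, ix x ∈ C.gm (n - 1) := fun n y hy =>
    ⟨mem_cast hy (by ring), zero_mem _⟩
  have Dy : ∀ y, C.D (iy y) = iy (Y.D y) := fun y => by
    ext <;> simp [C, iy]
  have Dx : ∀ x, C.D (ix x) = iy (g.f x) - ix (X.D x) := fun y => by
    ext <;> simp [C, iy, ix, PBHom.ofDG]
  have DC1 : ∀ p, p1 (C.D p) = - X.D (p1 p) := fun p => by simp [p1, C]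
  have DC2 : ∀ p, p2 (C.D p) = g.f (p1 p) + Y.D (p2 p) := fun p => by simp [p1, p2, C, PBHom.ofDG]
  let g' := glue Y.gm (fun n => p1 ∘ₗ κ n ∘ₗ iy)
  let kk := glue Y.gm (fun n => p2 ∘ₗ κ n ∘ₗ iy)
  let l := glue X.gm (fun n => p1 ∘ₗ κ (n - 1) ∘ₗ ix)
  have eg : ∀ n, ∀ y ∈ Y.gm n, g' y = p1 (κ n (iy y)) := fun n y hy => glue_mem Y.gm _ hy
  have ek : ∀ n, ∀ y ∈ Y.gm n, kk y = p2 (κ n (iy y)) := fun n y hy => glue_mem Y.gm _ hy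
  have el : ∀ n, ∀ x ∈ X.gm n, l x = p1 (κ (n - 1) (ix x)) := fun n y hy => glue_mem X.gm _ hy
  have H1 : ∀ n, ∀ p ∈ C.gm n, κ n p ∈ C.gm (n - 1) := fun n p hp => (H n p hp).1
  have H2 : ∀ n, ∀ p ∈ C.gm n, C.D (κ n p) + κ (n + 1) (C.D p) = p := fun n p hp => by
    have := (H n p hp).2.2.2.1
    simpa using this
  clear_value g' kk l
  refine ⟨g', kk, l, ?_, ?_, ?_, ?_, ?_, ?_⟩
  · intro n y hy'
    rw [eg n y hy']; exact mem_cast (H1 _ _ (hy n y hy')).1 (by ring)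
  · intro n y hy'
    rw [ek n y hy']; exact (H1 _ _ (hy n y hy')).2
  · intro n y hy'
    rw [el n y hy']; exact mem_cast (H1 _ _ (hx n y hy')).1 (by ring)
  · intro y
    induction y using gr_induction Y.gm with
    | h0 => simp
    | ha a b h1 h2 => simp only [map_add, h1, h2]
    | h n y hy' =>
      have := congrArg p1 (H2 n _ (hy n y hy'))
      rw [map_add, DC1, Dy, ← eg n y hy', ← eg _ _ (Y.D_deg n y hy')] at this
      have e : p1 (iy y) = 0 := rfl
      rw [e] at this
      exact (neg_add_eq_zero.mp this).symm
  · intro y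
    induction y using gr_induction Y.gm with
    | h0 => simp
    | ha a b h1 h2 => simp only [map_add, h1, h2]; abel
    | h n y hy' =>
      have := congrArg p2 (H2 n _ (hy n y hy'))
      rw [map_add, DC2, Dy, ← eg n y hy', ← ek n y hy', ← ek _ _ (Y.D_deg n y hy')] at this
      have e : p2 (iy y) = y := rfl
      rw [e] at this
      linear_combination (norm := module) this
  · intro x
    induction x using gr_induction X.gm with
    | h0 => simp
    | ha a b h1 h2 => simp only [map_add, h1, h2]; abel
    | h n x hx' =>
      have := congrArg p1 (H2 _ _ (hx n x hx'))
      rw [map_add, DC1, Dx, map_sub, map_sub, sub_add_cancel, ← eg n _ (g.deg n x hx'), ← el n x hx',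
        show κ n (ix (X.D x)) = κ (n + 1 - 1) (ix (X.D x)) by rw [add_sub_cancel_right],
        ← el _ _ (X.D_deg n x hx')] at this
      have e : p1 (ix x) = x := rfl
      rw [e] at this
      linear_combination (norm := module) this

/-! ## Dual bimodules -/
abbrev dualB (Y : DGBimod A) : PB A where
  E := Y.M →ₗ[k] k
  gm := dualGrade Y.gm
  aL := LinearMap.mk₂ k (fun a φ => φ ∘ₗ Y.actR (sg A.gr 1 a))
    (fun _ _ _ => by ext; simp) (fun _ _ _ => by ext; simp) (fun _ _ _ => by ext; simp)
    (fun _ _ _ => by ext; simp)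
  aR := LinearMap.mk₂ k (fun a φ => φ ∘ₗ Y.actL a)
    (fun _ _ _ => by ext; simp) (fun _ _ _ => by ext; simp) (fun _ _ _ => by ext; simp)
    (fun _ _ _ => by ext; simp)
  aL_one := fun m => by ext; simp [A_sg_one, Y.actR_one]
  aR_one := fun m => by ext; simp [Y.actL_one]
  aL_mul := fun x y m => by ext; simp [A_sg_mul, Y.actR_mul]
  aR_mul := fun x y m => by ext; simp [Y.actL_mul]
  aLR := fun x y m => by ext; simp [Y.actLR]
  aL_deg := fun i j x m hx hm l hl y hy =>
    hm (l + i) (by omega) _ (Y.actR_deg i l _ y (sg_mem' A.gr 1 hx) hy)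
  aR_deg := fun i j x m hx hm l hl y hy =>
    hm (i + l) (by omega) _ (Y.actL_deg i l x y hx hy)
  D := (LinearMap.llcomp k Y.M Y.M k).flip (Y.D ∘ₗ sg Y.gm 1)
  D_deg := fun j m hm l hl y hy => by
    simp only [LinearMap.flip_apply, LinearMap.llcomp_apply, LinearMap.comp_apply]
    exact hm (l + 1) (by omega) _ (Y.D_deg l _ (sg_mem' Y.gm 1 hy))
  D_sq := fun m => by
    ext y
    simp [sg_D Y.gm 1 Y.D Y.D_deg, sgnz_one, Y.D_sq]
  leibL := fun i j x m hx hm => by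
    apply gr_ext Y.gm
    intro l y hy
    simp only [LinearMap.flip_apply, LinearMap.llcomp_apply, LinearMap.comp_apply,
      LinearMap.mk₂_apply, LinearMap.add_apply, LinearMap.smul_apply]
    rw [sg_mem A.gr 1 hx, sg_mem A.gr 1 (A.d_deg i x hx), sg_mem Y.gm 1 hy]
    simp only [map_zsmul, LinearMap.smul_apply]
    rw [sg_mem Y.gm 1 (Y.actR_deg i l x y hx hy)]
    simp only [map_zsmul]
    rw [Y.leibnizR i l x y hx hy, map_add, map_zsmul]
    simp only [one_mul, sgnz_add, sgnz_one]
    rcases sgnz_cases i with h | h <;> rcases sgnz_cases l with h' | h' <;> simp [h, h']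
  leibR := fun i j x m hx hm => by
    apply gr_ext Y.gm
    intro l y hy
    simp only [LinearMap.flip_apply, LinearMap.llcomp_apply, LinearMap.comp_apply,
      LinearMap.mk₂_apply, LinearMap.add_apply, LinearMap.smul_apply]
    rw [sg_mem Y.gm 1 hy, map_zsmul, map_zsmul, map_zsmul,
      sg_mem Y.gm 1 (Y.actL_deg i l x y hx hy), map_zsmul, map_zsmul, Y.leibnizL i l x y hx hy,
      map_add, map_zsmul]
    by_cases e : i + 1 + l = -j
    · have : j = -(i + 1 + l) := by omega
      simp only [this, one_mul, sgnz_add, sgnz_one, sgnz_neg]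
      rcases sgnz_cases i with h | h <;> rcases sgnz_cases l with h' | h' <;> simp [h, h']
    · rw [hm _ e _ (Y.actL_deg _ l _ y (A.d_deg i x hx) hy)]
      simp only [one_mul, sgnz_add]
      rcases sgnz_cases i with h | h <;> rcases sgnz_cases l with h' | h' <;> simp [h, h']

theorem dualB_D {Y : DGBimod A} (φ : Y.M →ₗ[k] k) (y : Y.M) :
    (dualB Y).D φ y = φ (Y.D (sg Y.gm 1 y)) := rfl

theorem dualB_closed {Y : DGBimod A} {φ : Y.M →ₗ[k] k} (h : (dualB Y).D φ = 0) (y : Y.M) :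
    φ (Y.D y) = 0 := by
  have := LinearMap.congr_fun h (sg Y.gm 1 y)
  rw [dualB_D, sg_sg] at this; exact this

def dualMap {X Y : DGBimod A} (g : BimodHom X Y) : PBHom (dualB Y) (dualB X) where
  f := (LinearMap.llcomp k X.M Y.M k).flip g.f
  deg := fun j m hm l hl x hx => hm l hl _ (g.deg l x hx)
  aLc := fun x m => by ext; simp [g.actRc]
  aRc := fun x m => by ext; simp [g.actLc]
  comm := fun m => by
    apply gr_ext X.gm
    intro l x hx
    simp [sg_mem X.gm 1 hx, sg_mem Y.gm 1 (g.deg l x hx), g.comm]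

theorem dualMap_f {X Y : DGBimod A} (g : BimodHom X Y) (φ : Y.M →ₗ[k] k) (x : X.M) :
    (dualMap g).f φ x = φ (g.f x) := rfl

theorem dualMap_qi {X Y : DGBimod A} (g : BimodHom X Y) (hg : QI (PBHom.ofDG g)) :
    QI (dualMap g) := by
  obtain ⟨g', κ, l, h1, h2, h3, h4, h5, h6⟩ := KQI g hg
  constructor
  · intro n z hz hDz
    have hc := dualB_closed hDz
    refine ⟨z ∘ₗ g', fun l hl y hy => hz l hl _ (h1 l y hy), ?_, -(z ∘ₗ l ∘ₗ sg X.gm 1), ?_, ?_⟩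
    · ext y
      rw [dualB_D, LinearMap.comp_apply, h4, hc]; rfl
    · intro j hj x hx
      simp only [LinearMap.neg_apply, LinearMap.comp_apply]
      rw [hz (j - 1) (by omega) _ (h3 j _ (sg_mem' X.gm 1 hx)), neg_zero]
    · ext x
      rw [LinearMap.add_apply, dualMap_f, dualB_D, LinearMap.comp_apply, h6, map_add, map_add, hc]
      simp only [LinearMap.neg_apply, LinearMap.comp_apply]
      rw [sg_D X.gm 1 X.D X.D_deg, sg_sg, sgnz_one]
      simp
  · intro n w hw hDw y hy e
    have hc := dualB_closed hDw
    refine ⟨y ∘ₗ g' - w ∘ₗ κ ∘ₗ sg Y.gm 1, sub_mem (fun j hj x hx => hy j hj _ (h1 j x hx)) ?_, ?_⟩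
    · intro j hj x hx
      exact hw (j - 1) (by omega) _ (h2 j _ (sg_mem' Y.gm 1 hx))
    · apply gr_ext Y.gm
      intro j x hx
      have e1 := LinearMap.congr_fun e (g' x)
      rw [dualMap_f, dualB_D, h5, map_sub, map_sub, hc, sg_mem X.gm 1 (h1 j x hx), map_zsmul,
        map_zsmul] at e1
      rw [dualB_D, sg_mem Y.gm 1 hx]
      simp only [LinearMap.sub_apply, LinearMap.comp_apply, map_zsmul]
      rw [sg_mem Y.gm 1 (Y.D_deg j x hx), h4, map_zsmul, map_zsmul]
      simp only [one_mul, sgnz_add, sgnz_one] at e1 ⊢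
      rw [sub_zero, sub_eq_iff_eq_add] at e1
      rw [e1]
      rcases sgnz_cases j with h | h <;> simp [h] <;> abel

theorem compact_data (hc : IsCompactAlg A) :
    ∃ (I : Type) (_ : Fintype I) (dg : I → ℤ) (ν : I → A.R →ₗ[k] k) (z : I → A.R)
      (h : A.R →ₗ[k] A.R), (∀ i, ν i ∈ dualGrade A.gr (-(dg i))) ∧ (∀ i x, ν i (A.d x) = 0) ∧
      (∀ i, z i ∈ A.gr (dg i)) ∧ (∀ i, A.d (z i) = 0) ∧ (∀ n, ∀ x ∈ A.gr n, h x ∈ A.gr (n - 1)) ∧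
      ∀ x, x - ∑ i, ν i x • z i = A.d (h x) + h (A.d x) := by
  classical
  haveI := hc.1
  let S := hc.2.toFinset
  let q : ∀ n, Zg A.gr A.d n →ₗ[k] Hg A.gr A.d n := fun n => Submodule.mkQ _
  have hq : ∀ n, Function.Surjective (q n) := fun n => Submodule.mkQ_surjective _
  have hq0 : ∀ n w, q n w = 0 ↔ (w : A.R) ∈ Bg A.gr A.d n := fun n w =>
    Submodule.Quotient.mk_eq_zero (Submodule.comap (Zg A.gr A.d n).subtype (Bg A.gr A.d n))
  clear_value q
  let b := fun n => Module.finBasis k (Hg A.gr A.d n)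
  choose zz hzz using fun n (i : Fin (Module.finrank k (Hg A.gr A.d n))) => hq n (b n i)
  let c : ∀ n, Fin (Module.finrank k (Hg A.gr A.d n)) → A.R →ₗ[k] k := fun n i =>
    (b n).coord i ∘ₗ q n ∘ₗ prj (Zg A.gr A.d n)
  let pi : ℤ → A.R →ₗ[k] A.R := fun n => ∑ i, (c n i).smulRight (zz n i : A.R)
  have pi_ap : ∀ n x, pi n x = ∑ i, c n i x • (zz n i : A.R) := fun n x => by
    simp [pi, LinearMap.sum_apply]
  have cB : ∀ n i, ∀ y ∈ A.gr (n - 1), c n i (A.d y) = 0 := fun n i y hy => by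
    have h1 : A.d y ∈ A.gr n := mem_cast (A.d_deg _ _ hy) (by ring)
    have hz : A.d y ∈ Zg A.gr A.d n := ⟨h1, A.d_sq y⟩
    have : q n ⟨A.d y, hz⟩ = 0 := (hq0 _ _).2 ⟨h1, y, rfl⟩
    simp only [c, LinearMap.comp_apply, prj_mem _ hz, this, map_zero]
  obtain ⟨κ, σ, H⟩ := contr A.gr A.d A.d_deg A.d_sq pi (by
    intro n z hz hD
    have e : pi n z = ((∑ i, c n i z • zz n i : Zg A.gr A.d n) : A.R) := by
      rw [pi_ap]; push_cast; rfl
    have hmem : z ∈ Zg A.gr A.d n := ⟨hz, hD⟩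
    rw [e]
    refine ⟨(∑ i, c n i z • zz n i : Zg A.gr A.d n).2.2, ?_⟩
    have hB : q n (⟨z, hmem⟩ - ∑ i, c n i z • zz n i) = 0 := by
      rw [map_sub, map_sum]
      simp only [map_smul, hzz, c, LinearMap.comp_apply, prj_mem _ hmem]
      rw [sub_eq_zero]
      exact ((b n).sum_repr _).symm
    have := (hq0 _ _).1 hB
    obtain ⟨y, hy, e⟩ := range_homog A.gr A.d A.d_deg this.1 this.2
    exact ⟨y, hy, e⟩) (by
    intro n y hy
    rw [pi_ap]
    exact Finset.sum_eq_zero fun i _ => by rw [cB n i y hy, zero_smul])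
  refine ⟨(Σ n : S, Fin (Module.finrank k (Hg A.gr A.d n))), inferInstance, fun p => p.1,
    fun p => c p.1 p.2 ∘ₗ σ p.1 ∘ₗ grp A.gr p.1, fun p => zz p.1 p.2, glue A.gr κ, ?_, ?_,
    fun p => (zz p.1 p.2).2.1, fun p => (zz p.1 p.2).2.2, ?_, ?_⟩
  · intro p l hl m hm
    change c p.1 p.2 (σ p.1 (grp A.gr p.1 m)) = 0
    rw [grp_ne A.gr hm (by simpa using hl), map_zero, map_zero]
  · intro p x
    induction x using gr_induction A.gr with
    | h0 => simp
    | ha a b h1 h2 => simp only [map_add, h1, h2, add_zero]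
    | h n x hx =>
      simp only [LinearMap.comp_apply]
      by_cases e : n + 1 = p.1
      · have hx' : A.d x ∈ A.gr p.1 := mem_cast (A.d_deg n x hx) e
        rw [grp_same A.gr hx', (H _ _ hx').2.2.2.2 (A.d_sq x)]
        exact cB _ _ _ (mem_cast hx (by omega))
      · rw [grp_ne A.gr (A.d_deg n x hx) e, map_zero, map_zero]
  · intro n x hx
    rw [glue_mem A.gr _ hx]; exact (H n x hx).1
  · intro x
    induction x using gr_induction A.gr with
    | h0 => simp
    | ha a b h1 h2 =>
      simp only [map_add, add_smul, Finset.sum_add_distrib]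
      linear_combination (norm := module) h1 + h2
    | h n x hx =>
      rw [glue_mem A.gr _ hx, glue_mem A.gr _ (A.d_deg n x hx), (H n x hx).2.2.2.1, Fintype.sum_sigma]
      congr 1
      have hS : ∀ m : S, (m : ℤ) ≠ n → ∑ i, (c m i ∘ₗ σ m ∘ₗ grp A.gr m) x • (zz m i : A.R) = 0 := by
        intro m hm
        apply Finset.sum_eq_zero
        intro i _
        simp only [LinearMap.comp_apply]
        rw [grp_ne A.gr hx hm.symm]; simp
      by_cases hn : n ∈ S
      · rw [Finset.sum_eq_single (⟨n, hn⟩ : S) (fun m _ hm => hS m (fun e => hm (Subtype.ext e)))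
          (by simp), pi_ap]
        simp only [LinearMap.comp_apply, grp_same A.gr hx]
      · rw [Finset.sum_eq_zero (fun m _ => hS m (fun e => hn (e ▸ m.2))), pi_ap]
        have : Subsingleton (Hg A.gr A.d n) := by
          by_contra h
          exact hn (hc.2.mem_toFinset.2 h)
        symm
        apply Finset.sum_eq_zero
        intro i _
        have : q n (prj (Zg A.gr A.d n) (σ n x)) = 0 := Subsingleton.elim _ _
        simp only [c, LinearMap.comp_apply, this, map_zero, zero_smul]

/-! ## Twisted bimodules -/
theorem biact_tmul (N : DGBimod A) {i j : ℤ} {a b : A.R} {m : N.M} (ha : a ∈ A.gr i)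
    (hm : m ∈ N.gm j) : biact N (a ⊗ₜ[k] b) m = sgnz (i * j) • N.actL a (N.actR b m) := by
  have : biact N (a ⊗ₜ[k] b) = biactAux N i ⟨a, ha⟩ b := by
    unfold biact
    rw [TensorProduct.lift.tmul, LinearMap.comp_apply]
    change (DirectSum.toModule k ℤ (A.R →ₗ[k] N.M →ₗ[k] N.M) (fun i => biactAux N i) (DirectSum.decompose A.gr a)) b = _
    rw [DirectSum.decompose_of_mem _ ha, ← DirectSum.lof_eq_of k, DirectSum.toModule_lof]
  rw [this]
  change N.actL a (N.actR b (gop N.gm _ m)) = _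
  rw [gop_mem N.gm _ hm, sgnk_smul, map_zsmul, map_zsmul]

structure Tw (T : DGBimod A) where
  s : ℕ
  r : Fin s → ℤ
  e : Fin s → T.M
  he : ∀ j, e j ∈ T.gm (-(r j))
  hD : ∀ j, T.D (e j) ∈ biSpan T (e '' {i | i < j})
  hb : Function.Bijective (fun v : Fin s → A.R ⊗[k] A.R => ∑ j, biact T (v j) (e j))

def Tw.Phi {T : DGBimod A} (W : Tw T) : (Fin W.s → A.R ⊗[k] A.R) ≃ₗ[k] T.M :=
  LinearEquiv.ofBijective (∑ j, (biact T).flip (W.e j) ∘ₗ LinearMap.proj j) (by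
    have := W.hb
    convert this using 1
    ext v; simp [LinearMap.sum_apply])

theorem Tw.Phi_ap {T : DGBimod A} (W : Tw T) (v) : W.Phi v = ∑ j, biact T (v j) (W.e j) := by
  simp [Tw.Phi, LinearMap.sum_apply]

theorem Tw.gen_eq {T : DGBimod A} (W : Tw T) (j : Fin W.s) {i : ℤ} {a : A.R} (b : A.R)
    (ha : a ∈ A.gr i) : T.actL a (T.actR b (W.e j)) =
      W.Phi (Pi.single j (sgnz (i * W.r j) • (a ⊗ₜ[k] b))) := by
  classical
  rw [Tw.Phi_ap, Finset.sum_eq_single j]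
  · rw [Pi.single_eq_same, map_zsmul, LinearMap.smul_apply, biact_tmul T ha (W.he j), smul_smul,
      ← sgnz_add]
    rw [show i * W.r j + i * -W.r j = 0 by ring, sgnz_zero, one_smul]
  · intro l _ hl
    rw [Pi.single_eq_of_ne hl, map_zero, LinearMap.zero_apply]
  · simp

theorem Tw.ind {T : DGBimod A} (W : Tw T) {p : T.M → Prop} (h0 : p 0)
    (ha : ∀ x y, p x → p y → p (x + y))
    (h : ∀ (j : Fin W.s) (i l : ℤ), ∀ a ∈ A.gr i, ∀ b ∈ A.gr l, p (T.actL a (T.actR b (W.e j)))) (m : T.M) :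
    p m := by
  obtain ⟨v, rfl⟩ := W.Phi.surjective m
  rw [Tw.Phi_ap]
  refine Finset.sum_induction _ p ha h0 fun j _ => ?_
  generalize v j = t
  induction t using TensorProduct.induction_on with
  | zero => simpa using h0
  | add x y hx hy => rw [map_add, LinearMap.add_apply]; exact ha _ _ hx hy
  | tmul a b =>
    induction a using gr_induction A.gr with
    | h0 => simpa using h0
    | ha x y hx hy => rw [TensorProduct.add_tmul, map_add, LinearMap.add_apply]; exact ha _ _ hx hy
    | h i a hh =>
      induction b using gr_induction A.gr with
      | h0 => simpa using h0
      | ha x y hx hy => rw [TensorProduct.tmul_add, map_add, LinearMap.add_apply]; exact ha _ _ hx hy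
      | h l b hb =>
        have := h j i l _ hh _ (zsm_mem _ (sgnz (i * -W.r j)) hb)
        rw [map_zsmul, LinearMap.smul_apply, map_zsmul] at this
        rwa [biact_tmul T hh (W.he j)]

/-- the map `a ⊗ b ↦ ± a y b` -/
def bimp (N : PB A) (t : ℤ) : N.E →ₗ[k] (A.R ⊗[k] A.R) →ₗ[k] N.E :=
  LinearMap.flip (TensorProduct.lift (LinearMap.mk₂ k (fun a b => N.aL (sg A.gr t a) ∘ₗ N.aR b)
    (fun _ _ _ => by ext; simp) (fun _ _ _ => by ext; simp) (fun _ _ _ => by ext; simp)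
    (fun _ _ _ => by ext; simp)))

theorem bimp_ap (N : PB A) (t : ℤ) (y : N.E) (a b : A.R) :
    bimp N t y (a ⊗ₜ[k] b) = N.aL (sg A.gr t a) (N.aR b y) := by
  simp [bimp]

/-- the map from the free bimodule sending `e j` to `y` -/
def Tw.frm {T : DGBimod A} (W : Tw T) (N : PB A) (n : ℤ) (j : Fin W.s) :
    N.E →ₗ[k] T.M →ₗ[k] N.E :=
  (LinearMap.lcomp k N.E (LinearMap.proj (R := k) (φ := fun _ => A.R ⊗[k] A.R) j ∘ₗ W.Phi.symm.toLinearMap)) ∘ₗ bimp N (n - W.r j)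

theorem Tw.frm_ap {T : DGBimod A} (W : Tw T) (N : PB A) (n : ℤ) (j l : Fin W.s) (y : N.E)
    {i : ℤ} {a : A.R} (b : A.R) (ha : a ∈ A.gr i) :
    W.frm N n j y (T.actL a (T.actR b (W.e l))) =
      if l = j then sgnz (i * n) • N.aL a (N.aR b y) else 0 := by
  rw [W.gen_eq l b ha]
  change bimp N _ y (LinearMap.proj (R := k) (φ := fun _ => A.R ⊗[k] A.R) j (W.Phi.symm (W.Phi _))) = _
  rw [LinearEquiv.symm_apply_apply, LinearMap.proj_apply]
  split_ifs with h
  · subst h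
    rw [Pi.single_eq_same, map_zsmul, bimp_ap, sg_mem A.gr _ ha, map_zsmul, LinearMap.smul_apply,
      smul_smul, ← sgnz_add]
    rw [show i * W.r l + (n - W.r l) * i = i * n by ring]
  · rw [Pi.single_eq_of_ne' h, map_zero]

theorem Tw.frm_e {T : DGBimod A} (W : Tw T) (N : PB A) (n : ℤ) (j l : Fin W.s) (y : N.E) :
    W.frm N n j y (W.e l) = if l = j then y else 0 := by
  have := W.frm_ap N n j l y 1 A.one_mem
  rw [T.actL_one, T.actR_one, N.aL_one, N.aR_one, zero_mul, sgnz_zero, one_smul] at this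
  exact this

theorem Tw.frm_mem {T : DGBimod A} (W : Tw T) (N : PB A) (n : ℤ) (j : Fin W.s) {y : N.E}
    (hy : y ∈ N.gm (n - W.r j)) : W.frm N n j y ∈ HomG T N n := by
  refine ⟨fun q m hm => ?_, fun i x hx m => ?_, fun x m => ?_⟩
  · have key : ∀ m : T.M, ∀ q, W.frm N n j y (grp T.gm q m) ∈ N.gm (q + n) := by
      intro m
      induction m using W.ind with
      | h0 => intro q; simp
      | ha x y hx hy => intro q; rw [map_add, map_add]; exact add_mem (hx q) (hy q)
      | h l i p a ha b hb =>
        intro q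
        have hm := T.actL_deg _ _ _ _ ha (T.actR_deg _ _ _ _ hb (W.he l))
        by_cases e : i + (-W.r l + p) = q
        · subst e
          rw [grp_same T.gm hm, W.frm_ap N n j l y b ha]
          split_ifs with h
          · subst h
            exact zsm_mem _ _ (mem_cast (N.aL_deg _ _ _ _ ha (N.aR_deg _ _ _ _ hb hy)) (by ring))
          · exact zero_mem _
        · rw [grp_ne T.gm hm e, map_zero]; exact zero_mem _
    have := key m q
    rwa [grp_same T.gm hm] at this
  · induction m using W.ind with
    | h0 => simp
    | ha x y hx hy => simp only [map_add, hx, hy, smul_add]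
    | h l i' p a ha b hb =>
      rw [← T.actL_mul, W.frm_ap N n j l y b (A.mul_mem hx ha), W.frm_ap N n j l y b ha]
      split_ifs with h
      · rw [N.aL_mul, map_zsmul, smul_smul, add_mul, sgnz_add]
      · simp
  · induction m using W.ind with
    | h0 => simp
    | ha x y hx hy => simp only [map_add, hx, hy]
    | h l i' p a ha b hb =>
      rw [← T.actLR, ← T.actR_mul, W.frm_ap N n j l y _ ha, W.frm_ap N n j l y b ha]
      split_ifs with h
      · rw [N.aR_mul, map_zsmul, N.aLR]
      · simp

theorem Tw.ext {T : DGBimod A} (W : Tw T) {N : PB A} {n : ℤ} {f g : T.M →ₗ[k] N.E}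
    (hf : f ∈ HomG T N n) (hg : g ∈ HomG T N n) (h : ∀ j, f (W.e j) = g (W.e j)) : f = g := by
  ext m
  induction m using W.ind with
  | h0 => simp
  | ha x y hx hy => simp only [map_add, hx, hy]
  | h l i' p a ha b hb => rw [hf.2.1 _ _ ha, hg.2.1 _ _ ha, hf.2.2, hg.2.2, h]

theorem kill_biSpan {T : DGBimod A} {N : PB A} {n : ℤ} {f : T.M →ₗ[k] N.E}
    (hf : f ∈ HomG T N n) {S : Set T.M} (h : ∀ x ∈ S, f x = 0) {m : T.M} (hm : m ∈ biSpan T S) :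
    f m = 0 := by
  have : m ∈ LinearMap.ker f := by
    refine (Submodule.mem_sInf.1 hm) _ ⟨h, fun x m hm => ?_, fun x m hm => ?_⟩
    · have hm : f m = 0 := hm
      change f _ = 0
      induction x using gr_induction A.gr with
      | h0 => simp
      | ha a b h1 h2 => simp only [map_add, LinearMap.add_apply, h1, h2, add_zero]
      | h i x hx => rw [hf.2.1 _ _ hx, hm, map_zero, smul_zero]
    · change f _ = 0
      rw [hf.2.2, show f m = 0 from hm, map_zero]
  exact this

theorem Tw.hoProj {T : DGBimod A} (W : Tw T) : IsHoProjB T := by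
  intro N hN F
  have hF : F.f ∈ Zh T (ofDG N) 0 := Zh_of
    ⟨fun j m hm => mem_cast (gm := N.gm) (F.deg j m hm) (by ring), fun i x hx m => by
      rw [mul_zero, sgnz_zero, one_smul]; exact F.actLc x m, F.actRc⟩
    fun j x _ => by rw [sgnz_zero, one_smul]; exact (F.comm x).symm
  have key : ∀ q : ℕ, ∃ h ∈ HomG T (ofDG N) (0 - 1), ∀ j : Fin W.s, (j : ℕ) < q →
      (F.f - dl T (ofDG N) (0 - 1) h) (W.e j) = 0 := by
    intro q
    induction q with
    | zero => exact ⟨0, zero_mem _, fun j hj => by omega⟩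
    | succ q ih =>
      obtain ⟨h, hh, e⟩ := ih
      by_cases hq : q < W.s
      swap
      · exact ⟨h, hh, fun j hj => e j (by omega)⟩
      have hz : F.f - dl T (ofDG N) (0 - 1) h ∈ Zh T (ofDG N) 0 :=
        sub_mem hF (Bh_le _ _ _ ⟨h, hh, rfl⟩)
      set f' := F.f - dl T (ofDG N) (0 - 1) h with hf'
      clear_value f'
      let J : Fin W.s := ⟨q, hq⟩
      have hDz : N.D (f' (W.e J)) = 0 := by
        have := Zh_D hz (W.e J)
        rw [show (ofDG N).D = N.D from rfl] at this
        rw [this, kill_biSpan hz.1 _ (W.hD J), smul_zero]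
        rintro _ ⟨i, hi, rfl⟩
        exact e i hi
      have hd := hz.1.1 _ _ (W.he J)
      obtain ⟨hd', hr⟩ := hN _ ⟨hd, hDz⟩
      obtain ⟨y, hy, ey⟩ := range_homog N.gm N.D N.D_deg hd' hr
      have hm := W.frm_mem (ofDG N) (0 - 1) J (y := y) (mem_cast (gm := N.gm) hy (by ring))
      refine ⟨h + W.frm (ofDG N) (0 - 1) J y, add_mem hh hm, fun j hj => ?_⟩
      rw [map_add, ← sub_sub, ← hf', LinearMap.sub_apply, dl_apply, W.frm_e]
      rw [kill_biSpan hm _ (W.hD j), smul_zero, sub_zero]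
      · by_cases hjJ : j = J
        · subst hjJ
          rw [if_pos rfl, sub_eq_zero]; exact ey.symm
        · rw [if_neg hjJ, map_zero, sub_zero]
          exact e j (by have : (j : ℕ) ≠ q := fun h => hjJ (Fin.ext h)
                        omega)
      · rintro _ ⟨i, hi, rfl⟩
        rw [W.frm_e, if_neg]
        rintro rfl
        have : (J : ℕ) < j := hi
        simp only [J] at this
        omega
  obtain ⟨h, hh, e⟩ := key W.s
  have : F.f = dl T (ofDG N) (0 - 1) h :=
    W.ext hF.1 (mem_cast (dl_mem hh) (by ring)) fun j => sub_eq_zero.1 (by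
      have := e j j.2; rwa [LinearMap.sub_apply] at this)
  refine ⟨h, hh.1, fun i x hx m => ?_, hh.2.2, fun m => ?_⟩
  · rw [hh.2.1 i x hx]; congr 1; rw [show i * (0 - 1) = -i by ring, sgnz_neg]
  · change F.f m - 0 = _
    rw [this, dl_apply, sub_zero, show (0 - 1 : ℤ) = -1 by ring, sgnz_neg, sgnz_one, neg_smul,
      one_smul, sub_neg_eq_add]

theorem BHom_Zh {X Y : DGBimod A} (g : BimodHom X Y) : g.f ∈ Zh X (ofDG Y) 0 := Zh_of
    ⟨fun j m hm => mem_cast (gm := Y.gm) (g.deg j m hm) (by ring), fun i x hx m => by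
      rw [mul_zero, sgnz_zero, one_smul]; exact g.actLc x m, g.actRc⟩
    fun j x _ => by rw [sgnz_zero, one_smul]; exact (g.comm x).symm

def Zh_BHom {X Y : DGBimod A} {f : X.M →ₗ[k] Y.M} (hf : f ∈ Zh X (ofDG Y) 0) : BimodHom X Y where
  f := f
  deg := fun j m hm => mem_cast (gm := Y.gm) (hf.1.1 j m hm) (by ring)
  actLc := fun x m => by
    induction x using gr_induction A.gr with
    | h0 => simp
    | ha a b h1 h2 => simp only [map_add, LinearMap.add_apply, h1, h2]
    | h i x hx =>
      have := hf.1.2.1 i x hx m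
      rwa [mul_zero, sgnz_zero, one_smul] at this
  actRc := hf.1.2.2
  comm := fun m => by
    have := Zh_D hf m
    rw [sgnz_zero, one_smul] at this
    exact this.symm

theorem precomp_HomG {X Y : DGBimod A} (g : BimodHom X Y) {N : PB A} {n : ℤ} {f : Y.M →ₗ[k] N.E}
    (hf : f ∈ HomG Y N n) : f ∘ₗ g.f ∈ HomG X N n :=
  ⟨fun j m hm => hf.1 j _ (g.deg j m hm), fun i x hx m => by
    rw [LinearMap.comp_apply, g.actLc, hf.2.1 i x hx]; rfl, fun x m => by
    rw [LinearMap.comp_apply, g.actRc, hf.2.2]; rfl⟩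

theorem precomp_dl {X Y : DGBimod A} (g : BimodHom X Y) {N : PB A} (n : ℤ) (f : Y.M →ₗ[k] N.E) :
    dl X N n (f ∘ₗ g.f) = dl Y N n f ∘ₗ g.f := by
  ext x; simp only [dl_apply, LinearMap.comp_apply, g.comm]

theorem precomp_Zh {X Y : DGBimod A} (g : BimodHom X Y) {N : PB A} {n : ℤ} {f : Y.M →ₗ[k] N.E}
    (hf : f ∈ Zh Y N n) : f ∘ₗ g.f ∈ Zh X N n := by
  refine ⟨precomp_HomG g hf.1, ?_⟩
  change dl X N n _ = 0
  rw [precomp_dl, show dl Y N n f = 0 from hf.2, LinearMap.zero_comp]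

theorem precomp_Bh {X Y : DGBimod A} (g : BimodHom X Y) {N : PB A} {n : ℤ} {f : Y.M →ₗ[k] N.E}
    (hf : f ∈ Bh Y N n) : f ∘ₗ g.f ∈ Bh X N n := by
  obtain ⟨h, hh, rfl⟩ := hf
  exact ⟨_, precomp_HomG g hh, precomp_dl g _ h⟩

theorem summand (hs : IsSmooth A) {P : DGBimod A} {F : BimodHom P (diagBimod A)}
    (hP : IsDiagResolution P F) : ∃ (T : DGBimod A) (_ : Tw T) (ι : BimodHom P T)
      (ρ : BimodHom T P), ρ.f ∘ₗ ι.f - LinearMap.id ∈ Bh P (ofDG P) 0 := by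
  obtain ⟨T, P', ⟨s, r, e, h1, h2, h3⟩, ⟨ι, ρ', h, g1, g2, g3, g4⟩, F', hF'⟩ := hs
  let W : Tw T := ⟨s, r, e, h1, h2, h3⟩
  obtain ⟨u, hu, eu⟩ := L_surj hP.1 (qi_of_data F' hF') (BHom_Zh F)
  let U := Zh_BHom hu
  obtain ⟨w, hw, ew⟩ := L_surj W.hoProj (qi_of_data F hP.2) (BHom_Zh (F'.comp ρ'))
  let R := Zh_BHom hw
  refine ⟨T, W, ι.comp U, R, ?_⟩
  have e3 : F'.f ∘ₗ ρ'.f ∘ₗ ι.f - F'.f ∈ Bh P' (ofDG (diagBimod A)) 0 := by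
    have : ρ'.f ∘ₗ ι.f - LinearMap.id ∈ Bh P' (ofDG P') 0 := by
      refine Bh_of (g := h) ⟨fun j m hm => mem_cast (gm := P'.gm) (g1 j m hm) (by ring),
        fun i x hx m => ?_, g3⟩ fun j x hx => ?_
      · rw [show i * (0 - 1) = -i by ring, sgnz_neg]; exact g2 i x hx m
      · rw [sgnz_zero, one_smul]; exact g4 x
    have := Bh_comp (PBHom.ofDG F') this
    rw [LinearMap.comp_sub] at this
    exact this
  refine L_inj hP.1 (qi_of_data F hP.2) ?_ ?_
  · exact sub_mem (BHom_Zh (R.comp (ι.comp U))) (BHom_Zh (BimodHom.id P))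
  · have a1 := precomp_Bh (ι.comp U) ew
    have a2 := precomp_Bh U e3
    have a3 := add_mem (add_mem a1 a2) eu
    convert a3 using 1
    ext x
    change F.f (w (ι.f (u x)) - x) = (F.f (w (ι.f (u x))) - F'.f (ρ'.f (ι.f (u x)))) +
      (F'.f (ρ'.f (ι.f (u x))) - F'.f (u x)) + (F'.f (u x) - F.f x)
    rw [map_sub]; abel

/-! ## One-sided homotopies -/
def degM {M N : Type} [AddCommGroup M] [Module k M] [AddCommGroup N] [Module k N]
    (gm : ℤ → Submodule k M) (gn : ℤ → Submodule k N) (n : ℤ) : Submodule k (M →ₗ[k] N) where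
  carrier := {f | ∀ (j : ℤ), ∀ m ∈ gm j, f m ∈ gn (j + n)}
  add_mem' := fun hf hg j m hm => add_mem (hf j m hm) (hg j m hm)
  zero_mem' := fun j m hm => zero_mem _
  smul_mem' := fun c f hf j m hm => Submodule.smul_mem _ c (hf j m hm)

theorem DGleibR {N : DGBimod A} {j : ℤ} (x : A.R) {m : N.M} (hm : m ∈ N.gm j) :
    N.D (N.actR x m) = N.actR x (N.D m) + sgnz j • N.actR (A.d x) m := by
  induction x using gr_induction A.gr with
  | h0 => simp
  | ha a b h1 h2 => simp only [map_add, LinearMap.add_apply, h1, h2, smul_add]; abel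
  | h i x hx => exact N.leibnizR i j x m hx hm

/-- reducible copy of the diagonal bimodule -/
abbrev dA (A : DGAlgebra k) : DGBimod A where
  M := A.R
  gm := A.gr
  actL := LinearMap.mul k A.R
  actR := (LinearMap.mul k A.R).flip
  actL_one := fun m => one_mul m
  actR_one := fun m => mul_one m
  actL_mul := fun x y m => mul_assoc x y m
  actR_mul := fun x y m => (mul_assoc m x y).symm
  actLR := fun x y m => (mul_assoc x m y).symm
  actL_deg := fun i j x m hx hm => A.mul_mem hx hm
  actR_deg := fun i j x m hx hm => A.mul_mem hm hx
  D := A.d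
  D_deg := A.d_deg
  D_sq := A.d_sq
  leibnizL := fun i j x m hx _ => A.leibniz i x hx m
  leibnizR := fun i j x m _ hm => A.leibniz j m hm x

abbrev CR (M : DGBimod A) : PB A where
  E := A.R →ₗ[k] M.M
  gm := degM A.gr M.gm
  aL := LinearMap.mk₂ k (fun a O => O ∘ₗ (LinearMap.mul k A.R).flip a)
    (fun _ _ _ => by ext; simp) (fun _ _ _ => by ext; simp) (fun _ _ _ => by ext; simp)
    (fun _ _ _ => by ext; simp)
  aR := LinearMap.mk₂ k (fun a O => M.actR a ∘ₗ O)
    (fun _ _ _ => by ext; simp) (fun _ _ _ => by ext; simp) (fun _ _ _ => by ext; simp)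
    (fun _ _ _ => by ext; simp)
  aL_one := fun m => by ext; simp
  aR_one := fun m => by ext; simp [M.actR_one]
  aL_mul := fun x y m => by ext; simp [mul_assoc]
  aR_mul := fun x y m => by ext; simp [M.actR_mul]
  aLR := fun x y m => by ext; simp
  aL_deg := fun i j x m hx hm l y hy => mem_cast (hm _ _ (A.mul_mem hy hx)) (by ring)
  aR_deg := fun i j x m hx hm l y hy => mem_cast (M.actR_deg _ _ _ _ hx (hm _ _ hy)) (by ring)
  D :=
    (LinearMap.llcomp k A.R A.R M.M).flip (sg A.gr 1) ∘ₗ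
      (LinearMap.llcomp k A.R M.M M.M M.D - (LinearMap.llcomp k A.R A.R M.M).flip A.d)
  D_deg := fun j m hm l y hy => by
    simp only [LinearMap.flip_apply, LinearMap.llcomp_apply, LinearMap.comp_apply,
      LinearMap.sub_apply]
    have hy := sg_mem' A.gr 1 hy
    exact sub_mem (mem_cast (M.D_deg _ _ (hm _ _ hy)) (by ring))
      (mem_cast (hm _ _ (A.d_deg _ _ hy)) (by ring))
  D_sq := fun m => by
    ext y
    simp [sg_sg, A_sg_d, sgnz_one, M.D_sq, A.d_sq]
  leibL := fun i j x m hx hm => by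
    apply gr_ext A.gr
    intro l y hy
    simp only [LinearMap.flip_apply, LinearMap.llcomp_apply, LinearMap.comp_apply,
      LinearMap.mk₂_apply, LinearMap.add_apply, LinearMap.smul_apply, LinearMap.sub_apply,
      LinearMap.mul_apply']
    rw [sg_mem A.gr 1 hy, sg_mem A.gr 1 (A.mul_mem hy hx)]
    simp only [map_zsmul, smul_mul_assoc]
    rw [A.leibniz l y hy x, map_add, map_zsmul]
    simp only [one_mul, sgnz_add]
    rcases sgnz_cases i with h | h <;> rcases sgnz_cases l with h' | h' <;> simp [h, h'] <;> abel
  leibR := fun i j x m hx hm => by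
    apply gr_ext A.gr
    intro l y hy
    simp only [LinearMap.flip_apply, LinearMap.llcomp_apply, LinearMap.comp_apply,
      LinearMap.mk₂_apply, LinearMap.add_apply, LinearMap.smul_apply, LinearMap.sub_apply]
    rw [sg_mem A.gr 1 hy]
    simp only [map_zsmul]
    rw [M.leibnizR _ _ x _ hx (hm l y hy), map_sub, map_zsmul, map_zsmul]
    simp only [one_mul, sgnz_add]
    rcases sgnz_cases j with h | h <;> rcases sgnz_cases l with h' | h' <;> simp [h, h'] <;> abel

theorem CR_D {M : DGBimod A} (O : A.R →ₗ[k] M.M) (b : A.R) :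
    (CR M).D O b = M.D (O (sg A.gr 1 b)) - O (A.d (sg A.gr 1 b)) := rfl

theorem CR_closed {M : DGBimod A} {O : A.R →ₗ[k] M.M} (h : (CR M).D O = 0) (b : A.R) :
    O (A.d b) = M.D (O b) := by
  have := LinearMap.congr_fun h (sg A.gr 1 b)
  rw [CR_D, sg_sg] at this
  exact (sub_eq_zero.1 this).symm

def CRmap {M N : DGBimod A} (g : BimodHom M N) : PBHom (CR M) (CR N) where
  f := LinearMap.llcomp k A.R M.M N.M g.f
  deg := fun j m hm l y hy => g.deg _ _ (hm l y hy)
  aLc := fun x m => by ext; simp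
  aRc := fun x m => by ext; simp [g.actRc]
  comm := fun m => by ext; simp [g.comm]

theorem CRmap_qi {M N : DGBimod A} (g : BimodHom M N) (hg : QI (PBHom.ofDG g)) : QI (CRmap g) := by
  obtain ⟨g', κ, l, h1, h2, h3, h4, h5, h6⟩ := KQI g hg
  constructor
  · intro n z hz hD
    have hD := CR_closed hD
    refine ⟨g' ∘ₗ z, fun j b hb => h1 _ _ (hz j b hb), ?_, -(κ ∘ₗ z ∘ₗ sg A.gr 1), ?_, ?_⟩
    · ext b
      rw [CR_D]
      simp [hD, h4]
    · refine neg_mem fun j b hb => mem_cast (h2 _ _ (hz j _ (sg_mem' A.gr 1 hb))) (by ring)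
    · ext b
      rw [map_neg, LinearMap.add_apply, LinearMap.neg_apply, CR_D]
      change g.f (g' (z b)) = _
      simp only [LinearMap.comp_apply, sg_sg, A_sg_d, sgnz_one, map_zsmul, hD, h5]
      simp; abel
  · intro n w hw hD y hy e
    have hD := CR_closed hD
    refine ⟨g' ∘ₗ y - l ∘ₗ w ∘ₗ sg A.gr 1, sub_mem (fun j b hb => h1 _ _ (hy j b hb))
      fun j b hb => mem_cast (h3 _ _ (hw j _ (sg_mem' A.gr 1 hb))) (by ring), ?_⟩
    ext b
    have e1 := LinearMap.congr_fun e b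
    rw [CR_D] at e1 ⊢
    have e1 : g.f (w b) = _ := e1
    have e2 := congrArg g' e1
    rw [h6, map_sub, h4] at e2
    simp only [LinearMap.comp_apply, LinearMap.sub_apply, sg_sg, A_sg_d, sgnz_one, map_zsmul, hD,
      map_sub]
    simp only [neg_smul, one_smul]
    linear_combination (norm := module) -e2

/-- right-linear maps as bimodule maps to `CR` -/
def hatR {P M : DGBimod A} (n : ℤ) (f : P.M →ₗ[k] M.M) : P.M →ₗ[k] (CR M).E :=
  LinearMap.mk₂ k (fun x b => f (P.actL (sg A.gr n b) x)) (fun _ _ _ => by simp)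
    (fun _ _ _ => by simp) (fun _ _ _ => by simp) (fun _ _ _ => by simp)

theorem hatR_mem {P M : DGBimod A} {n : ℤ} {f : P.M →ₗ[k] M.M}
    (h1 : ∀ j, ∀ x ∈ P.gm j, f x ∈ M.gm (j + n)) (h2 : ∀ a x, f (P.actR a x) = M.actR a (f x)) :
    hatR n f ∈ HomG P (CR M) n := by
  refine ⟨fun j x hx l b hb => mem_cast (h1 _ _ (P.actL_deg _ _ _ _ (sg_mem' A.gr n hb) hx))
    (by ring), fun i a ha x => ?_, fun a x => ?_⟩
  · ext b
    simp only [hatR, LinearMap.mk₂_apply, LinearMap.smul_apply, LinearMap.comp_apply,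
      LinearMap.flip_apply, LinearMap.mul_apply']
    rw [A_sg_mul, sg_mem A.gr n ha, ← P.actL_mul, mul_smul_comm, map_zsmul, LinearMap.smul_apply,
      map_zsmul, smul_smul, ← sgnz_add, mul_comm n, ← two_mul]
    simp [sgnz]
  · ext b
    simp only [hatR, LinearMap.mk₂_apply, LinearMap.comp_apply]
    rw [P.actLR, h2]

theorem hatR_dl {P M : DGBimod A} {n : ℤ} {f : P.M →ₗ[k] M.M} :
    dl P (CR M) n (hatR n f) = hatR (n + 1) (dl P (ofDG M) n f) := by
  ext x : 1
  apply gr_ext A.gr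
  intro j b hb
  rw [dl_apply, LinearMap.sub_apply, LinearMap.smul_apply, CR_D]
  simp only [hatR, LinearMap.mk₂_apply]
  rw [sg_mem A.gr 1 hb, sg_mem A.gr _ hb, sg_mem A.gr _ hb]
  simp only [map_zsmul, LinearMap.smul_apply]
  rw [sg_mem A.gr _ hb, sg_mem A.gr _ (A.d_deg _ _ hb)]
  simp only [map_zsmul, LinearMap.smul_apply]
  rw [dl_apply (N := ofDG M), DGleibL x hb]
  simp only [map_zsmul, map_add, smul_add, smul_sub]
  rw [add_mul, mul_add, sgnz_add, sgnz_add]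
  simp only [one_mul, mul_one, mul_comm n]
  rcases sgnz_cases j with h | h <;> rcases sgnz_cases n with h' | h' <;>
    rcases sgnz_cases (j * n) with h'' | h'' <;> simp [h, h', h''] <;> abel

theorem right_htpy {P : DGBimod A} {F : BimodHom P (dA A)} (hP : IsHoProjB P) (hq : QI (PBHom.ofDG F))
    {p : P.M} (hp : p ∈ P.gm 0) (hDp : P.D p = 0) {c : A.R} (hc : c ∈ A.gr (-1))
    (hF : F.f p = (1 : A.R) + A.d c) :
    ∃ h : P.M →ₗ[k] P.M, (∀ j, ∀ x ∈ P.gm j, h x ∈ P.gm (j - 1)) ∧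
      (∀ a x, h (P.actR a x) = P.actR a (h x)) ∧
      ∀ x, x - P.actR (F.f x) p = P.D (h x) + h (P.D x) := by
  let FF : P.M →ₗ[k] A.R := F.f
  have FFd : ∀ x, FF (P.D x) = A.d (FF x) := F.comm
  have FFR : ∀ a x, FF (P.actR a x) = FF x * a := F.actRc
  have FFdeg : ∀ j, ∀ x ∈ P.gm j, FF x ∈ A.gr j := F.deg
  let φ : P.M →ₗ[k] P.M := LinearMap.id - P.actR.flip p ∘ₗ FF
  have φ_ap : ∀ x, φ x = x - P.actR (FF x) p := fun x => rfl
  have hφ0 : dl P (ofDG P) 0 φ = 0 := by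
    ext x
    rw [dl_apply, φ_ap, φ_ap, sgnz_zero, one_smul, FFd]
    simp only [map_sub]
    rw [DGleibR _ hp, hDp, map_zero, sgnz_zero, one_smul]
    simp
  have hφ : hatR 0 φ ∈ Zh P (CR P) 0 := by
    refine ⟨hatR_mem (fun j x hx => ?_) (fun a x => ?_), ?_⟩
    · rw [φ_ap]
      refine sub_mem (mem_cast hx (by ring)) (mem_cast (P.actR_deg _ _ _ _ (FFdeg _ _ hx) hp) (by ring))
    · rw [φ_ap, φ_ap, FFR, P.actR_mul, map_sub]
    · change dl P (CR P) 0 _ = 0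
      rw [hatR_dl, hφ0]; ext; simp [hatR]
  let g : P.M →ₗ[k] A.R := -(LinearMap.mul k A.R c ∘ₗ FF)
  have g_ap : ∀ x, g x = -(c * FF x) := fun x => rfl
  have hb : (CRmap F).f ∘ₗ hatR 0 φ ∈ Bh P (CR (dA A)) 0 := by
    refine ⟨hatR (0 - 1) (M := dA A) g, hatR_mem (fun j x hx => ?_) (fun a x => ?_), ?_⟩
    · rw [g_ap]
      exact neg_mem (mem_cast (A.mul_mem hc (FFdeg _ _ hx)) (by ring))
    · rw [g_ap, g_ap, FFR]
      change _ = -(c * FF x) * a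
      rw [neg_mul, mul_assoc]
    · rw [hatR_dl]
      ext x b
      simp only [hatR, LinearMap.mk₂_apply, LinearMap.comp_apply]
      change dl P (ofDG (dA A)) (0 - 1) g _ = FF (φ _)
      rw [sub_add_cancel, sg_zero A.gr]
      generalize (P.actL b) x = y
      rw [dl_apply, φ_ap, map_sub, FFR, g_ap, g_ap, FFd, show (0 - 1 : ℤ) = -1 by ring, sgnz_neg,
        sgnz_one]
      change A.d (-(c * FF y)) - _ = _
      rw [map_neg, A.leibniz _ _ hc, sgnz_neg, sgnz_one, show FF p = 1 + A.d c from hF, add_mul,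
        one_mul]
      simp
  obtain ⟨H, hH, e⟩ := Bh_D (L_inj hP (CRmap_qi F hq) hφ hb)
  refine ⟨(LinearMap.flip H) 1, fun j x hx => mem_cast (hH.1 j x hx 0 1 A.one_mem) (by ring),
    fun a x => ?_, fun x => ?_⟩
  · rw [LinearMap.flip_apply, hH.2.2]; rfl
  · have := LinearMap.congr_fun (e x) 1
    rw [LinearMap.add_apply, LinearMap.smul_apply, CR_D, A_sg_one, A_d_one, map_zero, sub_zero,
      sgnz_zero, one_smul] at this
    rw [LinearMap.flip_apply, LinearMap.flip_apply, ← this]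
    change _ = φ (P.actL (sg A.gr 0 1) x)
    rw [A_sg_one, P.actL_one]
    rfl

/-! ## Left-linear homotopies -/
abbrev CL (M : DGBimod A) : PB A where
  E := A.R →ₗ[k] M.M
  gm := degM A.gr M.gm
  aL := LinearMap.mk₂ k (fun a O => M.actL a ∘ₗ O)
    (fun _ _ _ => by ext; simp) (fun _ _ _ => by ext; simp) (fun _ _ _ => by ext; simp)
    (fun _ _ _ => by ext; simp)
  aR := LinearMap.mk₂ k (fun a O => O ∘ₗ LinearMap.mul k A.R a)
    (fun _ _ _ => by ext; simp) (fun _ _ _ => by ext; simp) (fun _ _ _ => by ext; simp)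
    (fun _ _ _ => by ext; simp)
  aL_one := fun m => by ext; simp [M.actL_one]
  aR_one := fun m => by ext; simp
  aL_mul := fun x y m => by ext; simp [M.actL_mul]
  aR_mul := fun x y m => by ext; simp [mul_assoc]
  aLR := fun x y m => by ext; simp
  aL_deg := fun i j x m hx hm l y hy => mem_cast (M.actL_deg _ _ _ _ hx (hm _ _ hy)) (by ring)
  aR_deg := fun i j x m hx hm l y hy => mem_cast (hm _ _ (A.mul_mem hx hy)) (by ring)
  D := LinearMap.llcomp k A.R M.M M.M M.D -
    (LinearMap.llcomp k A.R M.M M.M (sg M.gm 1)) ∘ₗ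
      ((LinearMap.llcomp k A.R A.R M.M).flip (sg A.gr 1 ∘ₗ A.d))
  D_deg := fun j m hm l y hy => by
    simp only [LinearMap.flip_apply, LinearMap.llcomp_apply, LinearMap.comp_apply,
      LinearMap.sub_apply]
    exact sub_mem (mem_cast (M.D_deg _ _ (hm _ _ hy)) (by ring))
      (mem_cast (sg_mem' M.gm 1 (hm _ _ (sg_mem' A.gr 1 (A.d_deg _ _ hy)))) (by ring))
  D_sq := fun m => by
    ext y
    simp [sg_sg, A_sg_d, sg_D M.gm 1 M.D M.D_deg, sgnz_one, M.D_sq, A.d_sq]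
  leibL := fun i j x m hx hm => by
    apply gr_ext A.gr
    intro l y hy
    simp only [LinearMap.flip_apply, LinearMap.llcomp_apply, LinearMap.comp_apply,
      LinearMap.mk₂_apply, LinearMap.add_apply, LinearMap.smul_apply, LinearMap.sub_apply]
    have hd := A.d_deg _ _ hy
    rw [sg_mem A.gr 1 hd]
    simp only [map_zsmul]
    rw [DGleibL _ hx, sg_mem M.gm 1 (hm _ _ hd), sg_mem M.gm 1 (M.actL_deg _ _ _ _ hx (hm _ _ hd))]
    simp only [one_mul, sgnz_add, map_sub, map_zsmul]
    rcases sgnz_cases i with h | h <;> rcases sgnz_cases l with h' | h' <;>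
      rcases sgnz_cases j with h'' | h'' <;> simp [h, h', h''] <;> abel
  leibR := fun i j x m hx hm => by
    apply gr_ext A.gr
    intro l y hy
    simp only [LinearMap.flip_apply, LinearMap.llcomp_apply, LinearMap.comp_apply,
      LinearMap.mk₂_apply, LinearMap.add_apply, LinearMap.smul_apply, LinearMap.sub_apply,
      LinearMap.mul_apply']
    have hd := A.d_deg _ _ hy
    have hxy := A.d_deg _ _ (A.mul_mem hx hy)
    rw [sg_mem A.gr 1 hd, sg_mem A.gr 1 hxy]
    simp only [map_zsmul, mul_smul_comm]
    rw [sg_mem M.gm 1 (hm _ _ hxy), A.leibniz i x hx y,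
      sg_mem M.gm 1 (hm _ _ (A.mul_mem hx hd)), map_add, map_zsmul]
    simp only [one_mul, sgnz_add]
    rcases sgnz_cases i with h | h <;> rcases sgnz_cases l with h' | h' <;>
      rcases sgnz_cases j with h'' | h'' <;> simp [h, h', h'', sgnz_one] <;> abel

theorem CL_D {M : DGBimod A} {n : ℤ} {O : A.R →ₗ[k] M.M} (hO : O ∈ degM A.gr M.gm n) (b : A.R) :
    (CL M).D O b = M.D (O b) - sgnz n • O (A.d b) := by
  change M.D (O b) - sg M.gm 1 (O (sg A.gr 1 (A.d b))) = _
  congr 1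
  generalize A.d b = y
  induction y using gr_induction A.gr with
  | h0 => simp
  | ha a b h1 h2 => simp only [map_add, smul_add, h1, h2]
  | h j y hy =>
    rw [sg_mem A.gr 1 hy, map_zsmul, map_zsmul, sg_mem M.gm 1 (hO _ _ hy), smul_smul, ← sgnz_add,
      show 1 * j + 1 * (j + n) = n + (j + j) by ring, sgnz_add, sgnz_add, sgnz_sq, mul_one]

theorem CL_closed {M : DGBimod A} {n : ℤ} {O : A.R →ₗ[k] M.M} (hO : O ∈ degM A.gr M.gm n)
    (h : (CL M).D O = 0) (b : A.R) : M.D (O b) = sgnz n • O (A.d b) := by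
  have := LinearMap.congr_fun h b
  rw [CL_D hO] at this
  exact sub_eq_zero.1 this

def CLmap {M N : DGBimod A} (g : BimodHom M N) : PBHom (CL M) (CL N) where
  f := LinearMap.llcomp k A.R M.M N.M g.f
  deg := fun j m hm l y hy => g.deg _ _ (hm l y hy)
  aLc := fun x m => by ext; simp [g.actLc]
  aRc := fun x m => by ext; simp
  comm := fun m => by
    ext b
    change g.f (M.D _ - sg M.gm 1 _) = N.D (g.f _) - sg N.gm 1 (g.f _)
    rw [map_sub, g.comm]
    congr 1
    have key : ∀ y, g.f (sg M.gm 1 y) = sg N.gm 1 (g.f y) := fun y => by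
      induction y using gr_induction M.gm with
      | h0 => simp
      | ha a b h1 h2 => simp only [map_add, h1, h2]
      | h j y hy => rw [sg_mem M.gm 1 hy, sg_mem N.gm 1 (g.deg _ _ hy), map_zsmul]
    exact key _

theorem CLmap_qi {M N : DGBimod A} (g : BimodHom M N) (hg : QI (PBHom.ofDG g)) : QI (CLmap g) := by
  obtain ⟨g', κ, l, h1, h2, h3, h4, h5, h6⟩ := KQI g hg
  constructor
  · intro n z hz hD
    have hD := CL_closed hz hD
    have m1 : g' ∘ₗ z ∈ degM A.gr M.gm n := fun j b hb => h1 _ _ (hz j b hb)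
    have m2 : -(κ ∘ₗ z) ∈ degM A.gr N.gm (n - 1) :=
      neg_mem fun j b hb => mem_cast (h2 _ _ (hz j _ hb)) (by ring)
    refine ⟨g' ∘ₗ z, m1, ?_, -(κ ∘ₗ z), m2, ?_⟩
    · ext b
      rw [CL_D m1, LinearMap.comp_apply, ← h4, hD]
      simp
    · ext b
      rw [LinearMap.add_apply, CL_D m2]
      change g.f (g' (z b)) = _
      simp only [LinearMap.comp_apply, LinearMap.neg_apply, map_neg, hD, h5, sgnz_sub, sgnz_one]
      simp; abel
  · intro n w hw hD y hy e
    have hD := CL_closed hw hD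
    have m1 : g' ∘ₗ y - l ∘ₗ w ∈ degM A.gr M.gm (n - 1) :=
      sub_mem (fun j b hb => h1 _ _ (hy j b hb)) fun j b hb => mem_cast (h3 _ _ (hw j _ hb)) (by ring)
    refine ⟨_, m1, ?_⟩
    ext b
    have e1 := LinearMap.congr_fun e b
    rw [CL_D hy] at e1
    rw [CL_D m1]
    have e1 : g.f (w b) = _ := e1
    have e2 := congrArg g' e1
    rw [h6, map_sub, h4, hD] at e2
    simp only [LinearMap.comp_apply, LinearMap.sub_apply, sgnz_sub, sgnz_one, map_zsmul,
      map_sub] at e2 ⊢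
    simp only [mul_neg, mul_one, neg_smul] at e2 ⊢
    linear_combination (norm := module) -e2

theorem left_htpy {P : DGBimod A} {F : BimodHom P (dA A)} (hP : IsHoProjB P) (hq : QI (PBHom.ofDG F))
    {p : P.M} (hp : p ∈ P.gm 0) (hDp : P.D p = 0) {c : A.R} (hc : c ∈ A.gr (-1))
    (hF : F.f p = (1 : A.R) + A.d c) :
    ∃ h : P.M →ₗ[k] P.M, (∀ j, ∀ x ∈ P.gm j, h x ∈ P.gm (j - 1)) ∧
      (∀ i, ∀ a ∈ A.gr i, ∀ x, h (P.actL a x) = sgnz i • P.actL a (h x)) ∧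
      ∀ x, x - P.actL (F.f x) p = P.D (h x) + h (P.D x) := by
  let FF : P.M →ₗ[k] A.R := F.f
  have FFd : ∀ x, FF (P.D x) = A.d (FF x) := F.comm
  have FFL : ∀ a x, FF (P.actL a x) = a * FF x := F.actLc
  have FFdeg : ∀ j, ∀ x ∈ P.gm j, FF x ∈ A.gr j := F.deg
  let hat : ∀ {M : DGBimod A}, (P.M →ₗ[k] M.M) → P.M →ₗ[k] (CL M).E := fun {M} f =>
    LinearMap.mk₂ k (fun x b => f (P.actR b x)) (fun _ _ _ => by simp)
    (fun _ _ _ => by simp) (fun _ _ _ => by simp) (fun _ _ _ => by simp)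
  have hat_ap : ∀ {M : DGBimod A} (f : P.M →ₗ[k] M.M) x b, hat f x b = f (P.actR b x) :=
    fun f x b => rfl
  clear_value hat
  have hat_mem : ∀ {M : DGBimod A} {n : ℤ} {f : P.M →ₗ[k] M.M}
      (h1 : ∀ j, ∀ x ∈ P.gm j, f x ∈ M.gm (j + n))
      (h2 : ∀ i, ∀ a ∈ A.gr i, ∀ x, f (P.actL a x) = sgnz (i * n) • M.actL a (f x)),
      hat f ∈ HomG P (CL M) n := by
    intro M n f h1 h2
    refine ⟨fun j x hx l b hb => ?_, fun i a ha x => ?_, fun a x => ?_⟩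
    · rw [hat_ap]; exact mem_cast (h1 _ _ (P.actR_deg _ _ _ _ hb hx)) (by ring)
    · ext b
      rw [hat_ap, LinearMap.smul_apply, ← P.actLR, h2 i a ha, ← hat_ap]; rfl
    · ext b
      rw [hat_ap, ← P.actR_mul, ← hat_ap]; rfl
  have hat_dl : ∀ {M : DGBimod A} {n : ℤ} {f : P.M →ₗ[k] M.M}
      (hf : hat f ∈ HomG P (CL M) n) j, ∀ x ∈ P.gm j, ∀ b,
      dl P (CL M) n (hat f) x b = dl P (ofDG M) n f (P.actR b x) := by
    intro M n f hf j x hx b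
    rw [dl_apply, LinearMap.sub_apply, LinearMap.smul_apply, CL_D (hf.1 j x hx),
      dl_apply (N := ofDG M), hat_ap, hat_ap, hat_ap, DGleibR b hx, map_add, map_zsmul, smul_add,
      smul_smul, sgnz_add, mul_comm (sgnz j)]
    abel
  let φ : P.M →ₗ[k] P.M := LinearMap.id - P.actL.flip p ∘ₗ FF
  have φ_ap : ∀ x, φ x = x - P.actL (FF x) p := fun x => rfl
  have hφ0 : dl P (ofDG P) 0 φ = 0 := by
    ext x
    rw [dl_apply, φ_ap, φ_ap, sgnz_zero, one_smul, FFd]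
    simp only [map_sub]
    have : P.D (P.actL (FF x) p) = P.actL (A.d (FF x)) p := by
      generalize FF x = a
      induction a using gr_induction A.gr with
      | h0 => simp
      | ha a b h1 h2 => simp only [map_add, LinearMap.add_apply, h1, h2]
      | h i a ha => rw [DGleibL _ ha, hDp, map_zero, smul_zero, add_zero]
    rw [this]; simp
  have hφ1 : hat φ ∈ HomG P (CL P) 0 := by
    refine hat_mem (fun j x hx => ?_) (fun i a ha x => ?_)
    · rw [φ_ap]
      refine sub_mem (mem_cast hx (by ring)) (mem_cast (P.actL_deg _ _ _ _ (FFdeg _ _ hx) hp) (by ring))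
    · rw [φ_ap, φ_ap, FFL, P.actL_mul, map_sub, mul_zero, sgnz_zero, one_smul]
  have hφ : hat φ ∈ Zh P (CL P) 0 := by
    refine ⟨hφ1, ?_⟩
    change dl P (CL P) 0 _ = 0
    apply gr_ext P.gm
    intro j x hx
    ext b
    rw [hat_dl hφ1 j x hx, hφ0]; rfl
  let g : P.M →ₗ[k] (dA A).M := -((LinearMap.mul k A.R).flip c ∘ₗ sg A.gr 1 ∘ₗ FF)
  have g_ap : ∀ x, g x = -(sg A.gr 1 (FF x) * c) := fun x => rfl
  have hb : (CLmap F).f ∘ₗ hat φ ∈ Bh P (CL (dA A)) 0 := by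
    have hg : hat g ∈ HomG P (CL (dA A)) (0 - 1) := by
      refine hat_mem (fun j x hx => ?_) (fun i a ha x => ?_)
      · rw [g_ap]
        exact neg_mem (mem_cast (A.mul_mem (sg_mem' A.gr 1 (FFdeg _ _ hx)) hc) (by ring))
      · rw [g_ap, g_ap, FFL, A_sg_mul, sg_mem A.gr 1 ha, one_mul, show i * (0 - 1) = -i by ring,
          sgnz_neg]
        change _ = sgnz i • (a * -(sg A.gr 1 (FF x) * c))
        rw [mul_neg, mul_assoc, smul_mul_assoc, smul_neg]
    refine ⟨hat g, hg, ?_⟩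
    apply gr_ext P.gm
    intro j x hx
    ext b
    rw [hat_dl hg j x hx]
    change _ = F.f (hat φ x b)
    rw [hat_ap]
    generalize (P.actR b) x = y
    change dl P (ofDG (dA A)) (0 - 1) g y = FF (φ y)
    rw [dl_apply, φ_ap, map_sub, FFL, g_ap, g_ap, FFd, show (0 - 1 : ℤ) = -1 by ring, sgnz_neg,
        sgnz_one]
    change A.d (-(sg A.gr 1 (FF y) * c)) - _ = _
    rw [show FF p = 1 + A.d c from hF, map_neg]
    generalize FF y = a
    induction a using gr_induction A.gr with
    | h0 => simp
    | ha a b h1 h2 =>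
      simp only [map_add, add_mul, neg_add, smul_add] at h1 h2 ⊢
      linear_combination (norm := module) h1 + h2
    | h i a ha =>
      rw [sg_mem A.gr 1 ha, A_sg_d, sg_mem A.gr 1 ha, smul_mul_assoc, map_zsmul, A.leibniz _ _ ha,
        mul_add, mul_one, map_zsmul, sgnz_one, one_mul]
      rcases sgnz_cases i with h | h <;> simp [h]
  obtain ⟨H, hH, e⟩ := Bh_D (L_inj hP (CLmap_qi F hq) hφ hb)
  refine ⟨(LinearMap.flip H) 1, fun j x hx => mem_cast (hH.1 j x hx 0 1 A.one_mem) (by ring),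
    fun i a ha x => ?_, fun x => ?_⟩
  · rw [LinearMap.flip_apply, hH.2.1 _ _ ha, show i * (0 - 1) = -i by ring, sgnz_neg]; rfl
  · induction x using gr_induction P.gm with
    | h0 => simp
    | ha a b h1 h2 =>
      simp only [map_add, LinearMap.add_apply] at h1 h2 ⊢
      linear_combination (norm := module) h1 + h2
    | h j x hx =>
      have := LinearMap.congr_fun (e x) 1
      rw [LinearMap.add_apply, LinearMap.smul_apply, CL_D (hH.1 j x hx), A_d_one, map_zero,
        smul_zero, sub_zero, sgnz_zero, one_smul] at this
      rw [LinearMap.flip_apply, LinearMap.flip_apply, ← this, hat_ap, P.actR_one]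
      rfl

/-! ## Outer tensor products -/
theorem sg_actL {N : DGBimod A} (t : ℤ) {i : ℤ} {a : A.R} (ha : a ∈ A.gr i) (m : N.M) :
    sg N.gm t (N.actL a m) = sgnz (t * i) • N.actL a (sg N.gm t m) := by
  induction m using gr_induction N.gm with
  | h0 => simp
  | ha a b h1 h2 => simp only [map_add, smul_add, h1, h2]
  | h j m hm =>
    rw [sg_mem N.gm t hm, sg_mem N.gm t (N.actL_deg _ _ _ _ ha hm), map_zsmul, smul_smul, ← sgnz_add,
      mul_add]

theorem sg_actR {N : DGBimod A} (t : ℤ) {i : ℤ} {a : A.R} (ha : a ∈ A.gr i) (m : N.M) :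
    sg N.gm t (N.actR a m) = sgnz (t * i) • N.actR a (sg N.gm t m) := by
  induction m using gr_induction N.gm with
  | h0 => simp
  | ha a b h1 h2 => simp only [map_add, smul_add, h1, h2]
  | h j m hm =>
    rw [sg_mem N.gm t hm, sg_mem N.gm t (N.actR_deg _ _ _ _ ha hm), map_zsmul, smul_smul, ← sgnz_add,
      mul_add, add_comm]

theorem tmul_mem_ten {U V : DGBimod A} {i j n : ℤ} {u : U.M} {v : V.M} (hu : u ∈ U.gm i)
    (hv : v ∈ V.gm j) (h : i + j = n) : u ⊗ₜ v ∈ tenGrade U.gm V.gm n :=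
  Submodule.subset_span ⟨i, j, u, v, hu, hv, h, rfl⟩

theorem ten_ind {U V : DGBimod A} {n : ℤ} {p : ∀ t, t ∈ tenGrade U.gm V.gm n → Prop}
    (h0 : p 0 (zero_mem _)) (ha : ∀ a b hha hhb, p a hha → p b hhb → p (a + b) (add_mem hha hhb))
    (h : ∀ i j u v (hu : u ∈ U.gm i) (hv : v ∈ V.gm j) (e : i + j = n), p (u ⊗ₜ v) (tmul_mem_ten hu hv e))
    {t} (ht : t ∈ tenGrade U.gm V.gm n) : p t ht := by
  have key : ∀ t (ht : t ∈ tenGrade U.gm V.gm n), ∀ c : k, p (c • t) (Submodule.smul_mem _ c ht) := by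
    intro t ht
    induction ht using Submodule.span_induction with
    | mem x hx =>
      obtain ⟨i, j, u, v, hu, hv, e, rfl⟩ := hx
      intro c
      exact h i j _ v (Submodule.smul_mem _ c hu) hv e
    | zero => intro c; simpa only [smul_zero] using h0
    | add x y _ _ h1 h2 => intro c; simpa only [smul_add] using ha _ _ _ _ (h1 c) (h2 c)
    | smul d x _ h1 => intro c; simpa only [smul_smul] using h1 _
  simpa only [one_smul] using key t ht 1

theorem ten_map {U V U' V' : DGBimod A} {f : U.M →ₗ[k] U'.M} {g : V.M →ₗ[k] V'.M} {a b n m : ℤ}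
    (hf : ∀ i, ∀ u ∈ U.gm i, f u ∈ U'.gm (i + a)) (hg : ∀ i, ∀ u ∈ V.gm i, g u ∈ V'.gm (i + b))
    (e : n + a + b = m) {t} (ht : t ∈ tenGrade U.gm V.gm n) :
    TensorProduct.map f g t ∈ tenGrade U'.gm V'.gm m := by
  induction ht using ten_ind with
  | h0 => simp
  | ha a b _ _ h1 h2 => rw [map_add]; exact add_mem h1 h2
  | h i j u v hu hv h =>
    rw [TensorProduct.map_tmul]
    exact tmul_mem_ten (hf _ _ hu) (hg _ _ hv) (by omega)

abbrev TT (U V : DGBimod A) : PB A where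
  E := U.M ⊗[k] V.M
  gm := tenGrade U.gm V.gm
  aL := (TensorProduct.mapBilinear (.id k) U.M V.M U.M V.M).flip LinearMap.id ∘ₗ U.actL
  aR := (TensorProduct.mapBilinear (.id k) U.M V.M U.M V.M) LinearMap.id ∘ₗ V.actR
  aL_one := fun m => by
    induction m using TensorProduct.induction_on <;> simp_all [U.actL_one]
  aR_one := fun m => by
    induction m using TensorProduct.induction_on <;> simp_all [V.actR_one]
  aL_mul := fun x y m => by
    induction m using TensorProduct.induction_on <;> simp_all [U.actL_mul]
  aR_mul := fun x y m => by
    induction m using TensorProduct.induction_on <;> simp_all [V.actR_mul]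
  aLR := fun x y m => by
    induction m using TensorProduct.induction_on <;> simp_all
  aL_deg := fun i j x m hx hm => ten_map (a := i) (b := 0)
    (fun l u hu => mem_cast (U.actL_deg _ _ _ _ hx hu) (by ring)) (fun l u hu => by simpa using hu)
    (by ring) hm
  aR_deg := fun i j x m hx hm => ten_map (a := 0) (b := i) (fun l u hu => by simpa using hu)
    (fun l u hu => V.actR_deg _ _ _ _ hx hu) (by ring) hm
  D := tenD U.D (sg U.gm 1) V.D
  D_deg := fun j m hm => add_mem
    (ten_map (a := 1) (b := 0) U.D_deg (fun l u hu => by simpa using hu) (by ring) hm)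
    (ten_map (a := 0) (b := 1) (fun l u hu => by simpa using sg_mem' U.gm 1 hu) V.D_deg (by ring) hm)
  D_sq := fun m => by
    induction m using TensorProduct.induction_on with
    | zero => simp
    | add x y h1 h2 => simp only [map_add, h1, h2, add_zero]
    | tmul u v =>
      simp [tenD, sg_D U.gm 1 U.D U.D_deg, sgnz_one, U.D_sq, V.D_sq, TensorProduct.neg_tmul]
  leibL := fun i j x m hx hm => by
    clear hm
    induction m using TensorProduct.induction_on with
    | zero => simp
    | add x y h1 h2 => simp only [map_add, h1, h2, smul_add]; abel
    | tmul u v =>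
      simp only [tenD, LinearMap.comp_apply, LinearMap.flip_apply, TensorProduct.mapBilinear_apply,
        LinearMap.add_apply, TensorProduct.map_tmul, LinearMap.id_apply, map_add]
      rw [sg_actL 1 hx, DGleibL _ hx, TensorProduct.add_tmul, one_mul, smul_add]
      simp only [TensorProduct.smul_tmul']
      abel
  leibR := fun i j x m hx hm => by
    induction hm using ten_ind with
    | h0 => simp
    | ha x y _ _ h1 h2 => simp only [map_add, h1, h2, smul_add]; abel
    | h i j u v hu hv e =>
      simp only [tenD, LinearMap.comp_apply, TensorProduct.mapBilinear_apply,
        LinearMap.add_apply, TensorProduct.map_tmul, LinearMap.id_apply, map_add]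
      rw [DGleibR _ hv, TensorProduct.tmul_add, sg_mem U.gm 1 hu, one_mul, ← e, sgnz_add]
      simp only [← TensorProduct.smul_tmul', TensorProduct.tmul_smul, smul_smul, mul_comm]
      abel

section
variable {U V : DGBimod A}
theorem TT_D (u : U.M) (v : V.M) : (TT U V).D (u ⊗ₜ v) = U.D u ⊗ₜ v + sg U.gm 1 u ⊗ₜ V.D v := by
  simp [tenD]
theorem TT_D' {i : ℤ} {u : U.M} (hu : u ∈ U.gm i) (v : V.M) :
    (TT U V).D (u ⊗ₜ v) = U.D u ⊗ₜ v + sgnz i • u ⊗ₜ V.D v := by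
  rw [TT_D, sg_mem U.gm 1 hu, one_mul, ← TensorProduct.smul_tmul']
theorem TT_aL (a : A.R) (u : U.M) (v : V.M) : (TT U V).aL a (u ⊗ₜ v) = U.actL a u ⊗ₜ v := rfl
theorem TT_aR (a : A.R) (u : U.M) (v : V.M) : (TT U V).aR a (u ⊗ₜ v) = u ⊗ₜ V.actR a v := rfl
end

/-- compactness data on a model of the dual bimodule -/
def CDat (B : DGBimod A) (β : PBHom (ofDG B) (dualB (dA A))) : Prop :=
    ∃ (I : Type) (_ : Fintype I) (dg : I → ℤ) (ν : I → B.M) (z : I → A.R)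
      (h : A.R →ₗ[k] A.R) (hB : B.M →ₗ[k] B.M), (∀ i, ν i ∈ B.gm (-(dg i))) ∧ (∀ i, B.D (ν i) = 0) ∧
      (∀ i, z i ∈ A.gr (dg i)) ∧ (∀ i, A.d (z i) = 0) ∧ (∀ n, ∀ x ∈ A.gr n, h x ∈ A.gr (n - 1)) ∧
      (∀ n, ∀ x ∈ B.gm n, hB x ∈ B.gm (n - 1)) ∧
      (∀ x, x - ∑ i, β.f (ν i) x • z i = A.d (h x) + h (A.d x)) ∧
      ∀ x, x - ∑ i, β.f x (z i) • ν i = B.D (hB x) + hB (B.D x)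

set_option maxHeartbeats 1000000 in
theorem dual_model (hc : IsCompactAlg A) :
    ∃ (B : DGBimod A) (β : PBHom (ofDG B) (dualB (dA A))), QI β ∧ CDat B β := by
  obtain ⟨I, hI, dg, ν, z, h, h1, h2, h3, h4, h5, h6⟩ := compact_data hc
  let N := (dualB (dA A)).toPN
  let hh : (A.R →ₗ[k] k) →ₗ[k] (A.R →ₗ[k] k) := (LinearMap.llcomp k A.R A.R k).flip h
  have hh_ap : ∀ φ x, hh φ x = φ (h x) := fun _ _ => rfl
  clear_value hh
  have hhm : ∀ j, ∀ φ ∈ dualGrade A.gr j, hh φ ∈ dualGrade A.gr (j - 1) := fun j φ hφ l hl x hx => by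
    rw [hh_ap]; exact hφ (l - 1) (by omega) _ (h5 l x hx)
  let hB : N.T →ₗ[k] N.T := N.tout (fun j => N.tin (j - 1) ∘ₗ (sgnz j • hh))
  have hB_ap : ∀ j, ∀ φ ∈ dualGrade A.gr j, hB (N.tin j φ) = N.tin (j - 1) (sgnz j • hh φ) :=
    fun j φ hφ => N.tout_tin _ hφ
  clear_value hB
  have D_ap : ∀ j, ∀ φ ∈ dualGrade A.gr j, N.tD (N.tin j φ) = N.tin (j + 1) ((dualB (dA A)).D φ) :=
    fun j φ hφ => N.tD_tin hφ
  have key : ∀ j, ∀ φ ∈ dualGrade A.gr j, φ - ∑ i, φ (z i) • ν i =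
      (sgnz j : ℤ) • (dualB (dA A)).D (hh φ) + (sgnz (j + 1) : ℤ) • hh ((dualB (dA A)).D φ) := by
    intro j φ hφ
    apply gr_ext A.gr
    intro l x hx
    have e6 := congrArg φ (h6 x)
    simp only [map_sub, map_sum, map_smul, map_add, smul_eq_mul] at e6
    change φ x - (∑ i, φ (z i) • ν i) x = sgnz j • hh φ (A.d (sg A.gr 1 x)) +
      sgnz (j + 1) • hh (φ ∘ₗ A.d ∘ₗ sg A.gr 1) x
    rw [hh_ap, hh_ap, sg_mem A.gr 1 hx, LinearMap.sum_apply, LinearMap.comp_apply, LinearMap.comp_apply,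
      sg_mem A.gr 1 (h5 l x hx)]
    simp only [one_mul, map_zsmul, LinearMap.smul_apply, smul_eq_mul]
    by_cases e : l = -j
    · rw [e, sgnz_neg, sgnz_sub, sgnz_add, sgnz_neg, smul_smul, smul_smul, sgnz_one,
        show sgnz j * -1 * (sgnz j * -1) = sgnz j * sgnz j by ring, sgnz_sq, one_smul, one_smul,
        add_comm, ← e6]
      simp only [mul_comm]
    · rw [hφ (l - 1 + 1) (by omega) _ (A.d_deg _ _ (h5 _ _ hx)),
        hφ (l + 1 - 1) (by omega) _ (h5 _ _ (A.d_deg _ _ hx))] at *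
      simp only [mul_comm] at e6 ⊢
      rw [e6]; simp
  refine ⟨tot N, tsm _, tsm_qi _, I, hI, dg, fun i => N.tin (-dg i) (ν i), z, h, hB,
    fun i => N.tin_mem (h1 i), fun i => ?_, h3, h4, h5, ?_, fun x => ?_, fun x => ?_⟩
  · change N.tD _ = 0
    rw [D_ap _ _ (h1 i)]
    have : (dualB (dA A)).D (ν i) = 0 := by ext x; rw [dualB_D]; exact h2 i _
    rw [this, map_zero]
  · rintro n _ ⟨φ, hφ, rfl⟩
    rw [hB_ap _ _ hφ]
    exact N.tin_mem (sgnz_smul_mem _ _ (hhm _ _ hφ))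
  · rw [← h6]; congr 1
    exact Finset.sum_congr rfl fun i _ => by rw [tsm_tin _ (h1 i)]
  · change _ = N.tD _ + hB (N.tD _)
    induction x using N.tin_ind with
    | h0 => simp
    | ha a b h1 h2 =>
      simp only [map_add, LinearMap.add_apply, add_smul, Finset.sum_add_distrib] at h1 h2 ⊢
      linear_combination (norm := module) h1 + h2
    | h j φ hφ =>
      have hφ : φ ∈ dualGrade A.gr j := hφ
      have e1 : ∑ i, (tsm (dualB (dA A))).f (N.tin j φ) (z i) • N.tin (-dg i) (ν i)
          = N.tin j (∑ i, φ (z i) • ν i) := by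
        rw [map_sum]
        refine Finset.sum_congr rfl fun i _ => ?_
        rw [tsm_tin _ hφ, map_smul]
        by_cases e : -dg i = j
        · rw [e]
        · rw [hφ (dg i) (by omega) _ (h3 i), zero_smul, zero_smul]
      have hD := (dualB (dA A)).D_deg _ _ hφ
      have e2 : N.tD (hB (N.tin j φ)) = N.tin j ((sgnz j : ℤ) • (dualB (dA A)).D (hh φ)) := by
        rw [hB_ap _ _ hφ, D_ap _ _ (zsm_mem _ _ (hhm _ _ hφ))]
        exact N.tin_congr (by ring) (map_zsmul _ _ _)
      have e3 : hB (N.tD (N.tin j φ)) = N.tin j ((sgnz (j + 1) : ℤ) • hh ((dualB (dA A)).D φ)) := by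
        rw [D_ap _ _ hφ, hB_ap _ _ hD]
        exact N.tin_congr (by ring) rfl
      have e4 := (N.tin j).map_sub φ (∑ i, φ (z i) • ν i)
      have e5 := (N.tin j).map_add ((sgnz j : ℤ) • (dualB (dA A)).D (hh φ))
        ((sgnz (j + 1) : ℤ) • hh ((dualB (dA A)).D φ))
      rw [← e1] at e4
      rw [← e2, ← e3] at e5
      refine e4.symm.trans (Eq.trans (congrArg (N.tin j) ?_) e5)
      exact key j φ hφ

/-! ## The evaluation map -/
section
variable {B : DGBimod A} (β : PBHom (ofDG B) (dualB (dA A)))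
def bt : B.M →ₗ[k] A.R →ₗ[k] k := β.f
theorem bt_L (a : A.R) (ν : B.M) (b : A.R) : bt β (B.actL a ν) b = bt β ν (b * sg A.gr 1 a) :=
  LinearMap.congr_fun (β.aLc a ν) b
theorem bt_R (a : A.R) (ν : B.M) (b : A.R) : bt β (B.actR a ν) b = bt β ν (a * b) :=
  LinearMap.congr_fun (β.aRc a ν) b
theorem bt_D (ν : B.M) (b : A.R) : bt β (B.D ν) b = bt β ν (A.d (sg A.gr 1 b)) :=
  LinearMap.congr_fun (β.comm ν) b
theorem bt_ne {i j : ℤ} {ν : B.M} (hν : ν ∈ B.gm i) {b : A.R} (hb : b ∈ A.gr j) (h : j ≠ -i) :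
    bt β ν b = 0 := β.deg i ν hν j h b hb
theorem bt_sg' {i : ℤ} {ν : B.M} (hν : ν ∈ B.gm i) (t : ℤ) (b : A.R) :
    bt β ν (sg A.gr t b) = sgnz (t * i) • bt β ν b := by
  induction b using gr_induction A.gr with
  | h0 => simp
  | ha a b h1 h2 => simp only [map_add, smul_add, h1, h2]
  | h j b hb =>
    rw [sg_mem A.gr t hb, map_zsmul]
    by_cases h : j = -i
    · rw [h, mul_neg, sgnz_neg]
    · rw [bt_ne β hν hb h]; simp
theorem bt_sg (t : ℤ) (ν : B.M) (b : A.R) : bt β ν (sg A.gr t b) = bt β (sg B.gm t ν) b := by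
  induction ν using gr_induction B.gm with
  | h0 => simp
  | ha a b h1 h2 => simp only [map_add, LinearMap.add_apply, h1, h2]
  | h i ν hν => rw [sg_mem B.gm t hν, bt_sg' β hν, map_zsmul, LinearMap.smul_apply]

def evf : B.M ⊗[k] A.R →ₗ[k] (A.R →ₗ[k] A.R) :=
  TensorProduct.lift (LinearMap.mk₂ k (fun ν c => (bt β (sg B.gm 1 ν)).smulRight c)
    (fun _ _ _ => by ext; simp [add_smul]) (fun _ _ _ => by ext; simp [mul_smul])
    (fun _ _ _ => by ext; simp) (fun _ _ _ => LinearMap.ext fun _ => smul_comm _ _ _))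
theorem evf_ap (ν : B.M) (c b : A.R) : evf β (ν ⊗ₜ c) b = bt β (sg B.gm 1 ν) b • c := rfl

def evm : PBHom (TT B (dA A)) (CR (dA A)) where
  f := evf β
  deg := fun j t ht => by
    induction ht using ten_ind with
    | h0 => rw [map_zero]; exact zero_mem _
    | ha a b _ _ h1 h2 => rw [map_add]; exact add_mem h1 h2
    | h i j ν c hν hc e =>
      intro l b hb
      rw [evf_ap]
      by_cases h : l = -i
      · exact Submodule.smul_mem _ _ (mem_cast (gm := A.gr) hc (by omega))
      · rw [bt_ne β (sg_mem' B.gm 1 hν) hb h, zero_smul]; exact zero_mem _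
  aLc := fun a t => by
    induction t using TensorProduct.induction_on with
    | zero => simp
    | add x y h1 h2 => simp only [map_add, h1, h2]
    | tmul ν c =>
      ext b
      rw [TT_aL]
      change _ = evf β (ν ⊗ₜ c) (b * a)
      rw [evf_ap, evf_ap, ← bt_sg, ← bt_sg, bt_L, A_sg_mul]
  aRc := fun a t => by
    induction t using TensorProduct.induction_on with
    | zero => simp
    | add x y h1 h2 => simp only [map_add, h1, h2]
    | tmul ν c =>
      ext b
      rw [TT_aR]
      change _ = evf β (ν ⊗ₜ c) b * a
      rw [evf_ap, evf_ap, smul_mul_assoc]; rfl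
  comm := fun t => by
    induction t using TensorProduct.induction_on with
    | zero => simp
    | add x y h1 h2 => simp only [map_add, h1, h2]
    | tmul ν c =>
      ext b
      rw [TT_D, map_add]
      change evf β _ b + evf β _ b = A.d (evf β (ν ⊗ₜ c) (sg A.gr 1 b)) - evf β (ν ⊗ₜ c) (A.d (sg A.gr 1 b))
      rw [evf_ap, evf_ap, evf_ap, evf_ap, ← bt_sg, bt_D, sg_sg, sg_sg, bt_sg, sg_sg, ← bt_sg, A_sg_d,
        sg_sg, sgnz_one, map_smul]
      simp [add_comm]

set_option maxHeartbeats 1000000 in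
theorem evm_qi (hC : CDat B β) : QI (evm β) := by
  obtain ⟨I, hI, dg, ν, z, h, hB, h1, h2, h3, h4, h5, h6, h7, h8⟩ := hC
  have sν : ∀ i, sg B.gm 1 (ν i) = sgnz (dg i) • ν i := fun i => by
    rw [sg_mem B.gm 1 (h1 i), one_mul, sgnz_neg]
  constructor
  · intro n O hO hD
    have hD : ∀ b, O (A.d b) = A.d (O b) := CR_closed hD
    refine ⟨∑ i, sgnz (dg i) • ν i ⊗ₜ O (z i), ?_, ?_, -(O ∘ₗ h ∘ₗ sg A.gr 1), ?_, ?_⟩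
    · exact sum_mem fun i _ => sgnz_smul_mem _ _ (tmul_mem_ten (h1 i) (hO _ _ (h3 i)) (by ring))
    · rw [map_sum]
      refine Finset.sum_eq_zero fun i _ => ?_
      rw [map_zsmul, TT_D, h2]
      change sgnz (dg i) • (_ + _ ⊗ₜ A.d (O (z i))) = _
      rw [← hD, h4]; simp
    · exact neg_mem fun j b hb => mem_cast (hO _ _ (h5 _ _ (sg_mem' A.gr 1 hb))) (by ring)
    · ext b
      have e7 := congrArg O (h7 b)
      change evf β _ b = O b + (CR (dA A)).D _ b
      rw [CR_D]
      change _ = O b + (A.d (-(O (h (sg A.gr 1 (sg A.gr 1 b))))) - -(O (h (sg A.gr 1 (A.d (sg A.gr 1 b))))))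
      rw [A_sg_d, sg_sg, sgnz_one, map_sum, LinearMap.sum_apply]
      have : ∀ i, evf β (sgnz (dg i) • ν i ⊗ₜ O (z i)) b = β.f (ν i) b • O (z i) := fun i => by
        rw [map_zsmul, LinearMap.smul_apply, evf_ap, sν, map_zsmul, LinearMap.smul_apply, smul_assoc,
          sgnz_smul_smul]; rfl
      simp only [this]
      simp only [map_sub, map_sum, map_smul, map_add, map_zsmul, hD] at e7
      simp only [map_neg, neg_smul, one_smul, map_neg]
      linear_combination (norm := module) -e7
  · intro n t ht hD y hy e
    let K : B.M ⊗[k] A.R →ₗ[k] B.M ⊗[k] A.R := TensorProduct.map hB LinearMap.id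
    have hK : ∀ t, t - ∑ i, ν i ⊗ₜ[k] (sgnz (dg i) • evf β t (z i)) =
        (TT B (dA A)).D (K t) + K ((TT B (dA A)).D t) := by
      intro t
      induction t using TensorProduct.induction_on with
      | zero => simp
      | add x y h1 h2 =>
        simp only [map_add, LinearMap.add_apply, smul_add, TensorProduct.tmul_add,
          Finset.sum_add_distrib] at h1 h2 ⊢
        linear_combination (norm := module) h1 + h2
      | tmul u c =>
        have hs : sg B.gm 1 (hB u) = -hB (sg B.gm 1 u) := by
          induction u using gr_induction B.gm with
          | h0 => simp
          | ha a b h1 h2 => simp only [map_add, h1, h2, neg_add]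
          | h j u hu =>
            rw [sg_mem B.gm 1 hu, sg_mem B.gm 1 (h6 _ _ hu), map_zsmul, one_mul, one_mul, sgnz_sub,
              sgnz_one]; simp
        rw [TT_D, map_add, TensorProduct.map_tmul, TensorProduct.map_tmul, TensorProduct.map_tmul,
          TT_D, hs]
        simp only [LinearMap.id_apply]
        have e8 := congrArg (fun v => v ⊗ₜ[k] c) (h8 u)
        simp only [TensorProduct.sub_tmul, TensorProduct.sum_tmul, TensorProduct.add_tmul] at e8
        have : ∀ i, ν i ⊗ₜ[k] (sgnz (dg i) • evf β (u ⊗ₜ[k] c) (z i)) = (β.f u (z i) • ν i) ⊗ₜ[k] c :=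
            fun i => by
          rw [evf_ap, ← bt_sg, sg_mem A.gr 1 (h3 i), one_mul, map_zsmul, smul_assoc, sgnz_smul_smul,
            TensorProduct.tmul_smul, TensorProduct.smul_tmul']; rfl
        simp only [this]
        rw [e8, TensorProduct.neg_tmul]; abel
    have e1 : ∀ i, sgnz (dg i) • evf β t (z i) = A.d (y (z i)) := fun i => by
      have : evf β t (z i) = A.d (y (sg A.gr 1 (z i))) - y (A.d (sg A.gr 1 (z i))) :=
        LinearMap.congr_fun e (z i)
      rw [this, sg_mem A.gr 1 (h3 i), one_mul]
      simp only [map_zsmul, h4, map_zero, smul_zero, sub_zero, sgnz_smul_smul]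
    refine ⟨K t + ∑ i, sgnz (dg i) • ν i ⊗ₜ y (z i), add_mem ?_ ?_, ?_⟩
    · exact ten_map (U := B) (V := dA A) (U' := B) (V' := dA A) (a := -1) (b := 0) h6
        (fun l u hu => mem_cast (gm := A.gr) hu (add_zero l).symm) (by ring) ht
    · exact sum_mem fun i _ => sgnz_smul_mem _ _ (tmul_mem_ten (h1 i) (hy _ _ (h3 i)) (by ring))
    · have := hK t
      rw [hD, map_zero, add_zero] at this
      rw [map_add, ← this, map_sum, sub_add_eq_add_sub, sub_eq_iff_eq_add]
      congr 1
      refine Finset.sum_congr rfl fun i _ => ?_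
      rw [map_zsmul, TT_D, h2, e1, sν, TensorProduct.zero_tmul, zero_add, ← TensorProduct.smul_tmul',
        sgnz_smul_smul]
end

/-! ## The bimodules of right-linear and bilinear maps -/
section
variable {N N' : PN A} (φ : N.E →ₗ[k] N'.E) (h1 : ∀ n, ∀ f ∈ N.gm n, φ f ∈ N'.gm n)
  (hL : ∀ i n, ∀ a ∈ A.gr i, ∀ f ∈ N.gm n, φ (N.aL i n a f) = N'.aL i n a (φ f))
  (hR : ∀ i n, ∀ a ∈ A.gr i, ∀ f ∈ N.gm n, φ (N.aR i n a f) = N'.aR i n a (φ f))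
  (hD : ∀ n, ∀ f ∈ N.gm n, φ (N.D n f) = N'.D n (φ f))

theorem PNm_tin (h1 : ∀ n, ∀ f ∈ N.gm n, φ f ∈ N'.gm n) {n : ℤ} {f : N.E} (hf : f ∈ N.gm n) :
    N.tout (fun n => N'.tin n ∘ₗ φ) (N.tin n f) = N'.tin n (φ f) := N.tout_tin _ hf

def PNmap : BimodHom (tot N) (tot N') where
  f := N.tout (fun n => N'.tin n ∘ₗ φ)
  deg := by
    rintro j _ ⟨m, hm, rfl⟩
    rw [PNm_tin φ h1 hm]; exact N'.tin_mem (h1 _ _ hm)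
  actLc := fun x m => by
    induction m using N.tin_ind with
    | h0 => simp
    | ha a b h1 h2 => simp only [map_add, h1, h2]
    | h n m hm =>
      induction x using gr_induction A.gr with
      | h0 => simp
      | ha a b h1 h2 => simp only [map_add, LinearMap.add_apply, h1, h2]
      | h i x hx =>
        rw [PNm_tin φ h1 hm, N.tL_tin hx hm, PNm_tin φ h1 (N.aL_deg _ _ _ hx _ hm),
          N'.tL_tin hx (h1 _ _ hm), hL _ _ _ hx _ hm]
  actRc := fun x m => by
    induction m using N.tin_ind with
    | h0 => simp
    | ha a b h1 h2 => simp only [map_add, h1, h2]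
    | h n m hm =>
      induction x using gr_induction A.gr with
      | h0 => simp
      | ha a b h1 h2 => simp only [map_add, LinearMap.add_apply, h1, h2]
      | h i x hx =>
        rw [PNm_tin φ h1 hm, N.tR_tin hx hm, PNm_tin φ h1 (N.aR_deg _ _ _ hx _ hm),
          N'.tR_tin hx (h1 _ _ hm), hR _ _ _ hx _ hm]
  comm := fun m => by
    induction m using N.tin_ind with
    | h0 => simp
    | ha a b h1 h2 => simp only [map_add, h1, h2]
    | h n m hm =>
      rw [PNm_tin φ h1 hm, N.tD_tin hm, PNm_tin φ h1 (N.D_deg _ _ hm), N'.tD_tin (h1 _ _ hm),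
        hD _ _ hm]

theorem PNmap_qi
    (s : ∀ n, ∀ z ∈ N'.gm n, N'.D n z = 0 → ∃ w ∈ N.gm n, N.D n w = 0 ∧ ∃ y ∈ N'.gm (n - 1),
      φ w = z + N'.D (n - 1) y)
    (i : ∀ n, ∀ w ∈ N.gm n, N.D n w = 0 → ∀ y ∈ N'.gm (n - 1), φ w = N'.D (n - 1) y →
      ∃ v ∈ N.gm (n - 1), N.D (n - 1) v = w) :
    QI (PBHom.ofDG (PNmap φ h1 hL hR hD)) := by
  constructor
  · rintro n _ ⟨z, hz, rfl⟩ hDz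
    have hDz : N'.tD (N'.tin n z) = 0 := hDz
    rw [N'.tD_tin hz] at hDz
    obtain ⟨w, hw, hDw, y, hy, e⟩ := s n z hz (N'.tin_inj (N'.D_deg _ _ hz) hDz)
    refine ⟨N.tin n w, N.tin_mem hw, ?_, N'.tin (n - 1) y, N'.tin_mem hy, ?_⟩
    · change N.tD _ = 0
      rw [N.tD_tin hw, hDw, map_zero]
    · refine (PNm_tin φ h1 hw).trans ?_
      rw [e, map_add]
      refine congrArg (fun t => N'.tin n z + t) ((N'.tin_congr (by ring) rfl).trans (N'.tD_tin hy).symm)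
  · rintro n _ ⟨w, hw, rfl⟩ hDw _ ⟨y, hy, rfl⟩ e
    have hDw : N.tD (N.tin n w) = 0 := hDw
    rw [N.tD_tin hw] at hDw
    have e : N.tout (fun n => N'.tin n ∘ₗ φ) (N.tin n w) = N'.tD (N'.tin (n - 1) y) := e
    rw [PNm_tin φ h1 hw, N'.tD_tin hy] at e
    have e2 : φ w = N'.D (n - 1) y := by
      have h2 := N'.D_deg _ _ hy
      rw [sub_add_cancel] at e h2
      rw [← N'.tcomp_same (h1 _ _ hw), e, N'.tcomp_same h2]
    obtain ⟨v, hv, hDv⟩ := i n w hw (N.tin_inj (N.D_deg _ _ hw) hDw) y hy e2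
    refine ⟨N.tin (n - 1) v, N.tin_mem hv, ?_⟩
    exact (N.tD_tin hv).trans (N.tin_congr (by ring) hDv)
end

def rlin (P : DGBimod A) (n : ℤ) : Submodule k (P.M →ₗ[k] A.R) where
  carrier := {f | (∀ (j : ℤ), ∀ m ∈ P.gm j, f m ∈ A.gr (j + n)) ∧ ∀ a m, f (P.actR a m) = f m * a}
  add_mem' := fun hf hg => ⟨fun j m hm => add_mem (hf.1 j m hm) (hg.1 j m hm), fun a m => by
    rw [LinearMap.add_apply, hf.2, hg.2, LinearMap.add_apply, add_mul]⟩
  zero_mem' := ⟨fun j m hm => zero_mem _, by simp⟩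
  smul_mem' := fun c f hf => ⟨fun j m hm => Submodule.smul_mem _ c (hf.1 j m hm), fun a m => by
    rw [LinearMap.smul_apply, hf.2, LinearMap.smul_apply, smul_mul_assoc]⟩

theorem dlA {P : DGBimod A} (n : ℤ) (f : P.M →ₗ[k] A.R) (x : P.M) :
    dl P (ofDG (dA A)) n f x = A.d (f x) - sgnz n • f (P.D x) := dl_apply (N := ofDG (dA A)) n f x

abbrev H1 (P : DGBimod A) : PN A where
  E := P.M →ₗ[k] A.R
  gm := rlin P
  aL := fun _ _ => LinearMap.llcomp k P.M A.R A.R ∘ₗ LinearMap.mul k A.R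
  aR := fun _ _ => (LinearMap.llcomp k P.M P.M A.R).flip ∘ₗ P.actL
  D := fun n => dl P (ofDG (dA A)) n
  aL_one := fun n m _ => by ext; simp
  aR_one := fun n m _ => by ext; simp [P.actL_one]
  aL_mul := fun i j n x _ y _ m _ => by ext; simp [mul_assoc]
  aR_mul := fun i j n x _ y _ m _ => by ext; simp [P.actL_mul]
  aLR := fun i j n x _ y _ m _ => by ext; simp
  aL_deg := fun i n x hx m hm => ⟨fun j y hy => mem_cast (A.mul_mem hx (hm.1 _ _ hy)) (by ring),
    fun a y => by simp [hm.2, mul_assoc]⟩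
  aR_deg := fun i n x hx m hm => ⟨fun j y hy => mem_cast (hm.1 _ _ (P.actL_deg _ _ _ _ hx hy)) (by ring),
    fun a y => by simp [hm.2, P.actLR]⟩
  D_deg := fun n m hm => ⟨fun j y hy => by
    rw [dlA]
    exact sub_mem (mem_cast (A.d_deg _ _ (hm.1 _ _ hy)) (by ring))
      (sgnz_smul_mem _ _ (mem_cast (hm.1 _ _ (P.D_deg _ _ hy)) (by ring))), fun a y => by
    rw [dlA, dlA]
    induction y using gr_induction P.gm with
    | h0 => simp
    | ha x y h1 h2 =>
      simp only [map_add, add_mul, sub_mul, smul_add] at h1 h2 ⊢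
      linear_combination (norm := module) h1 + h2
    | h j y hy =>
      rw [DGleibR _ hy, map_add, map_zsmul, hm.2, hm.2, hm.2, A.leibniz _ _ (hm.1 _ _ hy), sub_mul,
        smul_add, smul_smul, sgnz_add, mul_comm (sgnz n), smul_mul_assoc]
      abel⟩
  D_sq := fun n m _ => dl_dl (N := ofDG (dA A)) m
  leibL := fun i n x hx m _ => by
    ext y
    refine (dlA (i + n) _ y).trans ?_
    change A.d (x * m y) - sgnz (i + n) • (x * m (P.D y))
      = A.d x * m y + sgnz i • (x * (dl P (ofDG (dA A)) n m y))
    rw [dlA, A.leibniz _ _ hx, mul_sub, smul_sub, sgnz_add, mul_smul, mul_smul_comm]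
    abel
  leibR := fun i n x hx m _ => by
    ext y
    refine (dlA (n + i) _ y).trans ?_
    change A.d (m (P.actL x y)) - sgnz (n + i) • m (P.actL x (P.D y))
      = dl P (ofDG (dA A)) n m (P.actL x y) + sgnz n • m (P.actL (A.d x) y)
    rw [dlA, DGleibL _ hx, map_add, map_zsmul, smul_add, sgnz_add, mul_smul]
    abel

section
variable {P : DGBimod A} (F : BimodHom P (dA A))
abbrev dAN (A : DGAlgebra k) : PN A := (ofDG (dA A)).toPN

def lmF : A.R →ₗ[k] (P.M →ₗ[k] A.R) :=
  (LinearMap.llcomp k P.M A.R A.R).flip (F.f) ∘ₗ LinearMap.mul k A.R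

theorem lmF_ap (a : A.R) (x : P.M) : lmF F a x = a * (F.f x : A.R) := rfl

theorem alp_qi (hP : IsHoProjB P) (hq : QI (PBHom.ofDG F)) :
    ∃ g : BimodHom (tot (dAN A)) (tot (H1 P)), QI (PBHom.ofDG g) := by
  have Fd : ∀ x, (F.f (P.D x) : A.R) = A.d (F.f x) := F.comm
  have FL : ∀ a x, (F.f (P.actL a x) : A.R) = a * (F.f x : A.R) := F.actLc
  have FR : ∀ a x, (F.f (P.actR a x) : A.R) = (F.f x : A.R) * a := F.actRc
  have Fdeg : ∀ j, ∀ x ∈ P.gm j, (F.f x : A.R) ∈ A.gr j := F.deg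
  obtain ⟨p, hp, hDp, c, hc, hF⟩ := hq.1 0 (1 : A.R) A.one_mem A_d_one
  have hF : (F.f p : A.R) = 1 + A.d c := hF
  have hc : c ∈ A.gr (-1) := mem_cast hc (by ring)
  obtain ⟨h, hh1, hh2, hh3⟩ := right_htpy hP hq hp hDp hc hF
  refine ⟨PNmap (N := dAN A) (N' := H1 P) (lmF F) ?_ ?_ ?_ ?_, PNmap_qi _ _ _ _ _ ?_ ?_⟩
  · intro n f hf
    exact ⟨fun j m hm => mem_cast (A.mul_mem hf (Fdeg _ _ hm)) (by ring), fun a m => by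
      rw [lmF_ap, lmF_ap, FR, mul_assoc]⟩
  · intro i n a ha f hf
    ext x; exact mul_assoc _ _ _
  · intro i n a ha f hf
    ext x; change f * a * (F.f x : A.R) = f * (F.f (P.actL a x) : A.R)
    rw [FL, mul_assoc]
  · intro n f hf
    ext x
    refine Eq.trans ?_ (dlA n _ x).symm
    change A.d f * (F.f x : A.R) = A.d (f * (F.f x : A.R)) - sgnz n • (f * (F.f (P.D x) : A.R))
    rw [Fd, A.leibniz _ _ hf]
    abel
  · intro n z hz hDz
    have hz' : ∀ x, A.d (z x) = sgnz n • z (P.D x) := fun x => by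
      have := (dlA n z x).symm.trans (LinearMap.congr_fun hDz x)
      exact sub_eq_zero.mp this
    refine ⟨z p, mem_cast (hz.1 _ _ hp) (by ring), ?_, - sgnz n • z ∘ₗ h, ?_, ?_⟩
    · change A.d (z p) = 0
      rw [hz', hDp]; simp
    · rw [neg_smul]
      exact neg_mem (sgnz_smul_mem _ _ ⟨fun j m hm => mem_cast (hz.1 _ _ (hh1 _ _ hm)) (by ring),
        fun a m => by simp [hh2, hz.2]⟩)
    · ext x
      refine Eq.trans ?_ (congrArg (fun t => z x + t) (dlA (n - 1) _ x).symm)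
      have e : z p * (F.f x : A.R) = z x - z (P.D (h x)) - z (h (P.D x)) := by
        rw [← hz.2, sub_sub, ← map_add, ← hh3, map_sub]; abel
      rw [lmF_ap, e, sgnz_sub, sgnz_one]
      have h4 := hz' (h x)
      simp only [LinearMap.smul_apply, LinearMap.comp_apply, LinearMap.neg_apply, map_neg, map_zsmul, neg_smul, h4]
      rcases sgnz_cases n with h | h <;> simp [h] <;> abel
  · intro n w hw hDw y hy e
    have hw : w ∈ A.gr n := hw
    have hDw : A.d w = 0 := hDw
    have e1 : w * (1 + A.d c) = A.d (y p) := by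
      have := (LinearMap.congr_fun e p).trans (dlA (n - 1) y p)
      rw [hDp, lmF_ap, hF] at this
      rw [this]; simp
    refine ⟨y p - sgnz n • (w * c), sub_mem (mem_cast (hy.1 _ _ hp) (by ring))
      (sgnz_smul_mem _ _ (mem_cast (A.mul_mem hw hc) (by ring))), ?_⟩
    change A.d (y p - sgnz n • (w * c)) = w
    rw [map_sub, ← e1, map_zsmul, A.leibniz _ _ hw, hDw, zero_mul, zero_add, sgnz_smul_smul]
    rw [mul_add, mul_one]; abel
end


section
variable {B : DGBimod A}
def OpL (B : DGBimod A) (i : ℤ) : A.R →ₗ[k] (B.M ⊗[k] A.R →ₗ[k] B.M ⊗[k] A.R) :=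
  (TensorProduct.mapBilinear (.id k) B.M A.R B.M A.R) (sg B.gm i) ∘ₗ LinearMap.mul k A.R
def OpR (B : DGBimod A) (i : ℤ) : A.R →ₗ[k] (B.M ⊗[k] A.R →ₗ[k] B.M ⊗[k] A.R) :=
  (TensorProduct.mapBilinear (.id k) B.M A.R B.M A.R).flip LinearMap.id ∘ₗ
    (LinearMap.llcomp k B.M B.M B.M).flip (sg B.gm i) ∘ₗ B.actR
theorem OpL_ap (i : ℤ) (a : A.R) (ν : B.M) (c : A.R) :
    OpL B i a (ν ⊗ₜ c) = sg B.gm i ν ⊗ₜ (a * c) := rfl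
theorem OpR_ap (i : ℤ) (a : A.R) (ν : B.M) (c : A.R) :
    OpR B i a (ν ⊗ₜ c) = B.actR a (sg B.gm i ν) ⊗ₜ c := rfl

/-- operators of degree `i` -/
structure OpOk (B : DGBimod A) (i : ℤ) (T : B.M ⊗[k] A.R →ₗ[k] B.M ⊗[k] A.R) : Prop where
  deg : ∀ n, ∀ t ∈ tenGrade B.gm A.gr n, T t ∈ tenGrade B.gm A.gr (n + i)
  L : ∀ l, ∀ x ∈ A.gr l, ∀ t, T ((TT B (dA A)).aL x t) = sgnz (l * i) • (TT B (dA A)).aL x (T t)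
  R : ∀ x t, T ((TT B (dA A)).aR x t) = (TT B (dA A)).aR x (T t)

theorem OpOk.mem {P : DGBimod A} {i n m : ℤ} {T} (h : OpOk B i T) {f : P.M →ₗ[k] B.M ⊗[k] A.R}
    (hf : f ∈ HomG P (TT B (dA A)) n) (e : n + i = m) : T ∘ₗ f ∈ HomG P (TT B (dA A)) m := by
  subst e
  refine ⟨fun j x hx => mem_cast (h.deg _ _ (hf.1 j x hx)) (by ring), fun l x hx y => ?_, fun x y => ?_⟩
  · rw [LinearMap.comp_apply, LinearMap.comp_apply, hf.2.1 l x hx, map_zsmul, h.L l x hx, smul_smul,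
      mul_add, sgnz_add]; rfl
  · rw [LinearMap.comp_apply, hf.2.2, h.R]; rfl

theorem OpL_ok {i : ℤ} {a : A.R} (ha : a ∈ A.gr i) : OpOk B i (OpL B i a) where
  deg := fun n t ht => ten_map (U := B) (V := dA A) (U' := B) (V' := dA A) (a := 0) (b := i)
    (fun j u hu => mem_cast (sg_mem' B.gm i hu) (by ring))
    (fun j u hu => mem_cast (A.mul_mem ha hu) (by ring)) (by ring) ht
  L := fun l x hx t => by
    induction t using TensorProduct.induction_on with
    | zero => simp
    | add _ _ h1 h2 => simp only [map_add, h1, h2, smul_add]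
    | tmul ν c =>
      rw [TT_aL, OpL_ap, OpL_ap, TT_aL, sg_actL i hx, mul_comm i l, TensorProduct.smul_tmul']
  R := fun x t => by
    induction t using TensorProduct.induction_on with
    | zero => simp
    | add _ _ h1 h2 => simp only [map_add, h1, h2]
    | tmul ν c => 
      change sg B.gm i ν ⊗ₜ[k] (a * (c * x)) = sg B.gm i ν ⊗ₜ[k] (a * c * x)
      rw [mul_assoc]

theorem OpR_ok {i : ℤ} {a : A.R} (ha : a ∈ A.gr i) : OpOk B i (OpR B i a) where
  deg := fun n t ht => ten_map (U := B) (V := dA A) (U' := B) (V' := dA A) (a := i) (b := 0)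
    (f := B.actR a ∘ₗ sg B.gm i) (g := LinearMap.id (M := A.R))
    (fun j u hu => mem_cast (B.actR_deg _ _ _ _ ha (sg_mem' B.gm i hu)) (by ring))
    (fun j u hu => mem_cast hu (by ring)) (by ring) ht
  L := fun l x hx t => by
    induction t using TensorProduct.induction_on with
    | zero => simp
    | add _ _ h1 h2 => simp only [map_add, h1, h2, smul_add]
    | tmul ν c =>
      rw [TT_aL, OpR_ap, OpR_ap, TT_aL, sg_actL i hx, mul_comm i l, map_zsmul, B.actLR,
        TensorProduct.smul_tmul']
  R := fun x t => by
    induction t using TensorProduct.induction_on with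
    | zero => simp
    | add _ _ h1 h2 => simp only [map_add, h1, h2]
    | tmul ν c => rfl

theorem sg_comm (t s : ℤ) (ν : B.M) : sg B.gm t (sg B.gm s ν) = sg B.gm s (sg B.gm t ν) := by
  rw [← sg_add, ← sg_add, add_comm]

theorem OpL_D {i : ℤ} {a : A.R} (ha : a ∈ A.gr i) (t : B.M ⊗[k] A.R) :
    (TT B (dA A)).D (OpL B i a t) = OpL B (i + 1) (A.d a) t + sgnz i • OpL B i a ((TT B (dA A)).D t) := by
  induction t using TensorProduct.induction_on with
  | zero => simp
  | add _ _ h1 h2 => simp only [map_add, h1, h2, smul_add]; abel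
  | tmul ν c =>
    have e := OpL_ap i a (B.D ν) c
    have e' := OpL_ap i a (sg B.gm 1 ν) (A.d c)
    refine (TT_D (V := dA A) _ _).trans ?_
    refine Eq.trans ?_ (congrArg (fun z => _ + sgnz i • (OpL B i a z)) (TT_D (V := dA A) ν c).symm)
    refine Eq.trans ?_ (congrArg (fun z => _ + sgnz i • z) ((map_add (OpL B i a) _ _).trans
      (congrArg₂ (· + ·) e e')).symm)
    change B.D (sg B.gm i ν) ⊗ₜ[k] (a * c) + _ ⊗ₜ[k] A.d (a * c) = sg B.gm (i + 1) ν ⊗ₜ[k] (A.d a * c) + _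
    rw [A.leibniz _ _ ha, smul_add, sg_D B.gm i B.D B.D_deg, ← TensorProduct.smul_tmul', sgnz_smul_smul,
      TensorProduct.tmul_add, TensorProduct.tmul_smul, sg_add, sg_comm 1 i]
    abel

theorem OpR_D {i : ℤ} {a : A.R} (ha : a ∈ A.gr i) (t : B.M ⊗[k] A.R) :
    (TT B (dA A)).D (OpR B i a t) = OpR B (i + 1) (A.d a) t + sgnz i • OpR B i a ((TT B (dA A)).D t) := by
  induction t using TensorProduct.induction_on with
  | zero => simp
  | add _ _ h1 h2 => simp only [map_add, h1, h2, smul_add]; abel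
  | tmul ν c =>
    have e := OpR_ap i a (B.D ν) c
    have e' := OpR_ap i a (sg B.gm 1 ν) (A.d c)
    refine (TT_D (V := dA A) _ _).trans ?_
    refine Eq.trans ?_ (congrArg (fun z => _ + sgnz i • (OpR B i a z)) (TT_D (V := dA A) ν c).symm)
    refine Eq.trans ?_ (congrArg (fun z => _ + sgnz i • z) ((map_add (OpR B i a) _ _).trans
      (congrArg₂ (· + ·) e e')).symm)
    change B.D (B.actR a (sg B.gm i ν)) ⊗ₜ[k] c + sg B.gm 1 (B.actR a (sg B.gm i ν)) ⊗ₜ[k] A.d c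
      = B.actR (A.d a) (sg B.gm (i + 1) ν) ⊗ₜ[k] c + _
    have h2 : B.D (B.actR a (sg B.gm i ν)) = B.actR (A.d a) (sg B.gm (i + 1) ν)
        + sgnz i • B.actR a (sg B.gm i (B.D ν)) := by
      clear e e'
      induction ν using gr_induction B.gm with
      | h0 => simp
      | ha x y h1 h2 => simp only [map_add, h1, h2, smul_add]; abel
      | h j x hx =>
        rw [DGleibR _ (sg_mem' B.gm i hx), sg_D B.gm i B.D B.D_deg, map_zsmul, sgnz_smul_smul,
          add_comm i 1, sg_add, sg_mem B.gm 1 (sg_mem' B.gm i hx), map_zsmul, one_mul]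
        abel
    rw [h2, sg_actR 1 ha, one_mul, sg_comm 1 i, smul_add, TensorProduct.add_tmul,
      ← TensorProduct.smul_tmul', ← TensorProduct.smul_tmul']
    abel

theorem OpL_mul (i j : ℤ) (a b : A.R) (t : B.M ⊗[k] A.R) :
    OpL B (i + j) (a * b) t = OpL B i a (OpL B j b t) := by
  induction t using TensorProduct.induction_on with
  | zero => simp
  | add _ _ h1 h2 => simp only [map_add, h1, h2]
  | tmul ν c => rw [OpL_ap, OpL_ap, OpL_ap, sg_add, mul_assoc]

theorem OpR_mul {i j : ℤ} {a : A.R} (ha : a ∈ A.gr i) (b : A.R) (t : B.M ⊗[k] A.R) :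
    OpR B (i + j) (a * b) t = sgnz (i * j) • OpR B j b (OpR B i a t) := by
  induction t using TensorProduct.induction_on with
  | zero => simp
  | add _ _ h1 h2 => simp only [map_add, h1, h2, smul_add]
  | tmul ν c => rw [OpR_ap, OpR_ap, OpR_ap, sg_actR j ha, add_comm i j, sg_add, B.actR_mul,
      TensorProduct.smul_tmul', map_zsmul, mul_comm j i, sgnz_smul_smul]

theorem OpLR {i j : ℤ} (a : A.R) {b : A.R} (hb : b ∈ A.gr j) (t : B.M ⊗[k] A.R) :
    OpL B i a (OpR B j b t) = sgnz (i * j) • OpR B j b (OpL B i a t) := by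
  induction t using TensorProduct.induction_on with
  | zero => simp
  | add _ _ h1 h2 => simp only [map_add, h1, h2, smul_add]
  | tmul ν c => rw [OpR_ap, OpL_ap, OpL_ap, OpR_ap, sg_actR i hb, sg_comm, TensorProduct.smul_tmul']

theorem OpL_one (t : B.M ⊗[k] A.R) : OpL B 0 1 t = t := by
  induction t using TensorProduct.induction_on with
  | zero => simp
  | add _ _ h1 h2 => simp only [map_add, h1, h2]
  | tmul ν c => rw [OpL_ap, sg_zero, one_mul]
theorem OpR_one (t : B.M ⊗[k] A.R) : OpR B 0 1 t = t := by
  induction t using TensorProduct.induction_on with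
  | zero => simp
  | add _ _ h1 h2 => simp only [map_add, h1, h2]
  | tmul ν c => rw [OpR_ap, sg_zero, B.actR_one]

theorem dlT {P : DGBimod A} (n : ℤ) (f : P.M →ₗ[k] B.M ⊗[k] A.R) (x : P.M) :
    dl P (TT B (dA A)) n f x = (TT B (dA A)).D (f x) - sgnz n • f (P.D x) :=
  dl_apply (N := TT B (dA A)) n f x

set_option maxHeartbeats 1000000 in
abbrev H2 (P B : DGBimod A) : PN A where
  E := P.M →ₗ[k] B.M ⊗[k] A.R
  gm := HomG P (TT B (dA A))
  aL := fun i _ => LinearMap.llcomp k P.M (B.M ⊗[k] A.R) (B.M ⊗[k] A.R) ∘ₗ OpL B i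
  aR := fun i n => LinearMap.llcomp k P.M (B.M ⊗[k] A.R) (B.M ⊗[k] A.R) ∘ₗ (sgnz (i * n) • OpR B i)
  D := dl P (TT B (dA A))
  aL_one := fun n m _ => LinearMap.ext fun x => OpL_one _
  aR_one := fun n m _ => LinearMap.ext fun x => by
    change sgnz (0 * n) • OpR B 0 1 (m x) = m x
    rw [zero_mul, sgnz_zero, one_smul, OpR_one]
  aL_mul := fun i j n x _ y _ m _ => LinearMap.ext fun z => OpL_mul i j x y _
  aR_mul := fun i j n x hx y _ m _ => LinearMap.ext fun z => by
    change sgnz ((i + j) * n) • OpR B (i + j) (x * y) (m z)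
      = sgnz (j * (n + i)) • OpR B j y (sgnz (i * n) • OpR B i x (m z))
    rw [OpR_mul hx, map_zsmul, smul_smul, smul_smul, ← sgnz_add, ← sgnz_add]
    congr 2; ring
  aLR := fun i j n x _ y hy m _ => LinearMap.ext fun z => by
    change OpL B i x (sgnz (j * n) • OpR B j y (m z)) = sgnz (j * (i + n)) • OpR B j y (OpL B i x (m z))
    rw [map_zsmul, OpLR _ hy, smul_smul, ← sgnz_add]
    congr 2; ring
  aL_deg := fun i n x hx m hm => (OpL_ok hx).mem hm (add_comm _ _)
  aR_deg := fun i n x hx m hm => by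
    have h := sgnz_smul_mem _ (i * n) ((OpR_ok hx).mem hm rfl)
    exact Eq.mp (congrArg (· ∈ _) (LinearMap.ext fun _ => rfl)) h
  D_deg := fun n m hm => dl_mem hm
  D_sq := fun n m _ => dl_dl (N := TT B (dA A)) m
  leibL := fun i n x hx m _ => by
    ext y
    refine (dlT (i + n) _ y).trans ?_
    change (TT B (dA A)).D (OpL B i x (m y)) - sgnz (i + n) • OpL B i x (m (P.D y))
      = OpL B (i + 1) (A.d x) (m y) + sgnz i • OpL B i x (dl P (TT B (dA A)) n m y)
    rw [dlT, OpL_D hx, map_sub, map_zsmul, smul_sub, sgnz_add, mul_smul]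
    abel
  leibR := fun i n x hx m _ => by
    ext y
    refine (dlT (n + i) _ y).trans ?_
    change (TT B (dA A)).D (sgnz (i * n) • OpR B i x (m y)) - sgnz (n + i) • sgnz (i * n) • OpR B i x (m (P.D y))
      = sgnz (i * (n + 1)) • OpR B i x (dl P (TT B (dA A)) n m y)
        + sgnz n • sgnz ((i + 1) * n) • OpR B (i + 1) (A.d x) (m y)
    rw [dlT, map_zsmul, OpR_D hx, map_sub, map_zsmul, mul_add, add_mul, mul_one, one_mul, sgnz_add, sgnz_add,
      sgnz_add]
    rcases sgnz_cases (i * n) with h | h <;> rcases sgnz_cases i with h' | h' <;>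
      rcases sgnz_cases n with h'' | h'' <;> simp only [h, h', h''] <;> module

section
variable {P B : DGBimod A} (β : PBHom (ofDG B) (dualB (dA A)))
def e1 : B.M ⊗[k] A.R →ₗ[k] A.R := LinearMap.applyₗ (1 : A.R) ∘ₗ evf β
theorem e1_ap (ν : B.M) (c : A.R) : e1 β (ν ⊗ₜ c) = bt β ν 1 • c := by
  change bt β (sg B.gm 1 ν) 1 • c = _
  rw [← bt_sg, A_sg_one]

theorem e1_L (i : ℤ) (a : A.R) (t) : e1 β (OpL B i a t) = a * e1 β t := by
  induction t using TensorProduct.induction_on with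
  | zero => simp
  | add _ _ h1 h2 => simp only [map_add, h1, h2, mul_add]
  | tmul ν c => rw [OpL_ap, e1_ap, e1_ap, ← bt_sg, A_sg_one, mul_smul_comm]

theorem e1_R {i : ℤ} {a : A.R} (ha : a ∈ A.gr i) (t) :
    e1 β (OpR B i a t) = e1 β ((TT B (dA A)).aL a t) := by
  induction t using TensorProduct.induction_on with
  | zero => simp
  | add _ _ h1 h2 => simp only [map_add, h1, h2]
  | tmul ν c => rw [OpR_ap, TT_aL, e1_ap, e1_ap, bt_R, bt_L, mul_one, one_mul, ← bt_sg,
      sg_mem A.gr _ ha, sg_mem A.gr _ ha, sgnz_mul_self, one_mul]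

theorem e1_aR (a : A.R) (t) : e1 β ((TT B (dA A)).aR a t) = e1 β t * a := by
  induction t using TensorProduct.induction_on with
  | zero => simp
  | add _ _ h1 h2 => simp only [map_add, h1, h2, add_mul]
  | tmul ν c =>
    rw [e1_ap]
    exact (e1_ap β ν (c * a)).trans (smul_mul_assoc _ _ _).symm

theorem e1_D (t) : e1 β ((TT B (dA A)).D t) = A.d (e1 β t) := by
  induction t using TensorProduct.induction_on with
  | zero => simp
  | add _ _ h1 h2 => simp only [map_add, h1, h2]
  | tmul ν c =>
    rw [e1_ap]
    refine (congrArg (e1 β) (TT_D (V := dA A) ν c)).trans ?_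
    rw [map_add, e1_ap]
    refine (congrArg (fun z => _ + z) (e1_ap β (sg B.gm 1 ν) (A.d c))).trans ?_
    rw [bt_D, A_sg_one, A_d_one, map_zero, zero_smul, zero_add, ← bt_sg, A_sg_one, map_smul]

theorem e1_deg {n : ℤ} {t} (ht : t ∈ tenGrade B.gm A.gr n) : e1 β t ∈ A.gr n := by
  induction ht using ten_ind (V := dA A) with
  | h0 => rw [map_zero]; exact zero_mem _
  | ha a b _ _ h1 h2 => rw [map_add]; exact add_mem h1 h2
  | h i j ν c hν hc e =>
    rw [show e1 β (ν ⊗ₜ c) = bt β ν 1 • c from e1_ap β ν c]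
    by_cases h : i = 0
    · exact Submodule.smul_mem _ _ (mem_cast hc (by omega))
    · rw [bt_ne β hν A.one_mem (by omega), zero_smul]; exact zero_mem _

theorem G_qi (hP : IsHoProjB P) (hC : CDat B β) :
    ∃ g : BimodHom (tot (H2 P B)) (tot (H1 P)), QI (PBHom.ofDG g) := by
  refine ⟨PNmap (N := H2 P B) (N' := H1 P) (LinearMap.llcomp k P.M (B.M ⊗[k] A.R) A.R (e1 β)) ?_ ?_ ?_ ?_,
    PNmap_qi _ _ _ _ _ ?_ ?_⟩
  · intro n f hf
    exact ⟨fun j m hm => e1_deg β (hf.1 j m hm), fun a m => by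
      change e1 β (f _) = e1 β (f m) * a
      rw [← e1_aR, hf.2.2]⟩
  · intro i n a ha f hf
    ext x; exact e1_L _ _ _ _
  · intro i n a ha f hf
    ext x; change e1 β (sgnz (i * n) • OpR B i a (f x)) = e1 β (f (P.actL a x))
    rw [hf.2.1 i a ha, map_zsmul, map_zsmul, e1_R β ha]
  · intro n f hf
    ext x
    refine Eq.trans ?_ (dlA n _ x).symm
    change e1 β (dl P (TT B (dA A)) n f x) = A.d (e1 β (f x)) - sgnz n • (e1 β (f (P.D x)))
    rw [dlT, map_sub, e1_D, map_zsmul]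
  · intro n z hz hDz
    have hz1 : hatR (M := dA A) n z ∈ Zh P (CR (dA A)) n := by
      refine ⟨hatR_mem hz.1 hz.2, ?_⟩
      change dl P (CR (dA A)) n (hatR (M := dA A) n z) = 0
      rw [hatR_dl]
      have : dl P (ofDG (dA A)) n z = 0 := hDz
      rw [this]; ext; rfl
    obtain ⟨w, hw, hb⟩ := L_surj hP (evm_qi β hC) hz1
    obtain ⟨y, hy, e⟩ := Bh_D hb
    refine ⟨w, hw.1, hw.2, LinearMap.applyₗ (1 : A.R) ∘ₗ y, ?_, ?_⟩
    · exact ⟨fun j x hx => mem_cast (hy.1 j x hx 0 1 A.one_mem) (by ring), fun a m =>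
        LinearMap.congr_fun (hy.2.2 a m) 1⟩
    · ext x
      refine Eq.trans ?_ (congrArg (fun t => z x + t) (dlA (n - 1) _ x).symm)
      have h1 := LinearMap.congr_fun (e x) (1 : A.R)
      have h2 : evf β (w x) 1 - z (P.actL (sg A.gr n 1) x)
        = (CR (dA A)).D (y x) (1 : A.R) + sgnz n • y (P.D x) (1 : A.R) := h1
      rw [CR_D, A_sg_one, A_sg_one, A_d_one, P.actL_one] at h2
      change evf β (w x) 1 = z x + (A.d (y x (1 : A.R)) - sgnz (n - 1) • y (P.D x) (1 : A.R))
      rw [sub_eq_iff_eq_add.mp h2, sgnz_sub, sgnz_one, map_zero]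
      change A.d (y x (1 : A.R)) - 0 + _ + _ = _
      module
  · intro n w hw hDw y hy e
    have hb : (evm β).f ∘ₗ w ∈ Bh P (CR (dA A)) n := by
      refine ⟨hatR (M := dA A) (n - 1) y, hatR_mem hy.1 hy.2, ?_⟩
      rw [hatR_dl]
      have e' : dl P (ofDG (dA A)) (n - 1) y = e1 β ∘ₗ w := e.symm
      rw [e', sub_add_cancel]
      ext x : 1
      apply gr_ext A.gr
      intro i b hb
      change e1 β (w (P.actL (sg A.gr n b) x)) = evf β (w x) b
      rw [sg_mem A.gr n hb, map_zsmul, LinearMap.smul_apply, map_zsmul, hw.2.1 i b hb, mul_comm i,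
        sgnz_smul_smul]
      have := LinearMap.congr_fun ((evm β).aLc b (w x)) (1 : A.R)
      refine Eq.trans this ?_
      change evf β (w x) (1 * b) = _
      rw [one_mul]
    obtain ⟨v, hv, e⟩ := L_inj hP (evm_qi β hC) ⟨hw, hDw⟩ hb
    exact ⟨v, hv, e⟩
end


theorem zigzag {P B : DGBimod A} {F : BimodHom P (dA A)} (hP : IsHoProjB P) (hq : QI (PBHom.ofDG F))
    {β : PBHom (ofDG B) (dualB (dA A))} (hβ : QI β) (hC : CDat B β) (n : ℤ) :
    Nonempty (UH P (ofDG B) n ≃ₗ[k] UH P (dualB (tot (H2 P B))) n) := by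
  obtain ⟨g, hg⟩ := alp_qi F hP hq
  obtain ⟨g', hg'⟩ := G_qi β hP hC
  let t : BimodHom (tot (dAN A)) (dA A) := ⟨(tsm (ofDG (dA A))).f, (tsm (ofDG (dA A))).deg,
    (tsm (ofDG (dA A))).aLc, (tsm (ofDG (dA A))).aRc, (tsm (ofDG (dA A))).comm⟩
  have ht : QI (PBHom.ofDG t) := tsm_qi (ofDG (dA A))
  exact ⟨(Ueq hP hβ n).trans <| (Ueq hP (dualMap_qi t ht) n).trans <|
    (Ueq hP (dualMap_qi g hg) n).symm.trans (Ueq hP (dualMap_qi g' hg') n)⟩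

abbrev quoPB (X : PB A) (S : Submodule k X.E) (hL : ∀ a, S ≤ S.comap (X.aL a))
    (hR : ∀ a, S ≤ S.comap (X.aR a)) (hD : S ≤ S.comap X.D) : PB A where
  E := X.E ⧸ S
  gm := fun n => (X.gm n).map S.mkQ
  aL := LinearMap.mk₂ k (fun a t => S.mapQ S (X.aL a) (hL a) t)
    (fun _ _ t => by obtain ⟨t, rfl⟩ := S.mkQ_surjective t; simp)
    (fun _ _ t => by obtain ⟨t, rfl⟩ := S.mkQ_surjective t; simp) (fun _ _ _ => map_add _ _ _)
    (fun _ _ _ => map_smul _ _ _)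
  aR := LinearMap.mk₂ k (fun a t => S.mapQ S (X.aR a) (hR a) t)
    (fun _ _ t => by obtain ⟨t, rfl⟩ := S.mkQ_surjective t; simp)
    (fun _ _ t => by obtain ⟨t, rfl⟩ := S.mkQ_surjective t; simp) (fun _ _ _ => map_add _ _ _)
    (fun _ _ _ => map_smul _ _ _)
  aL_one := fun t => by obtain ⟨t, rfl⟩ := S.mkQ_surjective t; exact congrArg S.mkQ (X.aL_one t)
  aR_one := fun t => by obtain ⟨t, rfl⟩ := S.mkQ_surjective t; exact congrArg S.mkQ (X.aR_one t)
  aL_mul := fun x y t => by obtain ⟨t, rfl⟩ := S.mkQ_surjective t; exact congrArg S.mkQ (X.aL_mul x y t)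
  aR_mul := fun x y t => by obtain ⟨t, rfl⟩ := S.mkQ_surjective t; exact congrArg S.mkQ (X.aR_mul x y t)
  aLR := fun x y t => by obtain ⟨t, rfl⟩ := S.mkQ_surjective t; exact congrArg S.mkQ (X.aLR x y t)
  aL_deg := by
    rintro i j x _ hx ⟨t, ht, rfl⟩; exact ⟨_, X.aL_deg i j x t hx ht, rfl⟩
  aR_deg := by
    rintro i j x _ hx ⟨t, ht, rfl⟩; exact ⟨_, X.aR_deg i j x t hx ht, rfl⟩
  D := S.mapQ S X.D hD
  D_deg := by
    rintro i _ ⟨t, ht, rfl⟩; exact ⟨_, X.D_deg i t ht, rfl⟩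
  D_sq := fun t => by obtain ⟨t, rfl⟩ := S.mkQ_surjective t; exact congrArg S.mkQ (X.D_sq t)
  leibL := by
    rintro i j x _ hx ⟨t, ht, rfl⟩; exact congrArg S.mkQ (X.leibL i j x t hx ht)
  leibR := by
    rintro i j x _ hx ⟨t, ht, rfl⟩; exact congrArg S.mkQ (X.leibR i j x t hx ht)

section
variable (B P : DGBimod A)
theorem rel_mem {B P : DGBimod A} (a : A.R) (u : B.M) (v : P.M) :
    B.actR a u ⊗ₜ[k] v - u ⊗ₜ P.actL a v ∈ tenRelBB B P := Submodule.subset_span ⟨a, u, v, rfl⟩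

abbrev BP : PB A := quoPB (TT B P) (tenRelBB B P)
  (fun x => Submodule.span_le.mpr (by
    rintro _ ⟨a, u, v, rfl⟩
    simp only [SetLike.mem_coe, Submodule.mem_comap]
    rw [map_sub, TT_aL, TT_aL, B.actLR]
    exact rel_mem _ _ _))
  (fun x => Submodule.span_le.mpr (by
    rintro _ ⟨a, u, v, rfl⟩
    simp only [SetLike.mem_coe, Submodule.mem_comap]
    rw [map_sub, TT_aR, TT_aR, ← P.actLR]
    exact rel_mem _ _ _))
  (Submodule.span_le.mpr (by
    rintro _ ⟨a, u, v, rfl⟩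
    simp only [SetLike.mem_coe, Submodule.mem_comap]
    induction a using gr_induction A.gr with
    | h0 => simp
    | ha a b h1 h2 =>
      have := add_mem h1 h2
      rw [← map_add] at this
      convert this using 2
      simp only [map_add, LinearMap.add_apply, TensorProduct.add_tmul, TensorProduct.tmul_add]; abel
    | h i a ha =>
      induction u using gr_induction B.gm with
      | h0 => simp
      | ha u u' h1 h2 =>
        have := add_mem h1 h2
        rw [← map_add] at this
        convert this using 2
        simp only [map_add, TensorProduct.add_tmul]; abel
      | h j u hu =>
        rw [map_sub, TT_D' (B.actR_deg _ _ _ _ ha hu), TT_D' hu, DGleibR _ hu, DGleibL _ ha]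
        have h1 := rel_mem a (B.D u) v
        have h2 := sgnz_smul_mem _ j (rel_mem (A.d a) u v)
        have h3 := sgnz_smul_mem _ (j + i) (rel_mem a u (P.D v))
        refine Eq.mp (congrArg (· ∈ _) ?_) (add_mem (add_mem h1 h2) h3)
        simp only [TensorProduct.add_tmul, TensorProduct.tmul_add, ← TensorProduct.smul_tmul',
          TensorProduct.tmul_smul, smul_sub, smul_add, smul_smul, sgnz_add]
        abel))

def bp : B.M →ₗ[k] P.M →ₗ[k] (BP B P).E :=
  (TensorProduct.mk k B.M P.M).compr₂ (tenRelBB B P).mkQ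
variable {B P}
theorem bp_rel (a : A.R) (u : B.M) (v : P.M) : bp B P (B.actR a u) v = bp B P u (P.actL a v) :=
  (Submodule.Quotient.eq _).mpr (rel_mem a u v)
theorem bp_mem {i j n : ℤ} {u : B.M} {v : P.M} (hu : u ∈ B.gm i) (hv : v ∈ P.gm j) (h : i + j = n) :
    bp B P u v ∈ (BP B P).gm n := ⟨_, tmul_mem_ten hu hv h, rfl⟩
theorem bp_D (u : B.M) (v : P.M) :
    (BP B P).D (bp B P u v) = bp B P (B.D u) v + bp B P (sg B.gm 1 u) (P.D v) :=
  congrArg (tenRelBB B P).mkQ (TT_D u v)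
theorem bp_L (a : A.R) (u : B.M) (v : P.M) : (BP B P).aL a (bp B P u v) = bp B P (B.actL a u) v := rfl
theorem bp_R (a : A.R) (u : B.M) (v : P.M) : (BP B P).aR a (bp B P u v) = bp B P u (P.actR a v) := rfl
theorem bp_ext {N : Type} [AddCommGroup N] [Module k N] {f g : (BP B P).E →ₗ[k] N}
    (h : ∀ i, ∀ u ∈ B.gm i, ∀ j, ∀ v ∈ P.gm j, f (bp B P u v) = g (bp B P u v)) : f = g := by
  apply Submodule.linearMap_qext
  apply TensorProduct.ext
  apply gr_ext B.gm
  intro i u hu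
  apply gr_ext P.gm
  exact h i u hu
def bpl {N : Type} [AddCommGroup N] [Module k N] (f : B.M →ₗ[k] P.M →ₗ[k] N)
    (h : ∀ a u v, f (B.actR a u) v = f u (P.actL a v)) : (BP B P).E →ₗ[k] N :=
  (tenRelBB B P).liftQ (TensorProduct.lift f) (Submodule.span_le.mpr (by
    rintro _ ⟨a, u, v, rfl⟩; simp [h]))
theorem bpl_ap {N : Type} [AddCommGroup N] [Module k N] (f : B.M →ₗ[k] P.M →ₗ[k] N) (h) (u : B.M) (v : P.M) :
    bpl f h (bp B P u v) = f u v := rfl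
end

section
variable {B P : DGBimod A} (F : BimodHom P (dA A))
def Fs0 : (BP B P).E →ₗ[k] B.M := bpl (B.actR.flip.compl₂ (F.f : P.M →ₗ[k] A.R)) (fun a u v => by
  change B.actR (F.f v : A.R) (B.actR a u) = B.actR (F.f (P.actL a v) : A.R) u
  rw [← B.actR_mul]
  exact congrArg (fun t => B.actR t u) (F.actLc a v).symm)
theorem Fs0_ap (u : B.M) (v : P.M) : Fs0 F (bp B P u v) = B.actR (F.f v : A.R) u := rfl

def Fs : PBHom (BP B P) (ofDG B) where
  f := Fs0 F
  deg := by
    rintro n _ ⟨t, ht, rfl⟩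
    induction ht using ten_ind with
    | h0 => rw [map_zero, map_zero]; exact zero_mem _
    | ha a b _ _ h1 h2 => rw [map_add, map_add]; exact add_mem h1 h2
    | h i j u v hu hv e => exact mem_cast (gm := B.gm) (B.actR_deg _ _ _ _ (F.deg _ _ hv) hu) e
  aLc := fun x m => by
    refine LinearMap.congr_fun (f := Fs0 F ∘ₗ (BP B P).aL x) (g := B.actL x ∘ₗ Fs0 F) (bp_ext ?_) m
    intro i u hu j v hv
    exact (B.actLR _ _ _).symm
  aRc := fun x m => by
    refine LinearMap.congr_fun (f := Fs0 F ∘ₗ (BP B P).aR x) (g := B.actR x ∘ₗ Fs0 F) (bp_ext ?_) m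
    intro i u hu j v hv
    change B.actR (F.f (P.actR x v) : A.R) u = B.actR x (B.actR (F.f v : A.R) u)
    rw [← B.actR_mul]
    exact congrArg (fun t => B.actR t u) (F.actRc x v)
  comm := fun m => by
    refine LinearMap.congr_fun (f := Fs0 F ∘ₗ (BP B P).D) (g := B.D ∘ₗ Fs0 F) (bp_ext ?_) m
    intro i u hu j v hv
    have Fd : (F.f (P.D v) : A.R) = A.d (F.f v) := F.comm v
    simp only [LinearMap.comp_apply]
    rw [bp_D, map_add, Fs0_ap, Fs0_ap, Fs0_ap, Fd, DGleibR _ hu, sg_mem B.gm 1 hu, map_zsmul, one_mul]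

theorem Fs_qi (hP : IsHoProjB P) (hq : QI (PBHom.ofDG F)) : QI (Fs (B := B) F) := by
  obtain ⟨p, hp, hDp, c, hc, hF⟩ := hq.1 0 (1 : A.R) A.one_mem A_d_one
  have hF : (F.f p : A.R) = 1 + A.d c := hF
  have hc : c ∈ A.gr (-1) := mem_cast hc (by ring)
  have hDp : P.D p = 0 := hDp
  obtain ⟨h, hh1, hh2, hh3⟩ := left_htpy hP hq hp hDp hc hF
  constructor
  · intro n z hz hDz
    have hDz : B.D z = 0 := hDz
    refine ⟨bp B P z p, bp_mem hz hp (add_zero _), ?_, sgnz n • B.actR c z,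
      sgnz_smul_mem _ _ (mem_cast (gm := B.gm) (B.actR_deg _ _ _ _ hc hz) (by ring)), ?_⟩
    · rw [bp_D, hDz, hDp]; simp
    · change B.actR (F.f p : A.R) z = z + B.D (sgnz n • B.actR c z)
      rw [hF, map_zsmul, DGleibR _ hz, hDz, map_zero, zero_add, sgnz_smul_smul, map_add,
        LinearMap.add_apply, B.actR_one]
  · intro n w hw hDw y hy e
    have hL : ∀ a x, ∀ u : B.M, bp B P (sg B.gm 1 (B.actR a u)) (h x)
        = bp B P (sg B.gm 1 u) (h (P.actL a x)) := fun a x u => by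
      induction a using gr_induction A.gr with
      | h0 => simp
      | ha a b h1 h2 => simp only [map_add, LinearMap.add_apply, h1, h2]
      | h i a ha =>
        rw [sg_actR 1 ha, hh2 i a ha, one_mul, map_zsmul, map_zsmul, LinearMap.smul_apply, bp_rel]
    let H : (BP B P).E →ₗ[k] (BP B P).E :=
      bpl (((bp B P) ∘ₗ sg B.gm 1).compl₂ h) (fun a u v => hL a v u)
    have H_ap : ∀ u v, H (bp B P u v) = bp B P (sg B.gm 1 u) (h v) := fun u v => rfl
    have Hdeg : H w ∈ (BP B P).gm (n - 1) := by
      obtain ⟨t, ht, rfl⟩ := hw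
      clear hDw e
      induction ht using ten_ind with
      | h0 => rw [map_zero, map_zero]; exact zero_mem _
      | ha a b _ _ h1 h2 => rw [map_add, map_add]; exact add_mem h1 h2
      | h i j u v hu hv e => exact bp_mem (sg_mem' B.gm 1 hu) (hh1 _ _ hv) (by omega)
    have key : (BP B P).D ∘ₗ H + H ∘ₗ (BP B P).D + (bp B P).flip p ∘ₗ Fs0 F = LinearMap.id := by
      apply bp_ext
      intro i u hu j v hv
      simp only [LinearMap.add_apply, LinearMap.comp_apply, LinearMap.flip_apply, LinearMap.id_apply]
      rw [bp_D, map_add, H_ap, H_ap, H_ap, Fs0_ap, bp_D, sg_sg, bp_rel, sg_D B.gm 1 B.D B.D_deg, sgnz_one]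
      have := congrArg (bp B P u) (hh3 v)
      rw [map_sub, map_add] at this
      rw [neg_smul, one_smul, map_neg, LinearMap.neg_apply]
      linear_combination (norm := module) - this
    refine ⟨H w + bp B P y p, add_mem Hdeg (bp_mem hy hp (add_zero _)), ?_⟩
    have h1 := LinearMap.congr_fun key w
    have e : Fs0 F w = B.D y := e
    simp only [LinearMap.add_apply, LinearMap.comp_apply, LinearMap.flip_apply, LinearMap.id_apply] at h1
    rw [hDw, e, map_zero, add_zero] at h1
    rw [map_add, bp_D, hDp, map_zero, add_zero]
    exact h1
end


section
variable {X P B : DGBimod A}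
def th (B P : DGBimod A) (p : ℤ) : P.M →ₗ[k] (B.M ⊗[k] A.R →ₗ[k] (BP B P).E) where
  toFun := fun q => TensorProduct.lift ((bp B P ∘ₗ sg B.gm p).compl₂ (P.actR.flip q))
  map_add' := fun q q' => TensorProduct.ext' fun u v => by simp
  map_smul' := fun c q => TensorProduct.ext' fun u v => by simp
theorem th_ap (p : ℤ) (q : P.M) (u : B.M) (c : A.R) :
    th B P p q (u ⊗ₜ c) = bp B P (sg B.gm p u) (P.actR c q) := rfl

theorem th_L (p : ℤ) (q : P.M) {i : ℤ} {a : A.R} (ha : a ∈ A.gr i) (t : B.M ⊗[k] A.R) :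
    th B P p q ((TT B (dA A)).aL a t) = sgnz (i * p) • (BP B P).aL a (th B P p q t) := by
  induction t using TensorProduct.induction_on with
  | zero => simp
  | add _ _ h1 h2 => simp only [map_add, h1, h2, smul_add]
  | tmul u c =>
    rw [TT_aL, th_ap, th_ap, sg_actL p ha, map_zsmul, LinearMap.smul_apply, bp_L, mul_comm]

theorem th_R (p : ℤ) (q : P.M) (a : A.R) (t : B.M ⊗[k] A.R) :
    th B P p q ((TT B (dA A)).aR a t) = (BP B P).aR a (th B P p q t) := by
  induction t using TensorProduct.induction_on with
  | zero => simp
  | add _ _ h1 h2 => simp only [map_add, h1, h2]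
  | tmul u c =>
    change bp B P (sg B.gm p u) (P.actR (c * a) q) = bp B P (sg B.gm p u) (P.actR a (P.actR c q))
    rw [P.actR_mul]

theorem th_D {p : ℤ} {q : P.M} (hq : q ∈ P.gm p) (t : B.M ⊗[k] A.R) :
    (BP B P).D (th B P p q t) = th B P (p + 1) (P.D q) t + sgnz p • th B P p q ((TT B (dA A)).D t) := by
  induction t using TensorProduct.induction_on with
  | zero => simp
  | add _ _ h1 h2 => simp only [map_add, h1, h2, smul_add]; abel
  | tmul u c =>
    refine Eq.trans ?_ (congrArg (fun z => _ + sgnz p • th B P p q z) (TT_D (V := dA A) u c).symm)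
    refine Eq.trans ?_ (congrArg (fun z => _ + sgnz p • z) ((map_add (th B P p q) _ _).trans
      (congrArg₂ (· + ·) (th_ap p q (B.D u) c) (th_ap p q (sg B.gm 1 u) (A.d c)))).symm)
    rw [th_ap, th_ap, bp_D, DGleibR _ hq, sg_D B.gm p B.D B.D_deg, map_zsmul, map_add, map_zsmul,
      LinearMap.smul_apply, smul_add, sgnz_smul_smul, add_comm p 1, sg_add, sg_comm 1 p]
    abel

theorem th_opL (p i : ℤ) (q : P.M) (a : A.R) (t : B.M ⊗[k] A.R) :
    th B P (p + i) (P.actR a q) t = th B P p q (OpL B i a t) := by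
  induction t using TensorProduct.induction_on with
  | zero => simp
  | add _ _ h1 h2 => simp only [map_add, h1, h2]
  | tmul u c => rw [th_ap, OpL_ap, th_ap, P.actR_mul, sg_add]

theorem th_opR (p : ℤ) {i : ℤ} (q : P.M) {a : A.R} (ha : a ∈ A.gr i) (t : B.M ⊗[k] A.R) :
    th B P (i + p) (P.actL a q) t = sgnz (p * i) • th B P p q (OpR B i a t) := by
  induction t using TensorProduct.induction_on with
  | zero => simp
  | add _ _ h1 h2 => simp only [map_add, h1, h2, smul_add]
  | tmul u c => rw [th_ap, OpR_ap, th_ap, sg_actR p ha, map_zsmul, LinearMap.smul_apply, sgnz_smul_smul,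
      bp_rel, P.actLR, add_comm, sg_add]

theorem th_deg {p n : ℤ} {q : P.M} (hq : q ∈ P.gm p) {t} (ht : t ∈ tenGrade B.gm A.gr n) :
    th B P p q t ∈ (BP B P).gm (n + p) := by
  induction ht using ten_ind (V := dA A) with
  | h0 => rw [map_zero]; exact zero_mem _
  | ha a b _ _ h1 h2 => rw [map_add]; exact add_mem h1 h2
  | h i j u c hu hc e => exact bp_mem (sg_mem' B.gm p hu) (P.actR_deg _ _ _ _ hc hq) (by omega)

theorem th_mem {p n m : ℤ} {q : P.M} (hq : q ∈ P.gm p) {f : X.M →ₗ[k] B.M ⊗[k] A.R}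
    (hf : f ∈ HomG X (TT B (dA A)) n) (e : n + p = m) : th B P p q ∘ₗ f ∈ HomG X (BP B P) m := by
  subst e
  refine ⟨fun j x hx => mem_cast (gm := (BP B P).gm) (th_deg hq (hf.1 j x hx)) (by ring),
    fun l x hx y => ?_, fun x y => ?_⟩
  · rw [LinearMap.comp_apply, LinearMap.comp_apply, hf.2.1 l x hx, map_zsmul, th_L p q hx, smul_smul,
      mul_add, sgnz_add]
  · rw [LinearMap.comp_apply, LinearMap.comp_apply, hf.2.2, th_R]

theorem th_dl {p n m : ℤ} {q : P.M} (hq : q ∈ P.gm p) (f : X.M →ₗ[k] B.M ⊗[k] A.R) (e : n + p = m) :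
    dl X (BP B P) m (th B P p q ∘ₗ f) = th B P (p + 1) (P.D q) ∘ₗ f
      + sgnz p • th B P p q ∘ₗ dl X (TT B (dA A)) n f := by
  subst e
  ext x
  rw [dl_apply]
  change _ - sgnz (n + p) • th B P p q (f (X.D x)) = th B P (p + 1) (P.D q) (f x)
    + sgnz p • th B P p q (dl X (TT B (dA A)) n f x)
  rw [LinearMap.comp_apply, th_D hq, dlT, map_sub, map_zsmul, smul_sub, smul_smul, ← sgnz_add, add_comm p n]
  abel

variable (m : ℤ)
def G0 (B P : DGBimod A) (m : ℤ) : P.M →ₗ[k] (H2 P B).T →ₗ[k] (P.M →ₗ[k] (BP B P).E) :=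
  glue P.gm (N := (H2 P B).T →ₗ[k] (P.M →ₗ[k] (BP B P).E)) fun p =>
    (LinearMap.llcomp k P.M (B.M ⊗[k] A.R) (BP B P).E ∘ₗ th B P p).compl₂ ((H2 P B).tcomp (m - p))

theorem G0_ap {p l : ℤ} {q : P.M} (hq : q ∈ P.gm p) {f} (hf : f ∈ (H2 P B).gm l) (h : l + p = m) :
    G0 B P m q ((H2 P B).tin l f) = th B P p q ∘ₗ f := by
  obtain rfl : l = m - p := by omega
  rw [G0, glue_mem P.gm (N := (H2 P B).T →ₗ[k] (P.M →ₗ[k] (BP B P).E)) _ hq]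
  change th B P p q ∘ₗ ((H2 P B).tcomp (m - p) ((H2 P B).tin (m - p) f)) = _
  rw [(H2 P B).tcomp_same hf]

theorem G0_ne {p l : ℤ} {q : P.M} (hq : q ∈ P.gm p) {f} (hf : f ∈ (H2 P B).gm l) (h : l + p ≠ m) :
    G0 B P m q ((H2 P B).tin l f) = 0 := by
  rw [G0, glue_mem P.gm (N := (H2 P B).T →ₗ[k] (P.M →ₗ[k] (BP B P).E)) _ hq]
  change th B P p q ∘ₗ ((H2 P B).tcomp (m - p) ((H2 P B).tin l f)) = _
  rw [(H2 P B).tcomp_ne hf (by omega), LinearMap.comp_zero]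

def gam (L : (P.M →ₗ[k] (BP B P).E) →ₗ[k] k) : P.M →ₗ[k] (H2 P B).T →ₗ[k] k :=
  (G0 B P m).compr₂ L
end

section
variable {N : PN A}
theorem dB_L (φ : N.T →ₗ[k] k) {i l : ℤ} {a : A.R} (ha : a ∈ A.gr i) {f : N.E} (hf : f ∈ N.gm l) :
    (dualB (tot N)).aL a φ (N.tin l f) = sgnz i • φ (N.tin (l + i) (N.aR i l a f)) := by
  change φ (N.tR (sg A.gr 1 a) (N.tin l f)) = _
  rw [sg_mem A.gr 1 ha, one_mul, ← sgnk_smul (k := k), map_smul, LinearMap.smul_apply, map_smul, N.tR_tin ha hf, sgnk_smul]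

theorem dB_R (φ : N.T →ₗ[k] k) {i l : ℤ} {a : A.R} (ha : a ∈ A.gr i) {f : N.E} (hf : f ∈ N.gm l) :
    (dualB (tot N)).aR a φ (N.tin l f) = φ (N.tin (i + l) (N.aL i l a f)) := by
  change φ (N.tL a (N.tin l f)) = _
  rw [N.tL_tin ha hf]

theorem dB_D (φ : N.T →ₗ[k] k) {l : ℤ} {f : N.E} (hf : f ∈ N.gm l) :
    (dualB (tot N)).D φ (N.tin l f) = sgnz l • φ (N.tin (l + 1) (N.D l f)) := by
  change φ (N.tD (sg N.tgm 1 (N.tin l f))) = _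
  rw [sg_mem N.tgm 1 (N.tin_mem hf), one_mul, ← sgnk_smul (k := k), map_smul, map_smul, N.tD_tin hf, sgnk_smul]

theorem dB_ext {φ ψ : N.T →ₗ[k] k} (h : ∀ l, ∀ f ∈ N.gm l, φ (N.tin l f) = ψ (N.tin l f)) : φ = ψ := by
  refine LinearMap.ext fun m => ?_
  induction m using N.tin_ind with
  | h0 => simp
  | ha a b h1 h2 => simp only [map_add, h1, h2]
  | h n m hm => exact h n m hm
end

theorem gam_Zh {P B : DGBimod A} (m : ℤ) (L : (P.M →ₗ[k] (BP B P).E) →ₗ[k] k)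
    (hL : ∀ f ∈ Bh P (BP B P) m, L f = 0) : gam m L ∈ Zh P (dualB (tot (H2 P B))) (-m) := by
  have g1 : ∀ {p l : ℤ} {q : P.M} (hq : q ∈ P.gm p) {f} (hf : f ∈ (H2 P B).gm l) (h : l + p = m),
    gam m L q ((H2 P B).tin l f) = L (th B P p q ∘ₗ f) := fun hq f hf h => congrArg L (G0_ap m hq hf h)
  have g2 : ∀ {p l : ℤ} {q : P.M} (hq : q ∈ P.gm p) {f} (hf : f ∈ (H2 P B).gm l) (h : l + p ≠ m),
    gam m L q ((H2 P B).tin l f) = 0 := fun hq f hf h =>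
      (congrArg L (G0_ne m hq hf h)).trans (map_zero L)
  refine Zh_of (HomG_of ?_ ?_ ?_) ?_
  · rintro p q hq l hl _ ⟨f, hf, rfl⟩
    exact g2 hq hf (by omega)
  · intro i a ha p q hq
    apply dB_ext
    intro l f hf
    refine Eq.trans ?_ (congrArg (fun z => sgnz (i * -m) • z) (dB_L (N := H2 P B) (gam m L q) ha hf)).symm
    have h1 := P.actL_deg _ _ _ _ ha hq
    have h2 := (H2 P B).aR_deg i l a ha f hf
    by_cases h : l + (i + p) = m
    · rw [g1 h1 hf h, g1 hq h2 (by omega)]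
      have e : th B P (i + p) (P.actL a q) ∘ₗ f
          = sgnz (p * i + i * l) • (th B P p q ∘ₗ (((H2 P B).aR i l a) f)) := by
        ext x
        change th B P (i + p) (P.actL a q) (f x)
          = sgnz (p * i + i * l) • th B P p q (sgnz (i * l) • OpR B i a (f x))
        rw [th_opR p q ha, map_zsmul, smul_smul, sgnz_add, mul_assoc, sgnz_sq, mul_one]
      rw [e, map_zsmul, smul_smul]
      congr 1
      rw [← h, mul_neg, sgnz_neg, mul_add, mul_add, sgnz_add, sgnz_add, sgnz_add, sgnz_mul_self, mul_comm p i]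
      rcases sgnz_cases i with h | h <;> simp [h, mul_comm]
    · rw [g2 h1 hf h, g2 hq h2 (by omega)]; simp
  · intro i a ha p q hq
    apply dB_ext
    intro l f hf
    refine Eq.trans ?_ (dB_R (N := H2 P B) (gam m L q) ha hf).symm
    have h1 := P.actR_deg _ _ _ _ ha hq
    have h2 := (H2 P B).aL_deg i l a ha f hf
    by_cases h : l + (p + i) = m
    · rw [g1 h1 hf h, g1 hq h2 (by omega)]
      congr 1
      ext x
      exact th_opL p i q a _
    · rw [g2 h1 hf h, g2 hq h2 (by omega)]
  · intro p q hq
    apply dB_ext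
    intro l f hf
    refine (dB_D (N := H2 P B) (gam m L q) hf).trans ?_
    have h1 := P.D_deg _ _ hq
    have h2 := (H2 P B).D_deg l f hf
    change _ = sgnz (-m) • gam m L (P.D q) ((H2 P B).tin l f)
    by_cases h : l + (p + 1) = m
    · rw [g1 h1 hf h, g1 hq h2 (by omega)]
      have hb : L (dl P (BP B P) (m - 1) (th B P p q ∘ₗ f)) = 0 :=
        hL _ ⟨_, th_mem hq hf (by omega), rfl⟩
      rw [th_dl hq f (n := l) (by omega), map_add, map_zsmul] at hb
      have hb' : L (th B P p q ∘ₗ (H2 P B).D l f) = - sgnz p • L (th B P (p + 1) (P.D q) ∘ₗ f) := by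
        rw [neg_smul, ← smul_neg, ← add_eq_zero_iff_eq_neg'.mp hb, sgnz_smul_smul]
      rw [hb', smul_smul, ← h, sgnz_neg, sgnz_add, sgnz_add, sgnz_one]
      congr 1; ring
    · rw [g2 h1 hf h, g2 hq h2 (by omega)]; simp

theorem sgnz_par {x y : ℤ} (h : Even (x - y)) : sgnz x = sgnz y := by
  unfold sgnz
  rw [Int.even_sub] at h
  simp [h]

theorem Tw.sum {T : DGBimod A} (W : Tw T) {N : PB A} {n : ℤ} {f : T.M →ₗ[k] N.E}
    (hf : f ∈ HomG T N n) : f = ∑ j, W.frm N n j (f (W.e j)) := by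
  refine W.ext hf (sum_mem fun j _ => W.frm_mem N n j (mem_cast (hf.1 _ _ (W.he j)) (by ring))) fun l => ?_
  rw [LinearMap.sum_apply, Finset.sum_eq_single l (fun j _ h => ?_) (by simp), W.frm_e, if_pos rfl]
  rw [W.frm_e, if_neg h.symm]

section
variable {T P B : DGBimod A} (W : Tw T) (ι : BimodHom P T)
/-- elementary maps -/
def fe (B : DGBimod A) (b : ℤ) (j : Fin W.s) : B.M →ₗ[k] (P.M →ₗ[k] B.M ⊗[k] A.R) :=
  LinearMap.lcomp k (B.M ⊗[k] A.R) ι.f ∘ₗ W.frm (TT B (dA A)) (b + W.r j) j ∘ₗ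
    (TensorProduct.mk k B.M A.R).flip 1

theorem fe_mem {b : ℤ} (j : Fin W.s) {ν : B.M} (h : ν ∈ B.gm b) :
    fe W ι B b j ν ∈ (H2 P B).gm (b + W.r j) :=
  precomp_HomG ι (W.frm_mem (TT B (dA A)) _ j (tmul_mem_ten (V := dA A) h A.one_mem (by ring)))

theorem fe_op {b i m : ℤ} (j : Fin W.s) {ν : B.M} (h : ν ∈ B.gm b) {O} (hO : OpOk B i O) (e : b + W.r j + i = m) :
    O ∘ₗ fe W ι B b j ν = W.frm (TT B (dA A)) m j (O (ν ⊗ₜ 1)) ∘ₗ ι.f := by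
  subst e
  have h1 := tmul_mem_ten (U := B) (V := dA A) h A.one_mem (add_zero b)
  have := W.ext (hO.mem (W.frm_mem (TT B (dA A)) (b + W.r j) j (mem_cast h1 (by ring))) rfl)
    (W.frm_mem (TT B (dA A)) (b + W.r j + i) j (mem_cast (hO.deg _ _ h1) (by ring))) fun l => by
      refine (congrArg O (W.frm_e (TT B (dA A)) _ j l _)).trans ?_
      rw [W.frm_e]
      split_ifs <;> simp
  exact congrArg (· ∘ₗ ι.f) this

def gh (g : P.M →ₗ[k] (H2 P B).T →ₗ[k] k) (j : Fin W.s) : B.M →ₗ[k] P.M →ₗ[k] k :=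
  glue B.gm (N := P.M →ₗ[k] k) fun b =>
    (g ∘ₗ sg P.gm b).flip ∘ₗ (H2 P B).tin (b + W.r j) ∘ₗ fe W ι B b j

theorem gh_ap (g : P.M →ₗ[k] (H2 P B).T →ₗ[k] k) (j : Fin W.s) {b p : ℤ} {ν : B.M} {q : P.M}
    (h : ν ∈ B.gm b) (hq : q ∈ P.gm p) : gh W ι g j ν q =
      sgnz (b * p) • g q ((H2 P B).tin (b + W.r j) (fe W ι B b j ν)) := by
  rw [gh, glue_mem B.gm (N := P.M →ₗ[k] k) _ h]
  change g (sg P.gm b q) _ = _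
  rw [sg_mem P.gm b hq, map_zsmul, LinearMap.smul_apply]
  rfl

variable {g : P.M →ₗ[k] (H2 P B).T →ₗ[k] k} {m : ℤ}

theorem gh_bal (hg : g ∈ HomG P (dualB (tot (H2 P B))) (-m - 1)) (j : Fin W.s) (a : A.R) (ν : B.M) (q : P.M) :
    gh W ι g j (B.actR a ν) q = gh W ι g j ν (P.actL a q) := by
  induction a using gr_induction A.gr with
  | h0 => simp
  | ha x y hx hy => simp only [map_add, LinearMap.add_apply, hx, hy]
  | h i a ha =>
  induction ν using gr_induction B.gm with
  | h0 => simp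
  | ha x y hx hy => simp only [map_add, LinearMap.add_apply, hx, hy]
  | h b ν hν =>
  induction q using gr_induction P.gm with
  | h0 => simp
  | ha x y hx hy => simp only [map_add, hx, hy]
  | h p q hq =>
  have hf := fe_mem W ι j hν
  rw [gh_ap W ι g j (B.actR_deg _ _ _ _ ha hν) hq, gh_ap W ι g j hν (P.actL_deg _ _ _ _ ha hq)]
  have e1 : g (P.actL a q) ((H2 P B).tin (b + W.r j) (fe W ι B b j ν)) = sgnz (i * (-m - 1)) • sgnz i •
      g q ((H2 P B).tin (b + W.r j + i) ((H2 P B).aR i (b + W.r j) a (fe W ι B b j ν))) := by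
    rw [hg.2.1 i a ha q]
    exact congrArg (fun z => sgnz (i * (-m - 1)) • z) (dB_L (N := H2 P B) (g q) ha hf)
  have e2 : (H2 P B).aR i (b + W.r j) a (fe W ι B b j ν) = sgnz (i * W.r j) • fe W ι B (b + i) j (B.actR a ν) := by
    have h1 := fe_op W ι j hν (OpR_ok ha) (m := b + i + W.r j) (by ring)
    rw [OpR_ap, sg_mem B.gm i hν, map_zsmul] at h1
    refine LinearMap.ext fun x => ?_
    change sgnz (i * (b + W.r j)) • (OpR B i a ∘ₗ fe W ι B b j ν) x = _
    rw [h1, ← TensorProduct.smul_tmul', map_zsmul, LinearMap.smul_comp, LinearMap.smul_apply, smul_smul, ← sgnz_add,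
      LinearMap.smul_apply]
    rw [show i * (b + W.r j) + i * b = i * W.r j + (i*b + i*b) by ring, sgnz_add _ (i*b+i*b), sgnz_add (i*b), sgnz_sq, mul_one]
    rfl
  rw [e1, e2, map_zsmul, map_zsmul, (H2 P B).tin_congr (show b + W.r j + i = b + i + W.r j by ring) rfl]
  by_cases h : b + i + W.r j + p = m + 1
  · rw [smul_smul, smul_smul, smul_smul, ← sgnz_add, ← sgnz_add, ← sgnz_add]
    congr 1
    refine sgnz_par ?_
    rw [show (b + i) * p - (b * (i + p) + i * (-m - 1) + i + i * W.r j) = 2 * (i * p) + i * (i - 1) by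
      rw [show m = b + i + W.r j + p - 1 by omega]; ring]
    exact (even_two_mul _).add (Int.even_mul_pred_self i)
  · have : g q ((H2 P B).tin (b + i + W.r j) (fe W ι B (b + i) j (B.actR a ν))) = 0 :=
      hg.1 p q hq (b + i + W.r j) (by omega) _ ⟨_, fe_mem W ι j (B.actR_deg _ _ _ _ ha hν), rfl⟩
    simp [this]

/-- the pairing on `B ⊗_A P` -/
def gb (hg : g ∈ HomG P (dualB (tot (H2 P B))) (-m - 1)) (j : Fin W.s) : (BP B P).E →ₗ[k] k :=
  bpl (gh W ι g j) (gh_bal W ι hg j)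

theorem gb_th (hg : g ∈ HomG P (dualB (tot (H2 P B))) (-m - 1)) (j : Fin W.s) {p l : ℤ} {q : P.M}
    (hq : q ∈ P.gm p) {y : B.M ⊗[k] A.R} (hy : y ∈ tenGrade B.gm A.gr (l - W.r j)) :
    gb W ι hg j (th B P p q y) = g q ((H2 P B).tin l (W.frm (TT B (dA A)) l j y ∘ₗ ι.f)) := by
  induction hy using ten_ind (V := dA A) with
  | h0 => rw [map_zero, map_zero, map_zero, LinearMap.zero_comp, map_zero, map_zero]
  | ha a b _ _ h1 h2 => rw [map_add, map_add, map_add, LinearMap.add_comp, map_add, map_add, h1, h2]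
  | h b s ν c hν hc e =>
    have hf := fe_mem W ι j hν
    change gh W ι g j (sg B.gm p ν) (P.actR c q) = _
    have h1 := fe_op W ι j hν (OpL_ok hc) (m := l) (by omega)
    rw [OpL_ap, sg_mem B.gm s hν, mul_one, ← TensorProduct.smul_tmul', map_zsmul, LinearMap.smul_comp] at h1
    have e1 : g (P.actR c q) ((H2 P B).tin (b + W.r j) (fe W ι B b j ν)) = sgnz (s * b) •
        g q ((H2 P B).tin l (W.frm (TT B (dA A)) l j (ν ⊗ₜ c) ∘ₗ ι.f)) := by
      rw [hg.2.2 c q]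
      refine (dB_R (N := H2 P B) (g q) hc hf).trans ((congrArg (g q)
        ((H2 P B).tin_congr (show s + (b + W.r j) = l by omega) h1)).trans ?_)
      rw [map_zsmul, map_zsmul]
    rw [sg_mem B.gm p hν, map_zsmul, LinearMap.smul_apply, gh_ap W ι g j hν (P.actR_deg _ _ _ _ hc hq), e1,
      smul_smul, smul_smul, ← sgnz_add, ← sgnz_add, sgnz_par (y := 0), sgnz_zero, one_smul]
    rw [show p * b + b * (p + s) + s * b - 0 = 2 * (p * b + s * b) by ring]
    exact even_two_mul _

/-- the pairing -/
def pr (hg : g ∈ HomG P (dualB (tot (H2 P B))) (-m - 1)) : (T.M →ₗ[k] (BP B P).E) →ₗ[k] k :=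
  ∑ j, gb W ι hg j ∘ₗ LinearMap.applyₗ (W.e j)

theorem pr_th (hg : g ∈ HomG P (dualB (tot (H2 P B))) (-m - 1)) {p l : ℤ} {q : P.M}
    (hq : q ∈ P.gm p) {f : T.M →ₗ[k] B.M ⊗[k] A.R} (hf : f ∈ HomG T (TT B (dA A)) l) :
    pr W ι hg (th B P p q ∘ₗ f) = g q ((H2 P B).tin l (f ∘ₗ ι.f)) := by
  have e : (H2 P B).tin l (f ∘ₗ ι.f) =
      ∑ j, (H2 P B).tin l (W.frm (TT B (dA A)) l j (f (W.e j)) ∘ₗ ι.f) := by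
    conv_lhs => rw [W.sum hf]
    rw [← map_sum]
    congr 1
    exact LinearMap.ext fun x => by simp only [LinearMap.comp_apply, LinearMap.sum_apply]
  rw [e, map_sum, pr, LinearMap.sum_apply]
  exact Finset.sum_congr rfl fun j _ => gb_th W ι hg j hq (mem_cast (hf.1 _ _ (W.he j)) (by ring))

theorem pr_L (hg : g ∈ HomG P (dualB (tot (H2 P B))) (-m - 1)) (L : (P.M →ₗ[k] (BP B P).E) →ₗ[k] k)
    (hL : ∀ x, gam m L x = (dualB (tot (H2 P B))).D (g x) + sgnz (-m) • g (P.D x))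
    {s : T.M →ₗ[k] (BP B P).E} (hs : s ∈ HomG T (BP B P) m) :
    L (s ∘ₗ ι.f) = sgnz m • pr W ι hg (dl T (BP B P) m s) := by
  have key : ∀ {p l : ℤ} {q : P.M} (hq : q ∈ P.gm p) {f : T.M →ₗ[k] B.M ⊗[k] A.R}
      (hf : f ∈ HomG T (TT B (dA A)) l) (e : l + p = m),
      L ((th B P p q ∘ₗ f) ∘ₗ ι.f) = sgnz m • pr W ι hg (dl T (BP B P) m (th B P p q ∘ₗ f)) := by
    intro p l q hq f hf e
    have hf' : f ∘ₗ ι.f ∈ (H2 P B).gm l := precomp_HomG ι hf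
    have h1 : L ((th B P p q ∘ₗ f) ∘ₗ ι.f) = gam m L q ((H2 P B).tin l (f ∘ₗ ι.f)) :=
      (congrArg L (G0_ap m hq hf' e)).symm
    have h2 : (dualB (tot (H2 P B))).D (g q) ((H2 P B).tin l (f ∘ₗ ι.f)) =
      sgnz l • g q ((H2 P B).tin (l + 1) (dl T (TT B (dA A)) l f ∘ₗ ι.f)) :=
      (dB_D (N := H2 P B) (g q) hf').trans (congrArg (fun z => sgnz l • g q ((H2 P B).tin (l + 1) z))
        (precomp_dl ι (N := TT B (dA A)) l f))
    rw [h1, hL, LinearMap.add_apply, h2, th_dl hq f e, map_add, map_zsmul,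
      pr_th W ι hg (P.D_deg _ _ hq) hf, pr_th W ι hg hq (dl_mem hf), smul_add, smul_smul, ← sgnz_add,
      sgnz_neg, sgnz_par (x := m + p) (y := l) ⟨p, by omega⟩, add_comm]
    rfl
  have key2 : ∀ j, ∀ y ∈ (BP B P).gm (m - W.r j), L (W.frm (BP B P) m j y ∘ₗ ι.f) =
      sgnz m • pr W ι hg (dl T (BP B P) m (W.frm (BP B P) m j y)) := by
    rintro j _ ⟨t, ht, rfl⟩
    induction ht using ten_ind with
    | h0 => simp
    | ha a b _ _ h1 h2 =>
      rw [map_add, map_add, LinearMap.add_comp, map_add, map_add, map_add, h1, h2, smul_add]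
    | h b p ν q hν hq e =>
      have h0 := tmul_mem_ten (U := B) (V := dA A) (sg_mem' B.gm p hν) A.one_mem (add_zero b)
      have h1 := W.frm_mem (TT B (dA A)) (m - p) j (mem_cast h0 (by omega))
      have h2 : W.frm (BP B P) m j (bp B P ν q) =
          th B P p q ∘ₗ W.frm (TT B (dA A)) (m - p) j (sg B.gm p ν ⊗ₜ 1) := by
        refine W.ext (W.frm_mem _ m j (bp_mem hν hq e)) (th_mem hq h1 (by ring)) fun l => ?_
        rw [W.frm_e]
        refine Eq.trans ?_ (congrArg (th B P p q) (W.frm_e (TT B (dA A)) _ j l _)).symm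
        split_ifs
        · rw [th_ap, P.actR_one, sg_sg]
        · rw [map_zero]
      have h3 := key hq h1 (by ring)
      rw [← h2] at h3
      exact h3
  rw [W.sum hs]
  have e : (∑ j, W.frm (BP B P) m j (s (W.e j))) ∘ₗ ι.f = ∑ j, W.frm (BP B P) m j (s (W.e j)) ∘ₗ ι.f :=
    LinearMap.ext fun x => by simp only [LinearMap.comp_apply, LinearMap.sum_apply]
  rw [e, map_sum, map_sum, map_sum, Finset.smul_sum]
  exact Finset.sum_congr rfl fun j _ => key2 j _ (mem_cast (hs.1 _ _ (W.he j)) (by ring))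
end

/-- post-composition with a closed map preserves boundaries -/
theorem Bh_post {P Q : DGBimod A} {N : PB A} {m : ℤ} {f : P.M →ₗ[k] Q.M} (hf : f ∈ Bh P (ofDG Q) 0)
    {ψ : Q.M →ₗ[k] N.E} (hψ : ψ ∈ Zh Q N m) : ψ ∘ₗ f ∈ Bh P N m := by
  obtain ⟨g, hg, h⟩ := Bh_D hf
  refine Bh_of (g := sgnz m • ψ ∘ₗ g) (sgnz_smul_mem _ m ⟨fun j x hx => mem_cast (hψ.1.1 _ _ (hg.1 j x hx)) (by ring),
    fun i x hx y => ?_, fun x y => ?_⟩) fun j x _ => ?_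
  · rw [LinearMap.comp_apply, LinearMap.comp_apply, hg.2.1 i x hx, map_zsmul]
    refine (congrArg (fun z => sgnz (i * (0 - 1)) • z) (hψ.1.2.1 i x hx (g y))).trans ?_
    rw [smul_smul, ← sgnz_add]
    congr 2; ring
  · rw [LinearMap.comp_apply, LinearMap.comp_apply, hg.2.2]
    exact hψ.1.2.2 x (g y)
  · rw [LinearMap.comp_apply, h, sgnz_zero, one_smul, map_add, LinearMap.smul_apply, map_zsmul, LinearMap.comp_apply,
      Zh_D hψ, sgnz_smul_smul, LinearMap.smul_apply, sgnz_smul_smul]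
    rfl

/-- functional on `Hom(P, B ⊗_A P)` -/
def Lf {P B : DGBimod A} (F : BimodHom P (dA A)) (m : ℤ) :
    (UH P (ofDG B) m →ₗ[k] k) →ₗ[k] ((P.M →ₗ[k] (BP B P).E) →ₗ[k] k) :=
  LinearMap.lcomp k k ((((Bh P (ofDG B) m).comap (Zh P (ofDG B) m).subtype).mkQ ∘ₗ prj (Zh P (ofDG B) m)) ∘ₗ
    LinearMap.llcomp k P.M (BP B P).E B.M (Fs0 F))

theorem Lf_ap {P B : DGBimod A} (F : BimodHom P (dA A)) (m : ℤ) (Λ : UH P (ofDG B) m →ₗ[k] k)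
    {f : P.M →ₗ[k] (BP B P).E} (hf : f ∈ Zh P (BP B P) m) :
    Lf F m Λ f = Λ (Submodule.Quotient.mk ⟨Fs0 F ∘ₗ f, Zh_comp (Fs F) hf⟩) :=
  congrArg (fun z => Λ (Submodule.Quotient.mk z)) (prj_mem (Zh P (ofDG B) m) (Zh_comp (Fs F) hf))

theorem Lf_Bh {P B : DGBimod A} (F : BimodHom P (dA A)) (m : ℤ) (Λ : UH P (ofDG B) m →ₗ[k] k)
    (f : P.M →ₗ[k] (BP B P).E) (hf : f ∈ Bh P (BP B P) m) : Lf F m Λ f = 0 := by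
  rw [Lf_ap F m Λ (Bh_le _ _ _ hf), (Submodule.Quotient.mk_eq_zero ((Bh P (ofDG B) m).comap (Zh P (ofDG B) m).subtype)).mpr,
    map_zero]
  exact Bh_comp (Fs F) hf

theorem dual_emb {P B : DGBimod A} {F : BimodHom P (dA A)} (hP : IsHoProjB P) (hq : QI (PBHom.ofDG F))
    {T : DGBimod A} (W : Tw T) (ι : BimodHom P T) (ρ : BimodHom T P)
    (hr : ρ.f ∘ₗ ι.f - LinearMap.id ∈ Bh P (ofDG P) 0)
    {β : PBHom (ofDG B) (dualB (dA A))} (hβ : QI β) (hC : CDat B β) (m : ℤ) :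
    ∃ j : (UH P (ofDG B) m →ₗ[k] k) →ₗ[k] UH P (ofDG B) (-m), Function.Injective j := by
  obtain ⟨z⟩ := zigzag hP hq hβ hC (-m)
  let j0 : (UH P (ofDG B) m →ₗ[k] k) →ₗ[k] Zh P (dualB (tot (H2 P B))) (-m) :=
    { toFun := fun Λ => ⟨gam m (Lf F m Λ), gam_Zh m _ (Lf_Bh F m Λ)⟩
      map_add' := fun a b => Subtype.ext (LinearMap.ext fun x => LinearMap.ext fun y => rfl)
      map_smul' := fun a b => Subtype.ext (LinearMap.ext fun x => LinearMap.ext fun y => rfl) }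
  refine ⟨z.symm.toLinearMap ∘ₗ ((Bh P (dualB (tot (H2 P B))) (-m)).comap
    (Zh P (dualB (tot (H2 P B))) (-m)).subtype).mkQ ∘ₗ j0, ?_⟩
  rw [LinearMap.coe_comp]
  refine z.symm.injective.comp ((injective_iff_map_eq_zero _).mpr fun Λ h => ?_)
  have h : gam m (Lf F m Λ) ∈ Bh P (dualB (tot (H2 P B))) (-m) :=
    (Submodule.Quotient.mk_eq_zero ((Bh P (dualB (tot (H2 P B))) (-m)).comap
      (Zh P (dualB (tot (H2 P B))) (-m)).subtype)).mp h
  obtain ⟨g, hg, hL⟩ := Bh_D h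
  apply LinearMap.ext
  rintro ⟨⟨φ, hφ⟩⟩
  obtain ⟨ψ, hψ, e⟩ := L_surj hP (Fs_qi F hP hq) hφ
  have h1 := pr_L W ι hg (Lf F m Λ) hL (precomp_Zh ρ hψ).1
  rw [show dl T (BP B P) m _ = 0 from (precomp_Zh ρ hψ).2, map_zero, smul_zero] at h1
  have h2 := Lf_Bh F m Λ _ (Bh_post hr hψ)
  have h3 : (ψ ∘ₗ ρ.f) ∘ₗ ι.f = ψ ∘ₗ (ρ.f ∘ₗ ι.f - LinearMap.id) + ψ :=
    LinearMap.ext fun x => by simp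
  rw [h3, map_add, h2, zero_add, Lf_ap F m Λ hψ] at h1
  refine Eq.trans (congrArg Λ ?_) h1
  exact ((Submodule.Quotient.eq ((Bh P (ofDG B) m).comap (Zh P (ofDG B) m).subtype)).mpr e).symm

section
variable (P : DGBimod A)
theorem grp_comm (j : ℤ) {x : P.M} (hx : x ∈ commSub P) : grp P.gm j x ∈ commSub P := by
  suffices commSub P ≤ (commSub P).comap (grp P.gm j) from this hx
  refine Submodule.span_le.mpr ?_
  rintro _ ⟨i, l, a, m, ha, hm, rfl⟩
  have h : P.actL a m - sgnz (i * l) • P.actR a m ∈ P.gm (i + l) :=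
    sub_mem (P.actL_deg _ _ _ _ ha hm) (sgnz_smul_mem _ _ (mem_cast (P.actR_deg _ _ _ _ ha hm) (add_comm _ _)))
  change grp P.gm j _ ∈ commSub P
  by_cases e : i + l = j
  · subst e; rw [grp_same P.gm h]; exact Submodule.subset_span ⟨i, l, a, m, ha, hm, rfl⟩
  · rw [grp_ne P.gm h e]; exact zero_mem _

theorem grp_D (j : ℤ) (x : P.M) : grp P.gm (j + 1) (P.D x) = P.D (grp P.gm j x) := by
  induction x using gr_induction P.gm with
  | h0 => simp
  | ha a b h1 h2 => simp only [map_add, h1, h2]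
  | h l x hx =>
    by_cases e : l = j
    · subst e; rw [grp_same P.gm hx, grp_same P.gm (P.D_deg _ _ hx)]
    · rw [grp_ne P.gm hx e, grp_ne P.gm (P.D_deg _ _ hx) (by omega), map_zero]

/-- traces of degree `n` -/
def Tr (n : ℤ) (t : P.M →ₗ[k] k) : Prop :=
  (∀ x ∈ commSub P, t x = 0) ∧ ∀ x, t (grp P.gm n x) = t x

variable {P}
theorem Tr.ne {n l : ℤ} {t : P.M →ₗ[k] k} (h : Tr P n t) {x : P.M} (hx : x ∈ P.gm l) (e : l ≠ n) : t x = 0 := by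
  rw [← h.2, grp_ne P.gm hx e, map_zero]

theorem Tr.grp {t : P.M →ₗ[k] k} (h : ∀ x ∈ commSub P, t x = 0) (n : ℤ) : Tr P n (t ∘ₗ grp P.gm n) :=
  ⟨fun x hx => h _ (grp_comm P n hx), fun x => by
    rw [LinearMap.comp_apply, LinearMap.comp_apply, grp_same P.gm (grp_mem P.gm n x)]⟩

theorem Tr.LR {n : ℤ} {t : P.M →ₗ[k] k} (h : Tr P n t) {i j : ℤ} {a : A.R} {x : P.M} (ha : a ∈ A.gr i) (hx : x ∈ P.gm j) :
    t (P.actL a x) = sgnz (i * j) • t (P.actR a x) := by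
  have := h.1 _ (Submodule.subset_span ⟨i, j, a, x, ha, hx, rfl⟩)
  rw [map_sub, map_zsmul] at this
  exact sub_eq_zero.mp this

def lamf (t : P.M →ₗ[k] k) : P.M →ₗ[k] A.R →ₗ[k] k := P.actR.flip.compr₂ t

theorem lamf_mem {m : ℤ} {t : P.M →ₗ[k] k} (h : Tr P (-m) t) : lamf t ∈ HomG P (dualB (dA A)) m := by
  refine HomG_of ?_ ?_ ?_
  · intro j x hx l hl b hb
    exact h.ne (P.actR_deg _ _ _ _ hb hx) (by omega)
  · intro i a ha j x hx
    apply gr_ext A.gr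
    intro l b hb
    change t (P.actR b (P.actL a x)) = sgnz (i * m) • t (P.actR (b * sg A.gr 1 a) x)
    have hb' := P.actR_deg _ _ _ _ hb hx
    rw [← P.actLR, h.LR ha hb', ← P.actR_mul, sg_mem A.gr 1 ha, mul_smul_comm, map_zsmul,
      LinearMap.smul_apply, map_zsmul]
    by_cases e : j + (l + i) = -m
    · rw [smul_smul, ← sgnz_add]
      congr 1
      refine sgnz_par ?_
      rw [show i * (j + l) - (i * m + 1 * i) = -(2 * (i * m)) - i * (i + 1) by
        rw [show j = -m - l - i by omega]; ring]
      exact (even_two_mul _).neg.sub (Int.even_mul_succ_self i)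
    · rw [h.ne (P.actR_deg _ _ _ _ (A.mul_mem hb ha) hx) e]; simp
  · intro i a ha j x hx
    ext b
    change t (P.actR b (P.actR a x)) = t (P.actR (a * b) x)
    rw [P.actR_mul]

theorem lamf_Zh {m : ℤ} {t : P.M →ₗ[k] k} (h : Tr P (-m) t) (hD : ∀ x, t (P.D x) = 0) :
    lamf t ∈ Zh P (dualB (dA A)) m := by
  refine Zh_of (lamf_mem h) fun j x hx => ?_
  apply gr_ext A.gr
  intro l b hb
  change t (P.actR (A.d (sg A.gr 1 b)) x) = sgnz m • t (P.actR b (P.D x))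
  have := hD (P.actR b x)
  rw [DGleibR _ hx, map_add, map_zsmul, add_eq_zero_iff_eq_neg] at this
  rw [sg_mem A.gr 1 hb, map_zsmul, map_zsmul, LinearMap.smul_apply, map_zsmul, this]
  by_cases e : j + (l + 1) = -m
  · rw [smul_neg, smul_smul, ← sgnz_add, ← neg_smul]
    congr 1
    rw [show m + j = -(l + 1) by omega, sgnz_neg, sgnz_add, sgnz_one, one_mul]; ring
  · rw [h.ne (P.actR_deg _ _ _ _ (A.d_deg _ _ hb) hx) e]; simp

def lam : (P.M →ₗ[k] A.R →ₗ[k] k) →ₗ[k] (P.M →ₗ[k] k) :=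
  LinearMap.llcomp k P.M (A.R →ₗ[k] k) k (LinearMap.applyₗ 1)

theorem lamf_lam {m : ℤ} {f : P.M →ₗ[k] A.R →ₗ[k] k} (hf : f ∈ HomG P (dualB (dA A)) m) : lamf (lam f) = f := by
  ext x b
  change f (P.actR b x) 1 = _
  rw [hf.2.2]
  change f x (b * 1) = _
  rw [mul_one]

theorem lam_Tr {m : ℤ} {f : P.M →ₗ[k] A.R →ₗ[k] k} (hf : f ∈ HomG P (dualB (dA A)) m) : Tr P (-m) (lam f) := by
  have h2 : ∀ l, ∀ x ∈ P.gm l, l ≠ -m → lam f x = 0 := fun l x hx e =>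
    hf.1 l x hx 0 (by omega) 1 A.one_mem
  refine ⟨?_, ?_⟩
  · suffices commSub P ≤ LinearMap.ker (lam f) from fun x hx => this hx
    refine Submodule.span_le.mpr ?_
    rintro _ ⟨i, j, a, x, ha, hx, rfl⟩
    have e1 : lam f (P.actL a x) = sgnz (i * m) • sgnz i • lam f (P.actR a x) := by
      change f (P.actL a x) 1 = sgnz (i * m) • sgnz i • f (P.actR a x) 1
      rw [hf.2.1 i a ha x, hf.2.2 a x]
      change sgnz (i * m) • f x (1 * sg A.gr 1 a) = sgnz (i * m) • sgnz i • f x (a * 1)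
      rw [sg_mem A.gr 1 ha, one_mul, mul_one, map_zsmul, one_mul]
    change lam f _ = 0
    rw [map_sub, map_zsmul, e1]
    by_cases e : j + i = -m
    · rw [smul_smul, ← sgnz_add, sub_eq_zero]
      congr 1
      refine sgnz_par ?_
      rw [show i * m + i - i * j = -(2 * (i * j)) - i * (i - 1) by
        rw [show m = -j - i by omega]; ring]
      exact (even_two_mul _).neg.sub (Int.even_mul_pred_self i)
    · rw [h2 _ _ (P.actR_deg _ _ _ _ ha hx) e]; simp
  · intro x
    induction x using gr_induction P.gm with
    | h0 => simp
    | ha a b h1 h2 => simp only [map_add, h1, h2]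
    | h l x hx =>
      by_cases e : l = -m
      · subst e; rw [grp_same P.gm hx]
      · rw [grp_ne P.gm hx e, h2 _ _ hx e, map_zero]

theorem lam_D (φ : A.R →ₗ[k] k) : (dualB (dA A)).D φ (1 : A.R) = 0 := by
  change φ (A.d (sg A.gr 1 1)) = 0
  rw [A_sg_one, A_d_one, map_zero]

theorem lam_Zh {m : ℤ} {f : P.M →ₗ[k] A.R →ₗ[k] k} (hf : f ∈ Zh P (dualB (dA A)) m) (x : P.M) : lam f (P.D x) = 0 := by
  have := LinearMap.congr_fun (Zh_D hf x) (1 : A.R)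
  rw [lam_D] at this
  have h : lam f (P.D x) = sgnz m • sgnz m • lam f (P.D x) := (sgnz_smul_smul _ _).symm
  rw [h, show sgnz m • lam f (P.D x) = 0 from this.symm, smul_zero]

theorem dual_fac {V W : Type} [AddCommGroup V] [Module k V] [AddCommGroup W] [Module k W] (f : V →ₗ[k] W)
    (t : V →ₗ[k] k) (h : ∀ x, f x = 0 → t x = 0) : ∃ s : W →ₗ[k] k, ∀ x, s (f x) = t x := by
  have : t ∈ LinearMap.range f.dualMap := by
    rw [LinearMap.range_dualMap_eq_dualAnnihilator_ker, Submodule.mem_dualAnnihilator]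
    exact h
  obtain ⟨s, rfl⟩ := this
  exact ⟨s, fun x => rfl⟩

abbrev HV (P : DGBimod A) (n : ℤ) : Type :=
  ↥(HHZ P n) ⧸ (Submodule.comap (HHZ P n).subtype (HHB P n ⊓ HHZ P n))

def HVe (P : DGBimod A) (n : ℤ) : HHspace P n ≃ₗ[k] HV P n :=
  { toFun := fun x => x, invFun := fun x => x, map_add' := fun _ _ => rfl, map_smul' := fun _ _ => rfl,
    left_inv := fun _ => rfl, right_inv := fun _ => rfl }

theorem U_dual (P : DGBimod A) (m : ℤ) : Nonempty (UH P (dualB (dA A)) m ≃ₗ[k] (HV P (-m) →ₗ[k] k)) := by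
  have hk : ∀ f : Zh P (dualB (dA A)) m, ∀ x ∈ HHB P (-m), lam f.1 x = 0 := by
    intro f x hx
    obtain ⟨y, hy, _, ⟨z, rfl⟩, rfl⟩ := Submodule.mem_sup.mp hx.2
    rw [map_add, (lam_Tr f.2.1).1 y hy, lam_Zh f.2, add_zero]
  let Θ0 : Zh P (dualB (dA A)) m →ₗ[k] (HV P (-m) →ₗ[k] k) :=
    { toFun := fun f => Submodule.liftQ _ (lam f.1 ∘ₗ (HHZ P (-m)).subtype) fun x hx => hk f _ hx.1
      map_add' := fun f g => LinearMap.ext (by rintro ⟨x⟩; rfl)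
      map_smul' := fun f g => LinearMap.ext (by rintro ⟨x⟩; rfl) }
  have hΘ : ∀ f x, Θ0 f (Submodule.Quotient.mk x) = lam f.1 x.1 := fun f x => rfl
  have hB : ∀ f : Zh P (dualB (dA A)) m, f.1 ∈ Bh P (dualB (dA A)) m ↔ Θ0 f = 0 := by
    intro f
    constructor
    · intro h
      obtain ⟨g, hg, e⟩ := Bh_D h
      apply LinearMap.ext
      rintro ⟨x⟩
      refine (hΘ f x).trans ?_
      change f.1 x.1 1 = 0
      rw [e, LinearMap.add_apply, lam_D, zero_add]
      change sgnz m • lam g (P.D x.1) = 0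
      rw [(lam_Tr hg).1 _ x.2.2, smul_zero]
    · intro h
      obtain ⟨s, hs⟩ := dual_fac ((commSub P).mkQ ∘ₗ P.D) (lam f.1) fun x hx => by
        have hx : P.D x ∈ commSub P := (Submodule.Quotient.mk_eq_zero _).mp hx
        have h1 : grp P.gm (-m) x ∈ HHZ P (-m) := ⟨grp_mem _ _ _, by
          change P.D (grp P.gm (-m) x) ∈ commSub P
          rw [← grp_D]; exact grp_comm P _ hx⟩
        rw [← (lam_Tr f.2.1).2]
        exact (hΘ f ⟨_, h1⟩).symm.trans (LinearMap.congr_fun h _)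
      have ht : Tr P (-(m - 1)) ((s ∘ₗ (commSub P).mkQ) ∘ₗ grp P.gm (-(m - 1))) := Tr.grp (fun x hx => by
        rw [LinearMap.comp_apply, Submodule.mkQ_apply, (Submodule.Quotient.mk_eq_zero _).mpr hx, map_zero]) _
      have hl := lamf_mem ht
      have hl2 : sgnz m • lamf ((s ∘ₗ (commSub P).mkQ) ∘ₗ grp P.gm (-(m - 1))) ∈ HomG P (dualB (dA A)) (m - 1) :=
        sgnz_smul_mem _ m hl
      have hb : dl P (dualB (dA A)) (m - 1) (sgnz m • lamf ((s ∘ₗ (commSub P).mkQ) ∘ₗ grp P.gm (-(m - 1)))) ∈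
        Bh P (dualB (dA A)) m := ⟨_, hl2, rfl⟩
      have hz := (Bh_le _ _ _ hb).1
      have e : lam f.1 = lam (dl P (dualB (dA A)) (m - 1)
          (sgnz m • lamf ((s ∘ₗ (commSub P).mkQ) ∘ₗ grp P.gm (-(m - 1))))) := by
        ext x
        change _ = (dl P (dualB (dA A)) (m - 1) (sgnz m • lamf _)) x (1 : A.R)
        rw [dl_apply, LinearMap.sub_apply, lam_D, zero_sub, sgnz_sub, sgnz_one, ← (lam_Tr f.2.1).2, ← hs]
        change _ = -((sgnz m * -1) • sgnz m • s ((commSub P).mkQ (grp P.gm (-(m - 1)) (P.actR 1 (P.D x)))))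
        rw [P.actR_one, show -(m - 1) = -m + 1 by ring, grp_D, mul_neg, mul_one, neg_smul, neg_neg, sgnz_smul_smul]
        rfl
      rw [← lamf_lam f.2.1, e, lamf_lam hz]
      exact hb
  refine ⟨LinearEquiv.ofBijective (Submodule.liftQ _ Θ0 fun f hf => (hB f).mp hf) ⟨?_, ?_⟩⟩
  · refine (injective_iff_map_eq_zero _).mpr ?_
    rintro ⟨f⟩ h
    exact (Submodule.Quotient.mk_eq_zero ((Bh P (dualB (dA A)) m).comap (Zh P (dualB (dA A)) m).subtype)).mpr ((hB f).mpr h)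
  · intro Λ
    obtain ⟨s, hs⟩ := dual_fac ((commSub P ⊔ LinearMap.range P.D).mkQ ∘ₗ (HHZ P (-m)).subtype)
      (Λ ∘ₗ (Submodule.mkQ _)) fun x hx => by
        have hx : x.1 ∈ commSub P ⊔ LinearMap.range P.D := (Submodule.Quotient.mk_eq_zero _).mp hx
        rw [LinearMap.comp_apply, Submodule.mkQ_apply, (Submodule.Quotient.mk_eq_zero _).mpr, map_zero]
        exact ⟨⟨x.2.1, hx⟩, x.2⟩
    have h0 : ∀ x ∈ commSub P ⊔ LinearMap.range P.D, (s ∘ₗ (commSub P ⊔ LinearMap.range P.D).mkQ) x = 0 :=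
      fun x hx => by rw [LinearMap.comp_apply, Submodule.mkQ_apply, (Submodule.Quotient.mk_eq_zero _).mpr hx, map_zero]
    have ht : Tr P (-m) ((s ∘ₗ (commSub P ⊔ LinearMap.range P.D).mkQ) ∘ₗ grp P.gm (-m)) :=
      Tr.grp (fun x hx => h0 x (Submodule.mem_sup_left hx)) _
    have hz := lamf_Zh ht fun x => by
      rw [LinearMap.comp_apply, show -m = -m - 1 + 1 by ring, grp_D]
      exact h0 _ (Submodule.mem_sup_right ⟨_, rfl⟩)
    refine ⟨Submodule.Quotient.mk ⟨_, hz⟩, LinearMap.ext ?_⟩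
    rintro ⟨x⟩
    refine Eq.trans ?_ (hs x)
    change s ((commSub P ⊔ LinearMap.range P.D).mkQ (grp P.gm (-m) (P.actR 1 x.1))) = _
    rw [P.actR_one, grp_same P.gm x.2.1]
    rfl
end

theorem lin_alg (U V : ℤ → Type) [∀ n, AddCommGroup (U n)] [∀ n, Module k (U n)] [∀ n, AddCommGroup (V n)]
    [∀ n, Module k (V n)] (e : ∀ m, Nonempty (U m ≃ₗ[k] (V (-m) →ₗ[k] k)))
    (h : ∀ m, ∃ j : (U m →ₗ[k] k) →ₗ[k] U (-m), Function.Injective j) (n : ℤ) :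
    ∃ B : V n →ₗ[k] (V (-n) →ₗ[k] k), Function.Bijective B := by
  have r1 : ∀ m, Module.rank k (U m →ₗ[k] k) ≤ Module.rank k (U (-m)) := fun m => by
    obtain ⟨j, hj⟩ := h m
    exact LinearMap.rank_le_of_injective j hj
  have r0 : ∀ m, Module.rank k (U m) ≤ Module.rank k (U m →ₗ[k] k) := fun m => by
    by_cases hm : Cardinal.aleph0 ≤ Module.rank k (U m)
    · exact (rank_lt_rank_dual hm).le
    · have : Module.Finite k (U m) := Module.rank_lt_aleph0_iff.mp (not_le.mp hm)
      refine le_of_eq (Eq.symm ((Module.dual_rank_eq (K := k) (V := U m)).trans (Cardinal.lift_id _)))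
  have fU : ∀ m, Module.Finite k (U m) := fun m => by
    by_contra hf
    have hm : Cardinal.aleph0 ≤ Module.rank k (U m) := not_lt.mp fun h => hf (Module.rank_lt_aleph0_iff.mp h)
    have h1 := r1 (-m)
    rw [neg_neg] at h1
    exact ((((rank_lt_rank_dual hm).trans_le (r1 m)).trans_le (r0 (-m))).trans_le h1).false
  have fr : ∀ m, Module.finrank k (U m) ≤ Module.finrank k (U (-m)) := fun m => by
    have := fU m
    have := fU (-m)
    obtain ⟨j, hj⟩ := h m
    have := LinearMap.finrank_le_finrank_of_injective hj
    rwa [show Module.finrank k (U m →ₗ[k] k) = Module.finrank k (U m) from Subspace.dual_finrank_eq] at this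
  have fV : ∀ m, Module.Finite k (V m) := fun m => by
    obtain ⟨e⟩ := e (-m)
    rw [neg_neg] at e
    have := fU (-m)
    have : Module.Finite k (Module.Dual k (V m)) := Module.Finite.equiv e
    exact Module.finite_dual_iff k |>.mp this
  have dV : ∀ m, Module.finrank k (V m) = Module.finrank k (U (-m)) := fun m => by
    obtain ⟨e⟩ := e (-m)
    rw [neg_neg] at e
    rw [e.finrank_eq]
    exact Subspace.dual_finrank_eq.symm
  have := fV n
  have := fV (-n)
  have e1 : Module.finrank k (V n) = Module.finrank k (V (-n) →ₗ[k] k) := by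
    rw [dV, show Module.finrank k (V (-n) →ₗ[k] k) = Module.finrank k (V (-n)) from Subspace.dual_finrank_eq, dV]
    exact le_antisymm (fr _) (by have := fr (- -n); rwa [neg_neg (-n)] at this)
  exact ⟨(LinearEquiv.ofFinrankEq _ _ e1).toLinearMap, (LinearEquiv.ofFinrankEq _ _ e1).bijective⟩

theorem main_aux (hc : IsCompactAlg A) (hs : IsSmooth A) (P : DGBimod A) (F : BimodHom P (diagBimod A))
    (hPF : IsDiagResolution P F) (n : ℤ) :
    ∃ B : HHspace P n →ₗ[k] ((HHspace P (-n)) →ₗ[k] k), Function.Bijective B := by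
  obtain ⟨B, β, hβ, hC⟩ := dual_model hc
  obtain ⟨T, W, ι, ρ, hr⟩ := summand hs hPF
  have hq : QI (PBHom.ofDG (Y := dA A) F) := qi_of_data F hPF.2
  refine lin_alg (fun m => UH P (ofDG B) m) (fun n => HHspace P n) (fun m => ?_)
    (fun m => dual_emb hPF.1 hq W ι ρ hr hβ hC m) n
  obtain ⟨u⟩ := U_dual P m
  exact ⟨(Ueq hPF.1 hβ m).trans (u.trans (HVe P (-m)).dualMap)⟩

/-- If `A` is a compact homologically smooth DG algebra over `k`,
then for every `n` there is a canonical non-degenerate pairing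
`HH_n(A) × HH_{-n}(A) → k`, i.e. a bilinear pairing inducing an isomorphism
`HH_n(A) ≅ HH_{-n}(A)^*`.  Hochschild homology is computed from any h-projective
bimodule resolution `F : P → A` of the diagonal. -/
theorem hochschild_duality_pairing {k : Type} [Field k] (A : DGAlgebra k)
    (hc : IsCompactAlg A) (hs : IsSmooth A)
    (P : DGBimod A) (F : BimodHom P (diagBimod A)) (hPF : IsDiagResolution P F) :
    ∀ n : ℤ, ∃ B : HHspace P n →ₗ[k] ((HHspace P (-n)) →ₗ[k] k),
      Function.Bijective B := by
  exact main_aux hc hs P F hPF
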